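/- Let n ≥ 1 and let λ and μ be gl_n-highest weights with integer entries. The Y(gl_n)-module L(λ)⊗L(μ) (tensor product of evaluation modules, both evaluated at 0) is irreducible if and only if the sets A_λ \ A_μ and A_μ \ A_λ are non-crossing. -/

import Mathlib

open scoped TensorProduct

/-- An `n`-tuple of complex numbers is a `gl_n`-highest weight if the consecutive
differences `λ_i - λ_{i+1}` are non-negative integers. -/
def IsGLHighestWeight (n : ℕ) (lam : Fin n → ℂ) : Prop :=
  ∀ i : Fin n, ∀ h : (i : ℕ) + 1 < n, ∃ N : ℕ, lam i - lam ⟨(i : ℕ) + 1, h⟩ = N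

/-- A realization of the irreducible finite-dimensional `gl_n`-module `L(λ)`
with highest weight `lam`, given by the action of the matrix units `E i j`. -/
structure GLRep (n : ℕ) (lam : Fin n → ℂ) where
  V : Type
  [instAddCommGroup : AddCommGroup V]
  [instModule : Module ℂ V]
  [instFiniteDimensional : FiniteDimensional ℂ V]
  E : Fin n → Fin n → (V →ₗ[ℂ] V)
  commRel : ∀ i j k l : Fin n,
    E i j ∘ₗ E k l - E k l ∘ₗ E i j
      = (if j = k then E i l else 0) - (if l = i then E k j else 0)
  hv : V
  hv_ne : hv ≠ 0
  hv_upper : ∀ i j : Fin n, i < j → E i j hv = 0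
  hv_diag : ∀ i : Fin n, E i i hv = lam i • hv
  irreducible : ∀ U : Submodule ℂ V,
    (∀ i j : Fin n, ∀ v ∈ U, E i j v ∈ U) → U = ⊥ ∨ U = ⊤

attribute [instance] GLRep.instAddCommGroup GLRep.instModule GLRep.instFiniteDimensional

/-- The action of the Yangian generator `t_{ij}^{(1)}` on `L(λ) ⊗ L(μ)`
(both evaluation modules evaluated at `0`). -/
noncomputable def t1 {n : ℕ} {lam mu : Fin n → ℂ} (A : GLRep n lam) (B : GLRep n mu)
    (i j : Fin n) : A.V ⊗[ℂ] B.V →ₗ[ℂ] A.V ⊗[ℂ] B.V :=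
  TensorProduct.map (A.E i j) LinearMap.id + TensorProduct.map LinearMap.id (B.E i j)

/-- The action of the Yangian generator `t_{ij}^{(2)}` on `L(λ) ⊗ L(μ)`. -/
noncomputable def t2 {n : ℕ} {lam mu : Fin n → ℂ} (A : GLRep n lam) (B : GLRep n mu)
    (i j : Fin n) : A.V ⊗[ℂ] B.V →ₗ[ℂ] A.V ⊗[ℂ] B.V :=
  ∑ a : Fin n, TensorProduct.map (A.E i a) (B.E a j)

/-- Irreducibility of `L(λ) ⊗ L(μ)` as a module over the Yangian `Y(gl_n)`:
the only subspaces invariant under all the operators `t1` and `t2`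
(the generators `t_{ij}^{(r)}` with `r ≥ 3` acting as zero) are `⊥` and `⊤`. -/
def YangianIrred2 {n : ℕ} {lam mu : Fin n → ℂ} (A : GLRep n lam) (B : GLRep n mu) : Prop :=
  ∀ U : Submodule ℂ (A.V ⊗[ℂ] B.V),
    (∀ i j : Fin n, ∀ v ∈ U, t1 A B i j v ∈ U) →
    (∀ i j : Fin n, ∀ v ∈ U, t2 A B i j v ∈ U) →
    U = ⊥ ∨ U = ⊤

/-- The set `A_λ = {λ_1, λ_2 − 1, …, λ_n − n + 1}` (with `0`-indexed entries). -/
def Aset (n : ℕ) (lam : Fin n → ℤ) : Finset ℤ :=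
  Finset.image (fun i : Fin n => lam i - ((i : ℕ) : ℤ)) Finset.univ

/-- Two finite subsets `A`, `B` of `ℤ` are crossing if there are
`a₁, a₂ ∈ A` and `b₁, b₂ ∈ B` with `a₁ < b₁ < a₂ < b₂` or `b₁ < a₁ < b₂ < a₂`. -/
def CrossingSets (A B : Finset ℤ) : Prop :=
  (∃ a₁ ∈ A, ∃ a₂ ∈ A, ∃ b₁ ∈ B, ∃ b₂ ∈ B, a₁ < b₁ ∧ b₁ < a₂ ∧ a₂ < b₂) ∨
  (∃ a₁ ∈ A, ∃ a₂ ∈ A, ∃ b₁ ∈ B, ∃ b₂ ∈ B, b₁ < a₁ ∧ a₁ < b₂ ∧ b₂ < a₂)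

section C0
variable {V : Type} [AddCommGroup V] [Module ℂ V]

/-- `gl_n` relations, elementwise, for operators indexed by natural numbers. -/
def IsGL (n : ℕ) (E : ℕ → ℕ → V →ₗ[ℂ] V) : Prop :=
  ∀ i j k l, i < n → j < n → k < n → l < n → ∀ x, E i j (E k l x) =
    E k l (E i j x) + (if j = k then E i l x else 0) - (if l = i then E k j x else 0)

def Sing (n : ℕ) (E : ℕ → ℕ → V →ₗ[ℂ] V) (x : V) : Prop :=
  ∀ i j, i < j → j < n → E i j x = 0

def Wt (n : ℕ) (E : ℕ → ℕ → V →ₗ[ℂ] V) (w : ℕ → ℤ) (x : V) : Prop :=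
  ∀ i, i < n → E i i x = (w i : ℂ) • x

def Stb (n : ℕ) (E : ℕ → ℕ → V →ₗ[ℂ] V) (U : Submodule ℂ V) : Prop :=
  ∀ i j, i < n → j < n → ∀ y ∈ U, E i j y ∈ U

def Low (n : ℕ) (E : ℕ → ℕ → V →ₗ[ℂ] V) (x : V) : Submodule ℂ V :=
  sInf {U | x ∈ U ∧ ∀ i j, j < i → i < n → ∀ y ∈ U, E i j y ∈ U}

variable {n : ℕ} {E : ℕ → ℕ → V →ₗ[ℂ] V}

lemma IsGL.mono {m : ℕ} (h : IsGL n E) (hm : m ≤ n) : IsGL m E := by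
  intro i j k l hi hj hk hl x
  exact h i j k l (by omega) (by omega) (by omega) (by omega) x

lemma Sing.mono {m : ℕ} {x : V} (h : Sing n E x) (hm : m ≤ n) : Sing m E x :=
  fun i j hij hj => h i j hij (by omega)

lemma Wt.mono {m : ℕ} {w : ℕ → ℤ} {x : V} (h : Wt n E w x) (hm : m ≤ n) : Wt m E w x :=
  fun i hi => h i (by omega)

lemma Stb.mono {m : ℕ} {U : Submodule ℂ V} (h : Stb n E U) (hm : m ≤ n) : Stb m E U :=
  fun i j hi hj => h i j (by omega) (by omega)

lemma Sing.smul {x : V} (h : Sing n E x) (c : ℂ) : Sing n E (c • x) := by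
  intro i j hij hj; rw [map_smul, h i j hij hj, smul_zero]

lemma Wt.smul {w : ℕ → ℤ} {x : V} (h : Wt n E w x) (c : ℂ) : Wt n E w (c • x) := by
  intro i hi; rw [map_smul, h i hi, smul_comm]

lemma Wt.add {w : ℕ → ℤ} {x y : V} (h : Wt n E w x) (h' : Wt n E w y) :
    Wt n E w (x + y) := by
  intro i hi; rw [map_add, h i hi, h' i hi, smul_add]

lemma Wt.sub {w : ℕ → ℤ} {x y : V} (h : Wt n E w x) (h' : Wt n E w y) :
    Wt n E w (x - y) := by
  intro i hi; rw [map_sub, h i hi, h' i hi, smul_sub]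

lemma Wt.zero {w : ℕ → ℤ} : Wt n E w 0 := by
  intro i hi; rw [map_zero, smul_zero]

lemma Wt.congr {w w' : ℕ → ℤ} {x : V} (h : Wt n E w x) (hw : ∀ i, i < n → w i = w' i) :
    Wt n E w' x := by
  intro i hi; rw [← hw i hi]; exact h i hi

lemma Wt.unique {w w' : ℕ → ℤ} {x : V} (hx : x ≠ 0) (h : Wt n E w x) (h' : Wt n E w' x) :
    ∀ i, i < n → w i = w' i := by
  intro i hi
  have := (h i hi).symm.trans (h' i hi)
  have h2 := smul_left_injective ℂ hx this
  exact_mod_cast h2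

lemma Low.self {x : V} : x ∈ Low n E x := by
  simp only [Low, Submodule.mem_sInf, Set.mem_ofPred_eq]
  exact fun U hU => hU.1

lemma Low.step {x y : V} {i j : ℕ} (hji : j < i) (hi : i < n) (hy : y ∈ Low n E x) :
    E i j y ∈ Low n E x := by
  simp only [Low, Submodule.mem_sInf, Set.mem_ofPred_eq] at *
  exact fun U hU => hU.2 i j hji hi y (hy U hU)

lemma Low.le {x : V} {U : Submodule ℂ V} (hx : x ∈ U)
    (h : ∀ i j, j < i → i < n → ∀ y ∈ Low n E x, y ∈ U → E i j y ∈ U) : Low n E x ≤ U := by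
  have : Low n E x ≤ U ⊓ Low n E x := by
    apply sInf_le
    refine ⟨⟨hx, Low.self⟩, fun i j hji hi y hy => ⟨h i j hji hi y hy.2 hy.1, Low.step hji hi hy.2⟩⟩
  exact this.trans inf_le_left

lemma Low.le_stb {x : V} {U : Submodule ℂ V} (hx : x ∈ U) (h : Stb n E U) : Low n E x ≤ U :=
  Low.le hx fun i j hji hi y _ hy => h i j hi (by omega) y hy

lemma Low.stb (hgl : IsGL n E) {x : V} {w : ℕ → ℤ} (hs : Sing n E x) (hw : Wt n E w x) :
    Stb n E (Low n E x) := by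
  have key : Low n E x ≤
      ({ carrier := {y | ∀ i j, i ≤ j → j < n → E i j y ∈ Low n E x}
         add_mem' := fun {a b} ha hb i j h1 h2 => by
          rw [map_add]; exact add_mem (ha i j h1 h2) (hb i j h1 h2)
         zero_mem' := fun i j h1 h2 => by rw [map_zero]; exact zero_mem _
         smul_mem' := fun c a ha i j h1 h2 => by
          rw [map_smul]; exact Submodule.smul_mem _ _ (ha i j h1 h2) } : Submodule ℂ V) := by
    apply Low.le
    · intro i j hij hj
      rcases hij.lt_or_eq with h | h
      · rw [hs i j h hj]; exact zero_mem _
      · subst h; rw [hw i hj]; exact Submodule.smul_mem _ _ Low.self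
    · intro k l hlk hk y hy hy' i j hij hj
      have hyy : ∀ a b, a < n → b < n → E a b y ∈ Low n E x := by
        intro a b ha hb
        rcases le_or_gt a b with h | h
        · exact hy' a b h hb
        · exact Low.step h ha hy
      rw [hgl i j k l (by omega) hj hk (by omega)]
      refine sub_mem (add_mem (Low.step hlk hk (hy' i j hij hj)) ?_) ?_
      · split_ifs
        · exact hyy _ _ (by omega) (by omega)
        · exact zero_mem _
      · split_ifs
        · exact hyy _ _ (by omega) (by omega)
        · exact zero_mem _
  intro i j hi hj y hy
  rcases le_or_gt i j with h | h
  · exact key hy i j h hj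
  · exact Low.step h hi hy

/-- shift of a weight by `ε_i - ε_j`. -/
def sh (w : ℕ → ℤ) (i j : ℕ) : ℕ → ℤ :=
  fun k => w k + (if k = i then 1 else 0) - (if k = j then 1 else 0)

lemma Wt.sh (hgl : IsGL n E) {w : ℕ → ℤ} {x : V} (h : Wt n E w x) {i j : ℕ} (hi : i < n)
    (hj : j < n) : Wt n E (sh w i j) (E i j x) := by
  intro k hk
  rw [hgl k k i j hk hk hi hj, h k hk, map_smul]
  unfold _root_.sh
  by_cases h1 : k = i <;> by_cases h2 : k = j
  · subst h1; subst h2; simp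
  · subst h1; simp [h2, Ne.symm h2]; module
  · subst h2; simp [h1]; module
  · simp [h1, h2, Ne.symm h2]

def psum (w : ℕ → ℤ) (m : ℕ) : ℤ := ∑ i ∈ Finset.range m, w i

lemma psum_zero (w : ℕ → ℤ) : psum w 0 = 0 := by simp [psum]

lemma psum_succ (w : ℕ → ℤ) (m : ℕ) : psum w (m+1) = psum w m + w m := by
  simp [psum, Finset.sum_range_succ]

lemma psum_congr {w w' : ℕ → ℤ} {m : ℕ} (h : ∀ i, i < m → w i = w' i) : psum w m = psum w' m :=
  Finset.sum_congr rfl fun i hi => h i (Finset.mem_range.1 hi)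

lemma psum_sh (w : ℕ → ℤ) (i j m : ℕ) :
    psum (sh w i j) m = psum w m + (if i < m then 1 else 0) - (if j < m then 1 else 0) := by
  unfold psum sh
  rw [Finset.sum_sub_distrib, Finset.sum_add_distrib]
  simp

/-- span of weight vectors with weights satisfying `P`. -/
def WB (n : ℕ) (E : ℕ → ℕ → V →ₗ[ℂ] V) (P : (ℕ → ℤ) → Prop) : Submodule ℂ V :=
  Submodule.span ℂ {x | ∃ w, P w ∧ Wt n E w x}

lemma WB.mem {P : (ℕ → ℤ) → Prop} {w : ℕ → ℤ} {x : V} (hP : P w) (h : Wt n E w x) :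
    x ∈ WB n E P := Submodule.subset_span ⟨w, hP, h⟩

lemma WB.mono {P Q : (ℕ → ℤ) → Prop} (h : ∀ w, P w → Q w) {m : ℕ} (hm : m ≤ n) :
    WB n E P ≤ WB m E Q := by
  apply Submodule.span_mono
  rintro x ⟨w, hw, hx⟩
  exact ⟨w, h w hw, hx.mono hm⟩

lemma WB.list {P : (ℕ → ℤ) → Prop} {x : V} (h : x ∈ WB n E P) :
    ∃ l : List ((ℕ → ℤ) × V), (∀ p ∈ l, P p.1 ∧ Wt n E p.1 p.2) ∧ x = (l.map Prod.snd).sum := by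
  unfold WB at h
  induction h using Submodule.span_induction with
  | mem x hx =>
    obtain ⟨w, hw, hx⟩ := hx
    exact ⟨[(w, x)], by simpa using ⟨hw, hx⟩, by simp⟩
  | zero => exact ⟨[], by simp, by simp⟩
  | add x y _ _ hx hy =>
    obtain ⟨l, hl, rfl⟩ := hx
    obtain ⟨l', hl', rfl⟩ := hy
    refine ⟨l ++ l', ?_, by simp⟩
    intro p hp
    rcases List.mem_append.1 hp with h | h
    · exact hl p h
    · exact hl' p h
  | smul c x _ hx =>
    obtain ⟨l, hl, rfl⟩ := hx
    refine ⟨l.map (fun p => (p.1, c • p.2)), ?_, ?_⟩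
    · intro p hp
      obtain ⟨q, hq, rfl⟩ := List.mem_map.1 hp
      exact ⟨(hl q hq).1, (hl q hq).2.smul c⟩
    · rw [List.smul_sum]; simp [Function.comp_def]

lemma WB.exists_aux {P : (ℕ → ℤ) → Prop} {K : Submodule ℂ V}
    (hK : ∀ i, i < n → ∀ y ∈ K, E i i y ∈ K) (l : List ((ℕ → ℤ) × V)) :
    ∀ x : V, x ∈ K → x ≠ 0 → (∀ p ∈ l, P p.1 ∧ Wt n E p.1 p.2) → x = (l.map Prod.snd).sum →
    ∃ w, ∃ y ∈ K, P w ∧ y ≠ 0 ∧ Wt n E w y := by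
  induction hl : l.length generalizing l with
  | zero =>
    intro x _ hx0 _ hx
    rw [List.length_eq_zero_iff] at hl
    subst hl; simp at hx; exact absurd hx hx0
  | succ k ih =>
    intro x hxK hx0 hP hx
    obtain ⟨⟨w, z⟩, t, rfl⟩ := List.exists_cons_of_length_eq_add_one hl
    by_cases hall : ∀ i, i < n → E i i x - (w i : ℂ) • x = 0
    · exact ⟨w, x, hxK, (hP _ List.mem_cons_self).1, hx0, fun i hi => sub_eq_zero.1 (hall i hi)⟩
    · push Not at hall
      obtain ⟨i, hi, hne⟩ := hall
      refine ih (t.map (fun p => (p.1, ((p.1 i : ℂ) - (w i : ℂ)) • p.2))) (by simpa using hl) _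
        (sub_mem (hK i hi x hxK) (K.smul_mem _ hxK)) hne ?_ ?_
      · intro p hp
        obtain ⟨q, hq, rfl⟩ := List.mem_map.1 hp
        have := hP q (List.mem_cons_of_mem _ hq)
        exact ⟨this.1, this.2.smul _⟩
      · have hz := (hP (w, z) List.mem_cons_self).2 i hi
        have ht : ∀ t : List ((ℕ → ℤ) × V), (∀ p ∈ t, P p.1 ∧ Wt n E p.1 p.2) →
            E i i ((t.map Prod.snd).sum) - (w i : ℂ) • (t.map Prod.snd).sum =
            ((t.map (fun p => (p.1, ((p.1 i : ℂ) - (w i : ℂ)) • p.2))).map Prod.snd).sum := by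
          intro t
          induction t with
          | nil => intro _; simp
          | cons a t iht =>
            intro ha
            have h1 := iht fun p hp => ha p (List.mem_cons_of_mem _ hp)
            have h2 := (ha a List.mem_cons_self).2 i hi
            simp only [List.map_cons, List.sum_cons, map_add] at h1 ⊢
            rw [← h1, h2]; module
        have := ht t fun p hp => hP p (List.mem_cons_of_mem _ hp)
        rw [← this, hx]
        simp only [List.map_cons, List.sum_cons, map_add]
        simp only at hz
        rw [hz]; module

lemma WB.exists {P : (ℕ → ℤ) → Prop} {K : Submodule ℂ V}
    (hK : ∀ i, i < n → ∀ y ∈ K, E i i y ∈ K) {x : V} (hx : x ∈ K) (hx0 : x ≠ 0)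
    (h : x ∈ WB n E P) : ∃ w, ∃ y ∈ K, P w ∧ y ≠ 0 ∧ Wt n E w y := by
  obtain ⟨l, hl, hx'⟩ := WB.list h
  exact WB.exists_aux hK l x hx hx0 hl hx'

lemma WB.wt {P : (ℕ → ℤ) → Prop} {x : V} {w : ℕ → ℤ} (hx0 : x ≠ 0) (hw : Wt n E w x)
    (h : x ∈ WB n E P) : ∃ w', P w' ∧ ∀ i, i < n → w i = w' i := by
  obtain ⟨w', y, hy, hP, hy0, hyw⟩ := WB.exists (K := Submodule.span ℂ {x}) (by
    intro i hi y hy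
    obtain ⟨c, rfl⟩ := Submodule.mem_span_singleton.1 hy
    rw [map_smul, hw i hi]
    exact Submodule.smul_mem _ _ (Submodule.smul_mem _ _ (Submodule.mem_span_singleton_self x)))
    (Submodule.mem_span_singleton_self x) hx0 h
  obtain ⟨c, rfl⟩ := Submodule.mem_span_singleton.1 hy
  exact ⟨w', hP, Wt.unique hy0 (hw.smul c) hyw⟩

lemma WB.map {P Q : (ℕ → ℤ) → Prop} {W : Type} [AddCommGroup W] [Module ℂ W]
    {F : ℕ → ℕ → W →ₗ[ℂ] W} (f : V →ₗ[ℂ] W)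
    (h : ∀ w x, P w → Wt n E w x → f x ∈ WB n F Q) {x : V} (hx : x ∈ WB n E P) :
    f x ∈ WB n F Q := by
  have : WB n E P ≤ (WB n F Q).comap f := by
    apply Submodule.span_le.2
    rintro y ⟨w, hw, hy⟩
    exact h w y hw hy
  exact this hx

/-- dominance-type order. -/
def Bdd (n : ℕ) (lam w : ℕ → ℤ) : Prop := ∀ j, j ≤ n → psum w j ≤ psum lam j

def Bd (n : ℕ) (E : ℕ → ℕ → V →ₗ[ℂ] V) : Prop := ∃ lam, ∀ x, x ∈ WB n E (Bdd n lam)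

lemma Bd.mono {m : ℕ} (h : Bd n E) (hm : m ≤ n) : Bd m E := by
  obtain ⟨lam, h⟩ := h
  exact ⟨lam, fun x => WB.mono (fun w hw j hj => hw j (by omega)) hm (h x)⟩

/-- F1: existence of singular vectors. -/
lemma exists_sing (hgl : IsGL n E) {K : Submodule ℂ V} {lam : ℕ → ℤ}
    (hB : ∀ x ∈ K, x ∈ WB n E (Bdd n lam))
    (hK : ∀ i j, i ≤ j → j < n → ∀ y ∈ K, E i j y ∈ K) {x : V} (hx : x ∈ K) (hx0 : x ≠ 0) :
    ∃ y ∈ K, ∃ w, y ≠ 0 ∧ Sing n E y ∧ Wt n E w y := by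
  classical
  let Q : ℕ → Prop := fun k => ∃ y ∈ K, ∃ w, y ≠ 0 ∧ Wt n E w y ∧
    ∑ j ∈ Finset.range (n+1), (psum lam j - psum w j) = k
  have hex : ∃ k, Q k := by
    obtain ⟨w, y, hy, hP, hy0, hyw⟩ :=
      WB.exists (fun i hi => hK i i le_rfl hi) hx hx0 (hB x hx)
    have : 0 ≤ ∑ j ∈ Finset.range (n+1), (psum lam j - psum w j) := by
      apply Finset.sum_nonneg
      intro j hj
      have := hP j (by have := Finset.mem_range.1 hj; omega)
      omega
    obtain ⟨k, hk⟩ := Int.eq_ofNat_of_zero_le this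
    exact ⟨k, y, hy, w, hy0, hyw, hk⟩
  obtain ⟨y, hy, w, hy0, hyw, hsum⟩ := Nat.find_spec hex
  refine ⟨y, hy, w, hy0, ?_, hyw⟩
  intro i j hij hj
  by_contra hne
  have h1 := hyw.sh hgl (i := i) (j := j) (by omega) hj
  have h2 := hK i j hij.le hj y hy
  obtain ⟨w', hP, hw'⟩ := WB.wt hne h1 (hB _ h2)
  have hps : ∀ m, m ≤ n → psum (sh w i j) m ≤ psum lam m := by
    intro m hm
    rw [psum_congr (m := m) fun a ha => hw' a (by omega)]
    exact hP m hm
  have hnn : 0 ≤ ∑ m ∈ Finset.range (n+1), (psum lam m - psum (sh w i j) m) := by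
    apply Finset.sum_nonneg
    intro m hm
    have := hps m (by have := Finset.mem_range.1 hm; omega)
    omega
  obtain ⟨k, hk⟩ := Int.eq_ofNat_of_zero_le hnn
  have hlt : ∑ m ∈ Finset.range (n+1), (psum lam m - psum (sh w i j) m) <
      ∑ m ∈ Finset.range (n+1), (psum lam m - psum w m) := by
    apply Finset.sum_lt_sum
    · intro m _; rw [psum_sh]; split_ifs <;> omega
    · refine ⟨i+1, Finset.mem_range.2 (by omega), ?_⟩
      rw [psum_sh]; split_ifs <;> omega
  have := Nat.find_min' hex ⟨E i j y, h2, sh w i j, hne, h1, hk⟩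
  omega

end C0

section C1
variable {V : Type} [AddCommGroup V] [Module ℂ V]
variable {n : ℕ} {E : ℕ → ℕ → V →ₗ[ℂ] V}

def Dm (n : ℕ) (lam w : ℕ → ℤ) : Prop := Bdd n lam w ∧ psum w n = psum lam n

def Dms (n : ℕ) (lam w : ℕ → ℤ) : Prop := Dm n lam w ∧ ∃ j, j ≤ n ∧ psum w j < psum lam j

lemma Dm.congr {lam w w' : ℕ → ℤ} (h : Dm n lam w) (hw : ∀ i, i < n → w i = w' i) :
    Dm n lam w' := by
  refine ⟨fun j hj => ?_, ?_⟩
  · rw [← psum_congr (m := j) fun i hi => hw i (by omega)]; exact h.1 j hj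
  · rw [← psum_congr (m := n) hw]; exact h.2

lemma Dm.refl {lam : ℕ → ℤ} : Dm n lam lam := ⟨fun _ _ => le_rfl, rfl⟩

lemma eq_of_psum {w w' : ℕ → ℤ} (h : ∀ j, j ≤ n → psum w j = psum w' j) :
    ∀ i, i < n → w i = w' i := by
  intro i hi
  have h1 := h i (by omega)
  have h2 := h (i+1) (by omega)
  rw [psum_succ, psum_succ] at h2; omega

lemma Dm.antisymm {lam w : ℕ → ℤ} (h : Dm n lam w) (h' : Dm n w lam) :
    ∀ i, i < n → w i = lam i :=
  eq_of_psum fun j hj => le_antisymm (h.1 j hj) (h'.1 j hj)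

lemma Dm.sh_lower {lam w : ℕ → ℤ} (h : Dm n lam w) {i j : ℕ} (hji : j < i) (hi : i < n) :
    Dms n lam (sh w i j) := by
  refine ⟨⟨fun m hm => ?_, ?_⟩, j+1, by omega, ?_⟩
  · have := h.1 m hm; rw [psum_sh]; split_ifs <;> omega
  · have := h.2; rw [psum_sh]; split_ifs <;> omega
  · have := h.1 (j+1) (by omega); rw [psum_sh]; split_ifs <;> omega

lemma WB.lower (hgl : IsGL n E) {lam : ℕ → ℤ} {x : V} (hx : x ∈ WB n E (Dm n lam)) {i j : ℕ}
    (hji : j < i) (hi : i < n) : E i j x ∈ WB n E (Dms n lam) :=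
  WB.map (E i j) (fun _ _ hw hx => WB.mem (hw.sh_lower hji hi) (hx.sh hgl hi (by omega))) hx

lemma Low.le_WB (hgl : IsGL n E) {lam : ℕ → ℤ} {x : V} (hw : Wt n E lam x) :
    Low n E x ≤ WB n E (Dm n lam) :=
  Low.le (WB.mem Dm.refl hw) fun _ _ hji hi _ _ hy =>
    WB.mono (fun _ h => h.1) le_rfl (WB.lower hgl hy hji hi)

lemma Low.le_top (hgl : IsGL n E) {lam : ℕ → ℤ} {x : V} (hw : Wt n E lam x) :
    Low n E x ≤ Submodule.span ℂ {x} ⊔ WB n E (Dms n lam) := by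
  apply Low.le (Submodule.mem_sup_left (Submodule.mem_span_singleton_self x))
  intro i j hji hi y hy _
  exact Submodule.mem_sup_right (WB.lower hgl (Low.le_WB hgl hw hy) hji hi)

lemma Dms.irrefl {lam w : ℕ → ℤ} (h : Dms n lam w) (hw : ∀ i, i < n → lam i = w i) : False := by
  obtain ⟨_, j, hj, hlt⟩ := h
  rw [psum_congr (m := j) fun i hi => hw i (by omega)] at hlt
  exact lt_irrefl _ hlt

lemma WB.Dms_wt {lam : ℕ → ℤ} {x : V} (hw : Wt n E lam x) (hx : x ∈ WB n E (Dms n lam)) :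
    x = 0 := by
  by_contra h0
  obtain ⟨w', hP, hw'⟩ := WB.wt h0 hw hx
  exact hP.irrefl hw'

lemma Low.top_wt (hgl : IsGL n E) {lam : ℕ → ℤ} {x y : V} (hw : Wt n E lam x)
    (hy : y ∈ Low n E x) (hyw : Wt n E lam y) : ∃ c : ℂ, y = c • x := by
  obtain ⟨a, ha, b, hb, rfl⟩ := Submodule.mem_sup.1 (Low.le_top hgl hw hy)
  obtain ⟨c, rfl⟩ := Submodule.mem_span_singleton.1 ha
  have : b = 0 := WB.Dms_wt (by simpa using hyw.sub (hw.smul c)) hb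
  exact ⟨c, by rw [this, add_zero]⟩

/-- iterated shift. -/
def shk (w : ℕ → ℤ) (i j : ℕ) (k : ℕ) : ℕ → ℤ :=
  fun m => w m + (if m = i then (k : ℤ) else 0) - (if m = j then (k : ℤ) else 0)

lemma Wt.pow (hgl : IsGL n E) {w : ℕ → ℤ} {x : V} (h : Wt n E w x) {i j : ℕ} (hi : i < n)
    (hj : j < n) (k : ℕ) : Wt n E (shk w i j k) ((E i j ^ k) x) := by
  induction k with
  | zero => simpa using h.congr (by simp [shk])
  | succ k ih =>
    rw [pow_succ', Module.End.mul_apply]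
    refine (ih.sh hgl hi hj).congr ?_
    intro m _
    simp only [_root_.sh, shk]
    push_cast
    split_ifs <;> omega

lemma ef_pow (hgl : IsGL n E) {w : ℕ → ℤ} {x : V} (h : Wt n E w x) {i j : ℕ} (hi : i < n)
    (hj : j < n) (hij : i ≠ j) (hx : E i j x = 0) (k : ℕ) :
    E i j ((E j i ^ (k+1)) x) = (((k:ℂ)+1) * ((w i : ℂ) - w j - k)) • (E j i ^ k) x := by
  induction k with
  | zero =>
    simp only [zero_add, pow_one, pow_zero, Module.End.one_apply]
    rw [hgl i j j i hi hj hj hi, hx, if_pos rfl, if_pos rfl, h i hi, h j hj, map_zero]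
    push_cast; module
  | succ k ih =>
    rw [pow_succ', Module.End.mul_apply, hgl i j j i hi hj hj hi, ih, if_pos rfl, if_pos rfl]
    have hp := h.pow hgl hj hi (k+1)
    rw [hp i hi, hp j hj, map_smul, ← Module.End.mul_apply, ← pow_succ']
    simp only [shk, hij, if_true, if_false, hij.symm]
    push_cast; module

lemma sl2 (hgl : IsGL n E) {w : ℕ → ℤ} {x : V} (h : Wt n E w x) (hx0 : x ≠ 0) {i j : ℕ}
    (hi : i < n) (hj : j < n) (hij : i ≠ j) (hx : E i j x = 0) (hN : ∃ k, (E j i ^ k) x = 0) :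
    ∃ m : ℕ, w i - w j = m ∧ (E j i ^ (m+1)) x = 0 ∧ (E j i ^ m) x ≠ 0 := by
  classical
  have h0 := Nat.find_spec hN
  have hmin : ∀ m, m < Nat.find hN → (E j i ^ m) x ≠ 0 := fun m hm => Nat.find_min hN hm
  obtain ⟨m, hm⟩ : ∃ m, Nat.find hN = m + 1 := by
    apply Nat.exists_eq_succ_of_ne_zero
    intro hz
    rw [hz] at h0; simp at h0; exact hx0 h0
  rw [hm] at h0
  have hne := hmin m (by omega)
  refine ⟨m, ?_, h0, hne⟩
  have := ef_pow hgl h hi hj hij hx m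
  rw [h0, map_zero] at this
  rcases smul_eq_zero.1 this.symm with h1 | h1
  · rcases mul_eq_zero.1 h1 with h2 | h2
    · exact absurd h2 (by exact_mod_cast Nat.succ_ne_zero m)
    · have : ((w i - w j - m : ℤ) : ℂ) = 0 := by push_cast; exact h2
      have := Int.cast_eq_zero.1 this
      omega
  · exact absurd h1 hne

lemma nilp [FiniteDimensional ℂ V] (hgl : IsGL n E) {w : ℕ → ℤ} {x : V} (h : Wt n E w x)
    {i j : ℕ} (hi : i < n) (hj : j < n) (hij : i ≠ j) : ∃ k, (E j i ^ k) x = 0 := by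
  by_contra hcon
  push Not at hcon
  have hli : LinearIndependent ℂ (fun k : ℕ => (E j i ^ k) x) := by
    apply Module.End.eigenvectors_linearIndependent' (E i i) (fun k : ℕ => ((w i : ℂ) - k))
    · intro a b hab
      simpa using hab
    · intro k
      refine ⟨Module.End.mem_eigenspace_iff.2 ?_, hcon k⟩
      have := h.pow hgl hj hi k i hi
      rw [this]
      simp [shk, hij]
  have := hli.finite
  exact not_finite ℕ

lemma dom [FiniteDimensional ℂ V] (hgl : IsGL n E) {w : ℕ → ℤ} {x : V} (h : Wt n E w x)
    (hx0 : x ≠ 0) (hs : Sing n E x) {i j : ℕ} (hij : i < j) (hj : j < n) : w j ≤ w i := by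
  obtain ⟨m, hm, -⟩ := sl2 hgl h hx0 (by omega) hj (by omega) (hs i j hij hj)
    (nilp hgl h (by omega) hj (by omega))
  omega

/-- class of submodules with a unique singular vector -/
structure Cls (n : ℕ) (E : ℕ → ℕ → V →ₗ[ℂ] V) (K : Submodule ℂ V) (ξ : V) (lam : ℕ → ℤ) :
    Prop where
  stb : Stb n E K
  mem : ξ ∈ K
  ne : ξ ≠ 0
  sing : Sing n E ξ
  wt : Wt n E lam ξ
  uniq : ∀ x ∈ K, ∀ w, Sing n E x → Wt n E w x → ∃ c : ℂ, x = c • ξ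

lemma Cls.dm (hgl : IsGL n E) (hbd : Bd n E) {K : Submodule ℂ V} {ξ : V} {lam : ℕ → ℤ}
    (hK : Cls n E K ξ lam) {x : V} {w : ℕ → ℤ} (hx : x ∈ K) (hx0 : x ≠ 0) (hw : Wt n E w x) :
    Dm n lam w := by
  obtain ⟨lam0, hbd⟩ := hbd
  let Q : (ℕ → ℤ) → Prop := fun u => Dm n u w
  obtain ⟨y, hy, w', hy0, hys, hyw⟩ := exists_sing hgl (K := K ⊓ WB n E Q) (lam := lam0)
    (fun x _ => hbd x) (by
      rintro i j hij hj y ⟨hy1, hy2⟩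
      refine ⟨hK.stb i j (by omega) hj y hy1, WB.map (E i j) ?_ hy2⟩
      intro u z hu hz
      refine WB.mem ?_ (hz.sh hgl (by omega) hj)
      refine ⟨fun m hm => ?_, ?_⟩
      · have := hu.1 m hm; rw [psum_sh]; split_ifs <;> omega
      · have := hu.2; rw [psum_sh]; split_ifs <;> omega) ⟨hx, WB.mem Dm.refl hw⟩ hx0
  obtain ⟨c, rfl⟩ := hK.uniq y hy.1 w' hys hyw
  obtain ⟨w2, hw2, hw3⟩ := WB.wt hy0 (hK.wt.smul c) hy.2
  refine ⟨fun j hj => ?_, ?_⟩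
  · rw [psum_congr (w := lam) (m := j) fun i hi => hw3 i (by omega)]; exact hw2.1 j hj
  · rw [psum_congr (w := lam) (m := n) hw3]; exact hw2.2

/-- irreducible highest weight representation. -/
structure IRep (n : ℕ) (E : ℕ → ℕ → V →ₗ[ℂ] V) (ξ : V) (lam : ℕ → ℤ) : Prop where
  gl : IsGL n E
  ne : ξ ≠ 0
  sing : Sing n E ξ
  wt : Wt n E lam ξ
  irr : ∀ U : Submodule ℂ V, Stb n E U → U = ⊥ ∨ U = ⊤

variable {ξ : V} {lam : ℕ → ℤ}

lemma IRep.low_of (h : IRep n E ξ lam) {x : V} {w : ℕ → ℤ} (hx0 : x ≠ 0) (hs : Sing n E x)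
    (hw : Wt n E w x) : Low n E x = ⊤ := by
  rcases h.irr _ (Low.stb h.gl hs hw) with h1 | h1
  · have : x ∈ Low n E x := Low.self
    rw [h1] at this
    exact absurd ((Submodule.mem_bot ℂ).1 this) hx0
  · exact h1

lemma IRep.low (h : IRep n E ξ lam) : Low n E ξ = ⊤ := h.low_of h.ne h.sing h.wt

lemma IRep.mem_WB (h : IRep n E ξ lam) (x : V) : x ∈ WB n E (Dm n lam) :=
  Low.le_WB h.gl h.wt (by rw [h.low]; trivial)

lemma IRep.bd (h : IRep n E ξ lam) : Bd n E :=
  ⟨lam, fun x => WB.mono (fun _ h => h.1) le_rfl (h.mem_WB x)⟩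

lemma IRep.dm (h : IRep n E ξ lam) {x : V} {w : ℕ → ℤ} (hx0 : x ≠ 0) (hw : Wt n E w x) :
    Dm n lam w := by
  obtain ⟨w', h1, h2⟩ := WB.wt hx0 hw (h.mem_WB x)
  exact h1.congr fun i hi => (h2 i hi).symm

lemma IRep.uniq (h : IRep n E ξ lam) {x : V} {w : ℕ → ℤ} (hs : Sing n E x)
    (hw : Wt n E w x) : ∃ c : ℂ, x = c • ξ := by
  by_cases hx0 : x = 0
  · exact ⟨0, by simp [hx0]⟩
  have h1 := h.dm hx0 hw
  have h2 : Dm n w lam := by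
    obtain ⟨w', h3, h4⟩ := WB.wt h.ne h.wt
      (Low.le_WB h.gl hw (by rw [h.low_of hx0 hs hw]; trivial))
    exact h3.congr fun i hi => (h4 i hi).symm
  exact Low.top_wt h.gl h.wt (by rw [h.low]; trivial) (hw.congr (h1.antisymm h2))

lemma IRep.cls (h : IRep n E ξ lam) : Cls n E ⊤ ξ lam where
  stb := fun _ _ _ _ _ _ => trivial
  mem := trivial
  ne := h.ne
  sing := h.sing
  wt := h.wt
  uniq := fun _ _ _ hs hw => h.uniq hs hw

lemma IRep.dom [FiniteDimensional ℂ V] (h : IRep n E ξ lam) {i j : ℕ} (hij : i < j) (hj : j < n) :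
    lam j ≤ lam i := _root_.dom h.gl h.wt h.ne h.sing hij hj

lemma IRep.pow_zero [FiniteDimensional ℂ V] (h : IRep n E ξ lam) {p : ℕ} (hp : p + 1 < n) :
    ∃ m : ℕ, lam p - lam (p+1) = m ∧ (E (p+1) p ^ (m+1)) ξ = 0 := by
  obtain ⟨m, h1, h2, -⟩ := sl2 h.gl h.wt h.ne (i := p) (j := p+1) (by omega) hp (by omega)
    (h.sing _ _ (by omega) hp) (nilp h.gl h.wt (by omega) hp (by omega))
  exact ⟨m, h1, h2⟩

end C1

section C4
variable {V : Type} [AddCommGroup V] [Module ℂ V]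
variable {N : ℕ} {E : ℕ → ℕ → V →ₗ[ℂ] V}

/-- `∑_{a<N} E_{ia} E_{aN}` -/
def Sg (N : ℕ) (E : ℕ → ℕ → V →ₗ[ℂ] V) (i : ℕ) (x : V) : V :=
  ∑ a ∈ Finset.range N, E i a (E a N x)

lemma Sg_add (i : ℕ) (x y : V) : Sg N E i (x + y) = Sg N E i x + Sg N E i y := by
  simp [Sg, Finset.sum_add_distrib]

lemma Sg_zero (i : ℕ) : Sg N E i 0 = 0 := by
  simp [Sg]

lemma Sg_smul (i : ℕ) (c : ℂ) (x : V) : Sg N E i (c • x) = c • Sg N E i x := by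
  simp [Sg, Finset.smul_sum]

lemma Sg_comm1 (hgl : IsGL (N+1) E) {i j k : ℕ} (hi : i < N) (hj : j < N) (hk : k < N) (x : V) :
    Sg N E i (E j k x) = E j k (Sg N E i x) - (if k = i then Sg N E j x else 0) := by
  have h1 : ∀ a ∈ Finset.range N, E i a (E a N (E j k x)) =
      E j k (E i a (E a N x)) + (if a = j then E i k (E j N x) else 0)
        - (if k = i then E j a (E a N x) else 0) - (if k = a then E i k (E j N x) else 0) := by
    intro a ha
    have ha := Finset.mem_range.1 ha
    rw [hgl a N j k (by omega) (by omega) (by omega) (by omega), map_sub, map_add,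
      hgl i a j k (by omega) (by omega) (by omega) (by omega)]
    rw [if_neg (by omega : ¬ N = j), map_zero]
    by_cases h1 : a = j <;> by_cases h2 : k = i <;> by_cases h3 : k = a <;>
      simp [h1, h2, h3] <;> (try subst h1) <;> (try subst h3) <;> (try subst h2) <;> (try simp) <;> (try simp [h3]) <;>
      try abel
  unfold Sg
  rw [Finset.sum_congr rfl h1]
  simp only [Finset.sum_sub_distrib, Finset.sum_add_distrib, map_sum]
  rw [Finset.sum_ite_eq', Finset.sum_ite_eq, if_pos (Finset.mem_range.2 hj),
    if_pos (Finset.mem_range.2 hk)]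
  split_ifs
  · abel
  · simp

lemma Sg_comm2 (hgl : IsGL (N+1) E) {i j : ℕ} (hi : i < N) (hj : j < N) (x : V) :
    Sg N E i (E j N x) = E j N (Sg N E i x) + E i N (E j N x) := by
  have h1 : ∀ a ∈ Finset.range N, E i a (E a N (E j N x)) =
      E j N (E i a (E a N x)) + (if a = j then E i N (E j N x) else 0) := by
    intro a ha
    have ha := Finset.mem_range.1 ha
    rw [hgl a N j N (by omega) (by omega) (by omega) (by omega),
      if_neg (by omega), if_neg (by omega), add_zero, sub_zero,
      hgl i a j N (by omega) (by omega) (by omega) (by omega), if_neg (by omega : ¬ N = i),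
      sub_zero]
    split_ifs with h
    · subst h; rfl
    · rfl
  unfold Sg
  rw [Finset.sum_congr rfl h1]
  simp only [Finset.sum_add_distrib, map_sum]
  rw [Finset.sum_ite_eq', if_pos (Finset.mem_range.2 hj)]

def Kt (N : ℕ) (E : ℕ → ℕ → V →ₗ[ℂ] V) (K : Submodule ℂ V) (e τ : ℤ) : Submodule ℂ V where
  carrier := {x | x ∈ K ∧ E N N x = (e : ℂ) • x ∧
    ∀ i, i < N → Sg N E i x = (τ : ℂ) • E i N x}
  add_mem' := by
    rintro a b ⟨h1, h2, h3⟩ ⟨k1, k2, k3⟩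
    refine ⟨add_mem h1 k1, ?_, fun i hi => ?_⟩
    · rw [map_add, h2, k2, smul_add]
    · rw [Sg_add, h3 i hi, k3 i hi, map_add, smul_add]
  zero_mem' := ⟨zero_mem _, by simp, fun i hi => by simp [Sg_zero]⟩
  smul_mem' := by
    rintro c x ⟨h1, h2, h3⟩
    refine ⟨K.smul_mem c h1, ?_, fun i hi => ?_⟩
    · rw [map_smul, h2, smul_comm]
    · rw [Sg_smul, h3 i hi, map_smul, smul_comm]

lemma Kt.stb (hgl : IsGL (N+1) E) {K : Submodule ℂ V} (hK : Stb (N+1) E K) {e τ : ℤ} :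
    Stb N E (Kt N E K e τ) := by
  rintro j k hj hk x ⟨h1, h2, h3⟩
  refine ⟨hK j k (by omega) (by omega) x h1, ?_, fun i hi => ?_⟩
  · rw [hgl N N j k (by omega) (by omega) (by omega) (by omega), if_neg (by omega),
      if_neg (by omega), h2, map_smul]; simp
  · rw [Sg_comm1 hgl hi hj hk, h3 i hi, h3 j hj, map_smul,
      hgl i N j k (by omega) (by omega) (by omega) (by omega), if_neg (by omega : ¬ N = j)]
    split_ifs <;> simp [smul_sub]

lemma Kt.step (hgl : IsGL (N+1) E) {K : Submodule ℂ V} (hK : Stb (N+1) E K) {e τ : ℤ} {j : ℕ}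
    (hj : j < N) {x : V} (hx : x ∈ Kt N E K e τ) : E j N x ∈ Kt N E K (e-1) (τ+1) := by
  obtain ⟨h1, h2, h3⟩ := hx
  refine ⟨hK j N (by omega) (by omega) x h1, ?_, fun i hi => ?_⟩
  · rw [hgl N N j N (by omega) (by omega) (by omega) (by omega), if_neg (by omega),
      if_pos rfl, h2, map_smul]; push_cast; module
  · rw [Sg_comm2 hgl hi hj, h3 i hi, map_smul,
      hgl j N i N (by omega) (by omega) (by omega) (by omega), if_neg (by omega),
      if_neg (by omega)]
    push_cast; module

lemma Sing.succ {x : V} (h : Sing N E x) (h' : ∀ i, i < N → E i N x = 0) : Sing (N+1) E x := by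
  intro i j hij hj
  rcases Nat.lt_succ_iff_lt_or_eq.1 hj with h1 | h1
  · exact h i j hij h1
  · subst h1; exact h' i hij

lemma Sing.step (hgl : IsGL (N+1) E) {x : V} (h : Sing N E x) {s : ℕ} (hs : s < N)
    (h' : ∀ i, i < s → E i N x = 0) : Sing N E (E s N x) := by
  intro i j hij hj
  rw [hgl i j s N (by omega) (by omega) (by omega) (by omega), h i j hij hj, map_zero,
    if_neg (by omega : ¬ N = i)]
  split_ifs with h1
  · rw [h' i (by omega)]; simp
  · simp

variable {K : Submodule ℂ V} {ξ : V} {lam : ℕ → ℤ}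

lemma Cls.last_ge (hgl : IsGL (N+1) E) (hbd : Bd (N+1) E) (hK : Cls (N+1) E K ξ lam) {x : V}
    {w : ℕ → ℤ} (hx : x ∈ K) (hx0 : x ≠ 0) (hw : Wt (N+1) E w x) : lam N ≤ w N := by
  have h := hK.dm hgl hbd hx hx0 hw
  have h1 := h.1 N (by omega)
  have h2 := h.2
  rw [psum_succ, psum_succ] at h2
  omega

lemma Cls.chain (hgl : IsGL (N+1) E) (hK : Cls (N+1) E K ξ lam) {x : V} {w : ℕ → ℤ}
    (hx : x ∈ K) (hs : Sing N E x) (hw : Wt (N+1) E w x) :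
    (∃ c : ℂ, x = c • ξ) ∨ ∃ s, s < N ∧ (∀ i, i < s → E i N x = 0) ∧ E s N x ≠ 0 ∧
      Sing N E (E s N x) ∧ Wt (N+1) E (sh w s N) (E s N x) ∧ E s N x ∈ K := by
  classical
  by_cases h : ∃ s, s < N ∧ E s N x ≠ 0
  · right
    have h1 := Nat.find_spec h
    have h2 : ∀ i, i < Nat.find h → E i N x = 0 := by
      intro i hi
      have := Nat.find_min h hi
      push Not at this
      exact this (by omega)
    exact ⟨Nat.find h, h1.1, h2, h1.2, hs.step hgl h1.1 h2, hw.sh hgl (by omega) (by omega),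
      hK.stb _ _ (by omega) (by omega) x hx⟩
  · left
    push Not at h
    exact hK.uniq x hx w (hs.succ h) hw

/-- weights of `gl_N`-singular vectors are bounded coordinatewise. -/
lemma Cls.tl (hgl : IsGL (N+1) E) (hbd : Bd (N+1) E) (hK : Cls (N+1) E K ξ lam) (d : ℕ) :
    ∀ (x : V) (w : ℕ → ℤ), x ∈ K → x ≠ 0 → Sing N E x → Wt (N+1) E w x → w N = lam N + d →
    ∀ i, i < N → w i ≤ lam i := by
  induction d with
  | zero =>
    intro x w hx hx0 hs hw hd i hi
    rcases hK.chain hgl hx hs hw with ⟨c, rfl⟩ | ⟨s, hs, -, h0, -, hw', hmem⟩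
    · exact (Wt.unique hx0 hw (hK.wt.smul c) i (by omega)).le
    · have := hK.last_ge hgl hbd hmem h0 hw'
      simp [sh] at this
      split_ifs at this <;> omega
  | succ d ih =>
    intro x w hx hx0 hs hw hd i hi
    rcases hK.chain hgl hx hs hw with ⟨c, rfl⟩ | ⟨s, hs, -, h0, hsing, hw', hmem⟩
    · exact (Wt.unique hx0 hw (hK.wt.smul c) i (by omega)).le
    · have := ih _ _ hmem h0 hsing hw' (by
        simp only [sh]; push_cast at hd; split_ifs <;> omega) i hi
      simp only [sh] at this
      split_ifs at this <;> omega

lemma Cls.strict [FiniteDimensional ℂ V] (hgl : IsGL (N+1) E) (hK : Cls (N+1) E K ξ lam) {i j : ℕ}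
    (hij : i < j) (hj : j ≤ N) : lam j ≤ lam i :=
  dom hgl hK.wt hK.ne hK.sing hij (by omega)

lemma Sg_first (hgl : IsGL (N+1) E) {x : V} {w : ℕ → ℤ} (hx : Sing N E x) (hw : Wt (N+1) E w x)
    {s : ℕ} (hs : s < N) (h0 : ∀ i, i < s → E i N x = 0) :
    Sg N E s x = ((w s + N - s : ℤ) : ℂ) • E s N x := by
  have h1 : ∀ a ∈ Finset.range N, E s a (E a N x) =
      ((if a = s then (w s : ℂ) else 0) + (if s ≤ a then (1:ℂ) else 0)) • E s N x := by
    intro a ha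
    have ha := Finset.mem_range.1 ha
    rcases lt_trichotomy a s with h | h | h
    · rw [h0 a h, if_neg (by omega), if_neg (by omega)]; simp
    · subst h
      have := hw.sh hgl (i := a) (j := N) (by omega) (by omega) a (by omega)
      rw [this, if_pos rfl, if_pos le_rfl]
      have hne : a ≠ N := by omega
      simp [sh, hne]
    · rw [hgl s a a N (by omega) (by omega) (by omega) (by omega), hx s a h ha, map_zero,
        if_pos rfl, if_neg (by omega), if_neg (by omega), if_pos (by omega)]; simp
  have hc : ∀ M, s ≤ M → ∑ a ∈ Finset.range M, (if s ≤ a then (1:ℂ) else 0) = (M:ℂ) - s := by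
    intro M hM
    induction M, hM using Nat.le_induction with
    | base =>
      rw [Finset.sum_eq_zero]; · simp
      intro a ha; rw [if_neg]; have := Finset.mem_range.1 ha; omega
    | succ M hM ih => rw [Finset.sum_range_succ, ih, if_pos hM]; push_cast; ring
  unfold Sg
  rw [Finset.sum_congr rfl h1, ← Finset.sum_smul, Finset.sum_add_distrib, hc N hs.le,
    Finset.sum_ite_eq', if_pos (Finset.mem_range.2 hs)]
  congr 1; push_cast; ring

/-- The main structural lemma on `gl_N`-singular vectors in `Kt`. -/
lemma Cls.k3 [FiniteDimensional ℂ V] (hgl : IsGL (N+1) E) (hbd : Bd (N+1) E)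
    (hK : Cls (N+1) E K ξ lam) (d : ℕ) :
    ∀ (τ : ℤ) (x : V) (w : ℕ → ℤ), x ∈ Kt N E K (lam N + d) τ → x ≠ 0 → Sing N E x →
      Wt (N+1) E w x →
    (d = 0 ∧ ∃ c : ℂ, x = c • ξ) ∨ (1 ≤ d ∧ ∃ r, r < N ∧ τ = lam r - d + N - r ∧
      (∀ i, i < N → w i = lam i - (if i = r then (d:ℤ) else 0)) ∧
      (∀ i, i < r → E i N x = 0) ∧ (E r N ^ d) x ≠ 0 ∧ E r N x ≠ 0) := by
  induction d with
  | zero =>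
    intro τ x w hx hx0 hs hw
    left
    refine ⟨rfl, ?_⟩
    rcases hK.chain hgl hx.1 hs hw with h | ⟨s, hs, -, h0, -, hw', hmem⟩
    · exact h
    · have := hK.last_ge hgl hbd hmem h0 hw'
      have h2 := Wt.unique (n := 1) (E := fun _ _ => E N N) (w := fun _ => w N)
        (w' := fun _ => lam N + (0:ℕ)) hx0 (fun i _ => hw N (by omega))
        (fun i _ => by exact hx.2.1) 0 (by omega)
      simp [sh] at this h2
      split_ifs at this <;> omega
  | succ d ih =>
    intro τ x w hx hx0 hs hw
    right
    have hwN : w N = lam N + (d+1 : ℕ) := by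
      have := (hw N (by omega)).symm.trans hx.2.1
      have h2 := smul_left_injective ℂ hx0 this
      exact_mod_cast h2
    refine ⟨by omega, ?_⟩
    rcases hK.chain hgl hx.1 hs hw with ⟨c, rfl⟩ | ⟨s, hsN, hmin, h0, hsing, hw', hmem⟩
    · have := Wt.unique hx0 hw (hK.wt.smul c) N (by omega)
      push_cast at hwN; omega
    · have hτ : τ = w s + N - s := by
        have := (hx.2.2 s hsN).symm.trans (Sg_first hgl hs hw hsN hmin)
        exact_mod_cast smul_left_injective ℂ h0 this
      have hy := Kt.step hgl hK.stb hsN hx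
      have hde : lam N + ((d+1 : ℕ):ℤ) - 1 = lam N + d := by push_cast; ring
      rw [hde] at hy
      rcases ih _ _ _ hy h0 hsing hw' with ⟨rfl, c, hc⟩ | ⟨hd, r, hrN, hr1, hr2, hr3, hr4, hr5⟩
      · have hu := Wt.unique h0 hw' (hc ▸ hK.wt.smul c)
        have h1 := hu s (by omega)
        refine ⟨s, hsN, ?_, ?_, hmin, by simpa using h0, h0⟩
        · simp [sh] at h1; push_cast; omega
        · intro i hi
          have := hu i (by omega)
          simp [sh] at this; push_cast
          split_ifs at this ⊢ <;> omega
      · have hsr : s = r := by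
          by_contra hne
          have h1 := hr2 s hsN
          simp only [sh, hne, if_true, if_false] at h1
          have h2 : r < s := by
            by_contra h3
            have := hK.strict hgl (i := s) (j := r) (by omega) (by omega)
            omega
          apply hr5
          rw [hgl r N s N (by omega) (by omega) (by omega) (by omega), hmin r h2,
            if_neg (by omega), if_neg (by omega)]; simp
        subst hsr
        refine ⟨s, hsN, by push_cast; omega, ?_, hmin, ?_, h0⟩
        · intro i hi
          have := hr2 i hi
          simp [sh] at this; push_cast
          split_ifs at this ⊢ <;> omega
        · rw [pow_succ]; exact hr4

lemma Cls.kuniq [FiniteDimensional ℂ V] (hgl : IsGL (N+1) E) (hbd : Bd (N+1) E)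
    (hK : Cls (N+1) E K ξ lam) (d : ℕ) :
    ∀ (τ : ℤ) (x y : V) (w w' : ℕ → ℤ), x ∈ Kt N E K (lam N + d) τ → x ≠ 0 → Sing N E x →
      Wt (N+1) E w x → y ∈ Kt N E K (lam N + d) τ → Sing N E y → Wt (N+1) E w' y →
      ∃ c : ℂ, y = c • x := by
  induction d with
  | zero =>
    intro τ x y w w' hx hx0 hxs hxw hy hys hyw
    by_cases hy0 : y = 0
    · exact ⟨0, by simp [hy0]⟩
    rcases hK.k3 hgl hbd 0 τ x w hx hx0 hxs hxw with ⟨-, c, hc⟩ | ⟨h, -⟩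
    swap; · omega
    rcases hK.k3 hgl hbd 0 τ y w' hy hy0 hys hyw with ⟨-, c', hc'⟩ | ⟨h, -⟩
    swap; · omega
    have hc0 : c ≠ 0 := by rintro rfl; simp at hc; exact hx0 hc
    refine ⟨c' * c⁻¹, ?_⟩
    rw [hc, hc', smul_smul, mul_assoc, inv_mul_cancel₀ hc0, mul_one]
  | succ d ih =>
    intro τ x y w w' hx hx0 hxs hxw hy hys hyw
    by_cases hy0 : y = 0
    · exact ⟨0, by simp [hy0]⟩
    have hde : lam N + ((d+1 : ℕ):ℤ) - 1 = lam N + d := by push_cast; ring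
    rcases hK.k3 hgl hbd _ τ x w hx hx0 hxs hxw with ⟨h, -⟩ | ⟨-, r, hr, hr1, hr2, hr3, hr4, hr5⟩
    · omega
    have huni : ∀ r', r' < N → τ = lam r' - ((d+1:ℕ):ℤ) + N - r' → r' = r := by
      intro r' hr' h
      by_contra hne
      rcases lt_or_gt_of_ne hne with h1 | h1
      · have := hK.strict hgl h1 (by omega); omega
      · have := hK.strict hgl h1 (by omega); omega
    rcases hK.k3 hgl hbd _ τ y w' hy hy0 hys hyw with ⟨h, -⟩ | ⟨-, r', hr', hs1, hs2, hs3, hs4, hs5⟩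
    · omega
    obtain rfl := huni r' hr' hs1
    have hx1 := Kt.step hgl hK.stb hr hx
    have hy1 := Kt.step hgl hK.stb hr hy
    rw [hde] at hx1 hy1
    obtain ⟨c, hc⟩ := ih _ _ _ _ _ hx1 hr5 (hxs.step hgl hr hr3)
      (hxw.sh hgl (by omega) (by omega)) hy1 (hys.step hgl hr hs3) (hyw.sh hgl (by omega) (by omega))
    refine ⟨c, ?_⟩
    by_contra hne
    have hz0 : y - c • x ≠ 0 := sub_ne_zero.2 hne
    have hyw2 : Wt (N+1) E w y := by
      refine hyw.congr fun i hi => ?_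
      rcases Nat.lt_succ_iff_lt_or_eq.1 hi with h | h
      · rw [hr2 i h, hs2 i h]
      · subst h
        have h1 := smul_left_injective ℂ hx0 ((hxw i hi).symm.trans hx.2.1)
        have h2 := smul_left_injective ℂ hy0 ((hyw i hi).symm.trans hy.2.1)
        have h1 : w i = lam i + ((d+1:ℕ):ℤ) := by exact_mod_cast h1
        have h2 : w' i = lam i + ((d+1:ℕ):ℤ) := by exact_mod_cast h2
        omega
    rcases hK.k3 hgl hbd _ τ (y - c • x) w (sub_mem hy (Submodule.smul_mem _ c hx)) hz0
      (fun i j hij hj => by rw [map_sub, map_smul, hys i j hij hj, hxs i j hij hj]; simp)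
      (hyw2.sub (hxw.smul c)) with ⟨h, -⟩ | ⟨-, r', hr', hs1, -, -, -, h5⟩
    · omega
    · obtain rfl := huni r' hr' hs1
      apply h5
      rw [map_sub, map_smul, hc, sub_self]

lemma ef_pow2 {n : ℕ} (hgl : IsGL n E) {w : ℕ → ℤ} {x : V} (h : Wt n E w x) {i j : ℕ} (hi : i < n)
    (hj : j < n) (hij : i ≠ j) (k : ℕ) :
    E i j ((E j i ^ (k+1)) x) = (E j i ^ (k+1)) (E i j x) +
      (((k:ℂ)+1) * ((w i : ℂ) - w j - k)) • (E j i ^ k) x := by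
  induction k with
  | zero =>
    simp only [zero_add, pow_one, pow_zero, Module.End.one_apply]
    rw [hgl i j j i hi hj hj hi, if_pos rfl, if_pos rfl, h i hi, h j hj]
    push_cast; module
  | succ k ih =>
    rw [pow_succ', Module.End.mul_apply, hgl i j j i hi hj hj hi, ih, if_pos rfl, if_pos rfl]
    have hp := h.pow hgl hj hi (k+1)
    have hp2 : ∀ (m : ℕ) z, E j i ((E j i^m) z) = (E j i^(m+1)) z := by
      intro m z; rw [pow_succ', Module.End.mul_apply]
    rw [hp i hi, hp j hj, map_add, map_smul]
    simp only [Module.End.mul_apply, hp2]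
    simp only [shk, hij, if_true, if_false, hij.symm]
    push_cast; module

end C4

/-- one-sided crossing condition. -/
def XX (n : ℕ) (a b : ℕ → ℤ) : Prop :=
  ∃ i i' j j', i < n ∧ i' < n ∧ j < n ∧ j' < n ∧ a i < b j ∧ b j < a i' ∧ a i' < b j' ∧
    (∀ k, k < n → b k ≠ a i) ∧ (∀ k, k < n → b k ≠ a i') ∧
    (∀ k, k < n → a k ≠ b j) ∧ (∀ k, k < n → a k ≠ b j')

def SD (n : ℕ) (a : ℕ → ℤ) : Prop := ∀ i j, i < j → j < n → a j < a i

lemma SD.mono {n m : ℕ} {a : ℕ → ℤ} (h : SD n a) (hm : m ≤ n) : SD m a :=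
  fun i j hij hj => h i j hij (by omega)

lemma SD.le {n : ℕ} {a : ℕ → ℤ} (h : SD n a) {i j : ℕ} (hij : i ≤ j) (hj : j < n) : a j ≤ a i := by
  rcases hij.lt_or_eq with h1 | h1
  · exact (h i j h1 hj).le
  · rw [h1]

lemma SD.lt_of {n : ℕ} {a : ℕ → ℤ} (h : SD n a) {i j : ℕ} (hi : i < n) (hlt : a j < a i) :
    i < j := by
  by_contra hc
  have := h.le (i := j) (j := i) (by omega) hi
  omega

lemma SD.le_of {n : ℕ} {a : ℕ → ℤ} (h : SD n a) {i j : ℕ} (hi : i < n) (hlt : a j ≤ a i) :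
    i ≤ j := by
  by_contra hc
  have := h j i (by omega) hi
  omega

lemma XX.up {N : ℕ} {a b : ℕ → ℤ} (ha : SD (N+1) a) (hb : SD (N+1) b) (h : XX N a b) :
    XX (N+1) a b := by
  obtain ⟨i, i', j, j', hi, hi', hj, hj', h1, h2, h3, h4, h5, h6, h7⟩ := h
  have hbN : ∀ k, k < N → b N < b k := fun k hk => hb k N hk (by omega)
  have haN : ∀ k, k < N → a N < a k := fun k hk => ha k N hk (by omega)
  have key : ∀ k, k < N+1 → k < N ∨ k = N := fun k hk => by omega
  have e5 : ∀ k, k < N+1 → b k ≠ a i' := by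
    intro k hk; rcases key k hk with h | rfl
    · exact h5 k h
    · have := hbN j hj; omega
  have e6 : ∀ k, k < N+1 → a k ≠ b j := by
    intro k hk; rcases key k hk with h | rfl
    · exact h6 k h
    · have := haN i hi; omega
  have e7 : ∀ k, k < N+1 → a k ≠ b j' := by
    intro k hk; rcases key k hk with h | rfl
    · exact h7 k h
    · have := haN i hi; omega
  by_cases hc : b N = a i
  · refine ⟨N, i', j, j', by omega, by omega, by omega, by omega, ?_, h2, h3, ?_, e5, e6, e7⟩
    · have := haN i hi; omega
    · intro k hk; have := haN i hi
      rcases key k hk with h | rfl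
      · have := hbN k h; omega
      · omega
  · refine ⟨i, i', j, j', by omega, by omega, by omega, by omega, h1, h2, h3, ?_, e5, e6, e7⟩
    intro k hk; rcases key k hk with h | rfl
    · exact h4 k h
    · exact hc

lemma XX.up2 {N r : ℕ} {a b a' : ℕ → ℤ} (ha : SD (N+1) a) (hb : SD (N+1) b) (hr : r < N)
    (h1 : a (r+1) < b N) (h2 : b N < a r) (ha' : ∀ i, i < N → a' i = if i = r then b N else a i)
    (h : XX N a' b) : XX (N+1) a b := by
  obtain ⟨i, i', j, j', hi, hi', hj, hj', g1, g2, g3, g4, g5, g6, g7⟩ := h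
  have hbN : ∀ k, k < N → b N < b k := fun k hk => hb k N hk (by omega)
  have haN : a N < b N := lt_of_le_of_lt (ha.le (by omega) (by omega)) h1
  have key : ∀ k, k < N+1 → k < N ∨ k = N := fun k hk => by omega
  have hnot : ∀ k, k < N+1 → a k ≠ b N := by
    intro k hk
    rcases le_or_gt k r with h | h
    · have := ha.le h (by omega); omega
    · have := ha.le (i := r+1) (j := k) (by omega) hk; omega
  have hir : i' ≠ r := by
    rintro rfl
    have h3 := ha' i' hi'
    rw [if_pos rfl] at h3
    have := hbN j hj
    omega
  have hai' : a' i' = a i' := by rw [ha' i' hi', if_neg hir]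
  rw [hai'] at g2 g3 g5
  have hlow : ∀ k, k < N+1 → b k ≠ a N := by
    intro k hk
    rcases key k hk with h | rfl
    · have := hbN k h; omega
    · omega
  have e5 : ∀ k, k < N+1 → b k ≠ a i' := by
    intro k hk; rcases key k hk with h | rfl
    · exact g5 k h
    · exact (hnot i' (by omega)).symm
  have e7 : ∀ k, k < N+1 → a k ≠ b j' := by
    intro k hk heq
    rcases key k hk with h | rfl
    · by_cases hkr : k = r
      · subst hkr
        have := ha.lt_of (i := k) (j := i') (by omega) (by omega)
        have := ha.le (i := k+1) (j := i') (by omega) (by omega)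
        have := hbN j hj
        omega
      · have := g7 k h
        rw [ha' k h, if_neg hkr] at this
        exact this heq
    · have := hbN j' hj'; omega
  by_cases hβ : b j = a r
  · refine ⟨N, i', N, j', by omega, by omega, by omega, by omega, haN, ?_, g3, hlow, e5, hnot, e7⟩
    omega
  · have e6 : ∀ k, k < N+1 → a k ≠ b j := by
      intro k hk heq
      rcases key k hk with h | rfl
      · by_cases hkr : k = r
        · subst hkr; exact hβ heq.symm
        · have := g6 k h
          rw [ha' k h, if_neg hkr] at this
          exact this heq
      · have := hbN j hj; omega
    by_cases hα : i = r
    · refine ⟨N, i', j, j', by omega, by omega, by omega, by omega, ?_, g2, g3, hlow, e5, e6, e7⟩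
      have := hbN j hj; omega
    · have hai : a' i = a i := by rw [ha' i hi, if_neg hα]
      rw [hai] at g1 g4
      refine ⟨i, i', j, j', by omega, by omega, by omega, by omega, g1, g2, g3, ?_, e5, e6, e7⟩
      intro k hk; rcases key k hk with h | rfl
      · exact g4 k h
      · exact (hnot i (by omega)).symm

/-- pigeonhole: more `b` values than `a` values. -/
lemma pigeon {s t : ℕ} {a b : ℕ → ℤ} (hb : SD s b) (hts : t < s)
    (h : ∀ j, j < s → ∃ i, i < t ∧ a i = b j) : False := by
  choose! f hf using h
  have := Finset.exists_ne_map_eq_of_card_lt_of_maps_to (s := Finset.range s) (t := Finset.range t)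
    (by simpa using hts) (f := f) (fun x hx => by
      have := (hf x (by simpa using hx)).1
      simpa using this)
  obtain ⟨x, hx, y, hy, hxy, hfe⟩ := this
  have hx' := Finset.mem_range.1 hx
  have hy' := Finset.mem_range.1 hy
  have e1 := (hf x hx').2
  have e2 := (hf y hy').2
  rw [hfe, e2] at e1
  rcases lt_or_gt_of_ne hxy with h | h
  · have := hb x y h hy'; omega
  · have := hb y x h hx'; omega

lemma XX.of_gap {M r : ℕ} {a b : ℕ → ℤ} (ha : SD (M+2) a) (hb : SD (M+2) b) (hr : r < M+1)
    (h1 : a (r+1) < b (M+1)) (h2 : b (M+1) < a r) (h3 : a r < b M) : XX (M+2) a b := by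
  have haN : a (M+1) < b (M+1) := lt_of_le_of_lt (ha.le (by omega) (by omega)) h1
  have hex : ∃ j, j < M+1 ∧ ∀ i, i < r → a i ≠ b j := by
    by_contra hc
    push Not at hc
    exact pigeon (s := M+1) (t := r) (a := a) (hb.mono (by omega)) hr hc
  obtain ⟨j, hj, hja⟩ := hex
  have hbj := hb.le (i := j) (j := M) (by omega) (by omega)
  have hbmin : ∀ k, k < M+2 → b (M+1) ≤ b k := fun k hk => hb.le (by omega) (by omega)
  refine ⟨M+1, r, M+1, j, by omega, by omega, by omega, by omega, haN, h2, by omega, ?_, ?_, ?_, ?_⟩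
  · intro k hk; have := hbmin k hk; omega
  · intro k hk
    rcases le_or_gt k M with h | h
    · have := hb.le (i := k) (j := M) h (by omega); omega
    · have : k = M+1 := by omega
      subst this; omega
  · intro k hk
    rcases le_or_gt k r with h | h
    · have := ha.le h (by omega); omega
    · have := ha.le (i := r+1) (j := k) (by omega) hk; omega
  · intro k hk
    rcases lt_or_ge k r with h | h
    · exact hja k h
    · have := ha.le (i := r) (j := k) h hk; omega

section C5
variable {V : Type} [AddCommGroup V] [Module ℂ V]
variable {N : ℕ} {E : ℕ → ℕ → V →ₗ[ℂ] V}
variable {K : Submodule ℂ V} {ξ : V} {lam : ℕ → ℤ}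

lemma psum_shk_low (w : ℕ → ℤ) (i j k m : ℕ) (hi : m ≤ i) (hj : m ≤ j) :
    psum (shk w i j k) m = psum w m := by
  apply psum_congr
  intro a ha
  simp only [shk, if_neg (by omega : ¬ a = i), if_neg (by omega : ¬ a = j)]; omega

lemma Cls.edge_kill {M : ℕ} (hgl : IsGL (M+2) E) (hbd : Bd (M+2) E) (hK : Cls (M+2) E K ξ lam)
    {y : V} {k : ℕ} (hy : y ∈ K) (hw : Wt (M+2) E (shk lam (M+1) M k) y)
    (he : E M (M+1) y = 0) : Sing (M+2) E y := by
  intro i j hij hj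
  by_cases hiM : i = M
  · have : j = M+1 := by omega
    subst this; subst hiM; exact he
  · by_contra hne
    have := (hK.dm hgl hbd (hK.stb i j (by omega) hj y hy) hne (hw.sh hgl (by omega) hj)).1
      (i+1) (by omega)
    rw [psum_sh, psum_shk_low _ _ _ _ _ (by omega) (by omega), if_pos (by omega),
      if_neg (by omega)] at this
    omega

lemma Cls.edge_zero_of {M : ℕ} (hgl : IsGL (M+2) E) (hbd : Bd (M+2) E) (hK : Cls (M+2) E K ξ lam)
    {y : V} {k : ℕ} (hk : k ≠ 0) (hy : y ∈ K) (hw : Wt (M+2) E (shk lam (M+1) M k) y)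
    (he : E M (M+1) y = 0) : y = 0 := by
  by_contra hy0
  obtain ⟨c, rfl⟩ := hK.uniq y hy _ (hK.edge_kill hgl hbd hy hw he) hw
  have := Wt.unique hy0 hw (hK.wt.smul c) (M+1) (by omega)
  simp [shk] at this
  exact hk this

lemma shk_sh (w : ℕ → ℤ) (i j k : ℕ) (hij : i ≠ j) : sh (shk w i j (k+1)) j i = shk w i j k := by
  funext m
  simp only [sh, shk]; push_cast
  split_ifs <;> omega

lemma Cls.edge_uniq {M : ℕ} (hgl : IsGL (M+2) E) (hbd : Bd (M+2) E) (hK : Cls (M+2) E K ξ lam)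
    (k : ℕ) : (k:ℤ) ≤ lam M - lam (M+1) →
    ∀ y, y ∈ K → Wt (M+2) E (shk lam (M+1) M k) y → ∃ c : ℂ, y = c • (E (M+1) M ^ k) ξ := by
  induction k with
  | zero =>
    intro _ y hy hw
    have hw0 : Wt (M+2) E lam y := hw.congr (by simp [shk])
    have he : E M (M+1) y = 0 := by
      by_contra hne
      have := (hK.dm hgl hbd (hK.stb M (M+1) (by omega) (by omega) y hy) hne
        (hw0.sh hgl (by omega) (by omega))).1 (M+1) (by omega)
      rw [psum_sh] at this
      split_ifs at this <;> omega
    obtain ⟨c, hc⟩ := hK.uniq y hy _ (hK.edge_kill hgl hbd hy hw he) hw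
    exact ⟨c, by simpa using hc⟩
  | succ k ih =>
    intro hk y hy hw
    have hw' := hw.sh hgl (i := M) (j := M+1) (by omega) (by omega)
    rw [shk_sh _ _ _ _ (by omega)] at hw'
    obtain ⟨c, hc⟩ := ih (by push_cast at hk; omega) _ (hK.stb M (M+1) (by omega) (by omega) y hy) hw'
    have hef := ef_pow hgl hK.wt (i := M) (j := M+1) (by omega) (by omega) (by omega)
      (hK.sing _ _ (by omega) (by omega)) k
    set q : ℂ := ((k:ℂ)+1) * ((lam M : ℂ) - lam (M+1) - k) with hq
    have hq0 : q ≠ 0 := by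
      apply mul_ne_zero
      · exact_mod_cast Nat.succ_ne_zero k
      · have : (lam M - lam (M+1) - k : ℤ) ≠ 0 := by push_cast at hk; omega
        exact_mod_cast this
    have hmem : ∀ m, (E (M+1) M ^ m) ξ ∈ K := by
      intro m
      induction m with
      | zero => simpa using hK.mem
      | succ m ihm =>
        rw [pow_succ', Module.End.mul_apply]; exact hK.stb _ _ (by omega) (by omega) _ ihm
    refine ⟨c * q⁻¹, ?_⟩
    have hz := hK.edge_zero_of hgl hbd (y := y - (c * q⁻¹) • (E (M+1) M ^ (k+1)) ξ) (k := k+1)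
      (by omega) (sub_mem hy (K.smul_mem _ (hmem _)))
      (hw.sub ((hK.wt.pow hgl (by omega) (by omega) (k+1)).smul _))
      (by rw [map_sub, map_smul, hef, hc, smul_smul, mul_assoc, inv_mul_cancel₀ hq0, mul_one,
            sub_self])
    exact sub_eq_zero.1 hz

lemma Cls.edge_zero [FiniteDimensional ℂ V] {M : ℕ} (hgl : IsGL (M+2) E) (hbd : Bd (M+2) E)
    (hK : Cls (M+2) E K ξ lam) (t : ℕ) : ∀ (k : ℕ), (k:ℤ) = lam M - lam (M+1) + 1 + t →
    ∀ y, y ∈ K → Wt (M+2) E (shk lam (M+1) M k) y → y = 0 := by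
  induction t with
  | zero =>
    intro k hk y hy hw
    have hdom := hK.strict hgl (i := M) (j := M+1) (by omega) (by omega)
    obtain ⟨l, rfl⟩ : ∃ l, k = l + 1 := ⟨k-1, by omega⟩
    push_cast at hk
    by_contra hy0
    have hw' := hw.sh hgl (i := M) (j := M+1) (by omega) (by omega)
    rw [shk_sh _ _ _ _ (by omega)] at hw'
    obtain ⟨c, hc⟩ := hK.edge_uniq hgl hbd l (by omega) _
      (hK.stb M (M+1) (by omega) (by omega) y hy) hw'
    obtain ⟨m, hm1, hm2, -⟩ := sl2 hgl hK.wt hK.ne (i := M) (j := M+1) (by omega) (by omega)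
      (by omega) (hK.sing _ _ (by omega) (by omega)) (nilp hgl hK.wt (by omega) (by omega) (by omega))
    have hml : m = l := by omega
    subst hml
    have hfe : E (M+1) M (E M (M+1) y) = 0 := by
      rw [hc, map_smul, ← Module.End.mul_apply, ← pow_succ', hm2, smul_zero]
    have hne : ∀ j, (E (M+1) M ^ j) y ≠ 0 := by
      intro j
      induction j with
      | zero => simpa using hy0
      | succ j ihj =>
        intro h0
        have := ef_pow2 hgl hw (i := M) (j := M+1) (by omega) (by omega) (by omega) j
        rw [h0, map_zero, pow_succ, Module.End.mul_apply, hfe, map_zero, zero_add] at this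
        rcases smul_eq_zero.1 this.symm with h1 | h1
        · rcases mul_eq_zero.1 h1 with h2 | h2
          · exact absurd h2 (by exact_mod_cast Nat.succ_ne_zero j)
          · have h3 : (shk lam (M+1) M (m+1) M - shk lam (M+1) M (m+1) (M+1) - j : ℤ) = 0 := by
              exact_mod_cast h2
            simp [shk] at h3
            omega
        · exact ihj h1
    obtain ⟨j, hj⟩ := nilp hgl hw (i := M) (j := M+1) (by omega) (by omega) (by omega)
    exact hne j hj
  | succ t ih =>
    intro k hk y hy hw
    have hdom := hK.strict hgl (i := M) (j := M+1) (by omega) (by omega)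
    obtain ⟨l, rfl⟩ : ∃ l, k = l + 1 := ⟨k-1, by omega⟩
    push_cast at hk
    have hw' := hw.sh hgl (i := M) (j := M+1) (by omega) (by omega)
    rw [shk_sh _ _ _ _ (by omega)] at hw'
    have := ih l (by omega) _ (hK.stb M (M+1) (by omega) (by omega) y hy) hw'
    exact hK.edge_zero_of hgl hbd (by omega) hy hw this

lemma Kt.wt_last {x : V} {e τ : ℤ} (hx : x ∈ Kt N E K e τ) {w : ℕ → ℤ} (hw : Wt N E w x) :
    Wt (N+1) E (Function.update w N e) x := by
  intro i hi
  by_cases h : i = N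
  · subst h; simpa using hx.2.1
  · rw [Function.update_of_ne h]; exact hw i (by omega)

lemma Kt.last_eq {x : V} {e τ : ℤ} (hx : x ∈ Kt N E K e τ) (hx0 : x ≠ 0) {w : ℕ → ℤ}
    (hw : Wt (N+1) E w x) : w N = e := by
  have := (hw N (by omega)).symm.trans hx.2.1
  exact_mod_cast smul_left_injective ℂ hx0 this

lemma Cls.bound [FiniteDimensional ℂ V] (hgl : IsGL (N+1) E) (hbd : Bd (N+1) E)
    (hK : Cls (N+1) E K ξ lam) {d : ℕ} {τ : ℤ} {x : V} {w : ℕ → ℤ}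
    (hx : x ∈ Kt N E K (lam N + d) τ) (hx0 : x ≠ 0) (hs : Sing N E x) (hw : Wt (N+1) E w x)
    {r : ℕ} (hr : r < N) (hwr : ∀ i, i < N → w i = lam i - (if i = r then (d:ℤ) else 0)) :
    lam (r+1) ≤ lam r - d := by
  by_cases h : r + 1 < N
  · have := dom (n := N) (hgl.mono (by omega)) (hw.mono (by omega)) hx0 hs (i := r) (j := r+1)
      (by omega) h
    rw [hwr _ h, hwr _ hr] at this
    simpa using this
  · obtain rfl : N = r + 1 := by omega
    by_contra hc
    apply hx0
    refine hK.edge_zero hgl hbd (d - (lam r - lam (r+1) + 1)).toNat d (by omega) x hx.1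
      (hw.congr ?_)
    intro i hi
    have hl := Kt.last_eq hx hx0 hw
    by_cases h1 : i = r + 1
    · subst h1; simp [shk, hl]
    · rw [hwr i (by omega)]; simp [shk, h1]

lemma Cls.kt [FiniteDimensional ℂ V] (hgl : IsGL (N+1) E) (hbd : Bd (N+1) E)
    (hK : Cls (N+1) E K ξ lam) {d : ℕ} {τ : ℤ} {x : V} {w : ℕ → ℤ}
    (hx : x ∈ Kt N E K (lam N + d) τ) (hx0 : x ≠ 0) (hs : Sing N E x) (hw : Wt N E w x) :
    Cls N E (Kt N E K (lam N + d) τ) x w where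
  stb := Kt.stb hgl hK.stb
  mem := hx
  ne := hx0
  sing := hs
  wt := hw
  uniq := fun y hy _ hys hyw =>
    hK.kuniq hgl hbd d τ x y _ _ hx hx0 hs (Kt.wt_last hx hw) hy hys (Kt.wt_last hy hyw)

lemma gez_pow {g e z : Module.End ℂ V} (h : ∀ x, g (e x) = e (g x) + z x)
    (hzg : Commute z g) (hze : Commute z e) {x : V} (hx : g x = 0) (j : ℕ) :
    (g ^ j) ((e ^ j) x) = (j.factorial : ℂ) • (z ^ j) x := by
  have h1 : ∀ j : ℕ, g ((e ^ (j+1)) x) = ((j:ℂ)+1) • z ((e ^ j) x) := by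
    intro j
    induction j with
    | zero => simp [h, hx]
    | succ j ih =>
      rw [pow_succ', Module.End.mul_apply, h, ih, map_smul]
      have : e (z ((e^j) x)) = z ((e^(j+1)) x) := by
        rw [pow_succ', Module.End.mul_apply, ← Module.End.mul_apply, ← hze.eq,
          Module.End.mul_apply]
      rw [this]; push_cast; module
  induction j with
  | zero => simp
  | succ j ih =>
    rw [pow_succ, Module.End.mul_apply, h1, map_smul]
    have h2 : (g^j) (z ((e^j) x)) = z ((g^j) ((e^j) x)) := by
      rw [← Module.End.mul_apply, ← (hzg.pow_right j).eq, Module.End.mul_apply]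
    rw [h2, ih, map_smul, smul_smul, pow_succ' z, Module.End.mul_apply, Nat.factorial_succ]
    push_cast; rfl

/-- condition (∗) -/
def StarA (n : ℕ) (E : ℕ → ℕ → V →ₗ[ℂ] V) (mu : ℕ → ℤ) (v : V) : Prop :=
  ∀ i j, i < j → j < n → Sg j E i v = (mu j : ℂ) • E i j v

/-- condition (∗∗) -/
def StarB (n : ℕ) (E : ℕ → ℕ → V →ₗ[ℂ] V) (mu : ℕ → ℤ) (v : V) : Prop :=
  ∀ p, p + 1 < n → ∀ k : ℕ, (k:ℤ) = mu p - mu (p+1) + 1 → (E p (p+1) ^ k) v = 0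

lemma pow_zero_of_le {f : Module.End ℂ V} {x : V} {k m : ℕ} (h : (f^k) x = 0) (hkm : k ≤ m) :
    (f^m) x = 0 := by
  obtain ⟨t, rfl⟩ := Nat.exists_eq_add_of_le hkm
  rw [add_comm, pow_add, Module.End.mul_apply, h, map_zero]

lemma rpow_kill {M r : ℕ} (hgl : IsGL (M+2) E) {x : V} (hs : Sing (M+1) E x) (hr : r < M+1)
    {k : ℕ} (h : (E M (M+1) ^ k) x = 0) : (E r (M+1) ^ k) x = 0 := by
  by_cases hrM : r = M
  · subst hrM; exact h
  · have := gez_pow (g := E r M) (e := E M (M+1)) (z := E r (M+1)) (x := x) (by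
        intro y
        rw [hgl r M M (M+1) (by omega) (by omega) (by omega) (by omega), if_pos rfl,
          if_neg (by omega), sub_zero]) (by
        apply LinearMap.ext; intro y
        rw [Module.End.mul_apply, Module.End.mul_apply,
          hgl r (M+1) r M (by omega) (by omega) (by omega) (by omega), if_neg (by omega),
          if_neg (by omega)]; simp) (by
        apply LinearMap.ext; intro y
        rw [Module.End.mul_apply, Module.End.mul_apply,
          hgl r (M+1) M (M+1) (by omega) (by omega) (by omega) (by omega), if_neg (by omega),
          if_neg (by omega)]; simp) (hs r M (by omega) (by omega)) k
    rw [h, map_zero] at this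
    rcases smul_eq_zero.1 this.symm with h1 | h1
    · exact absurd h1 (by exact_mod_cast Nat.factorial_ne_zero k)
    · exact h1

def ash (lam : ℕ → ℤ) : ℕ → ℤ := fun i => lam i - i

lemma SD.of_dom {n : ℕ} {lam : ℕ → ℤ} (h : ∀ i j, i < j → j < n → lam j ≤ lam i) :
    SD n (ash lam) := by
  intro i j hij hj
  have := h i j hij hj
  simp only [ash]; omega

theorem thmI [FiniteDimensional ℂ V] (n : ℕ) : ∀ (K : Submodule ℂ V) (ξ : V) (lam mu : ℕ → ℤ),
    IsGL n E → Bd n E → Cls n E K ξ lam → ∀ v ∈ K, v ≠ 0 → (∃ w, Wt n E w v) →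
    StarA n E mu v → StarB n E mu v → (∀ i j, i < j → j < n → mu j ≤ mu i) →
    ¬ XX n (ash lam) (ash mu) → ∃ c : ℂ, v = c • ξ := by
  induction n with
  | zero =>
    intro K ξ lam mu hgl hbd hK v hv hv0 hw _ _ _ _
    obtain ⟨w, hw⟩ := hw
    exact hK.uniq v hv w (fun i j _ hj => absurd hj (by omega)) hw
  | succ N ih =>
    intro K ξ lam mu hgl hbd hK v hv hv0 hw hst hst2 hmu hX
    obtain ⟨w, hw⟩ := hw
    have hge := hK.last_ge hgl hbd hv hv0 hw
    obtain ⟨d, hd⟩ : ∃ d : ℕ, w N = lam N + d := ⟨(w N - lam N).toNat, by omega⟩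
    have hvK : v ∈ Kt N E K (lam N + d) (mu N) := by
      refine ⟨hv, ?_, fun i hi => hst i N hi (by omega)⟩
      rw [hw N (by omega), hd]
    have hglN := hgl.mono (Nat.le_succ N)
    have hbdN := hbd.mono (Nat.le_succ N)
    have hb := SD.of_dom hmu
    have ha : SD (N+1) (ash lam) := SD.of_dom fun i j hij hj => hK.strict hgl hij (by omega)
    obtain ⟨lam0, hl0⟩ := hbdN
    obtain ⟨x, hx, w', hx0, hxs, hxw⟩ := exists_sing hglN (K := Kt N E K (lam N + d) (mu N))
      (fun x _ => hl0 x) (fun i j hij hj y hy => Kt.stb hgl hK.stb i j (by omega) hj y hy) hvK hv0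
    have hC := hK.kt hgl hbd hx hx0 hxs hxw
    have hxw' := Kt.wt_last hx hxw
    have hIH := fun hX' => ih _ x w' mu hglN ⟨lam0, hl0⟩ hC v hvK hv0 ⟨w, hw.mono (by omega)⟩
      (fun i j hij hj => hst i j hij (by omega)) (fun p hp => hst2 p (by omega))
      (fun i j hij hj => hmu i j hij (by omega)) hX'
    rcases hK.k3 hgl hbd d (mu N) x _ hx hx0 hxs hxw' with ⟨hd0, c, hc⟩ |
        ⟨hd1, r, hr, hr1, hr2, hr3, hr4, hr5⟩
    · have hwl := Wt.unique hx0 hxw (hc ▸ (hK.wt.mono (Nat.le_succ N)).smul c)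
      obtain ⟨c', hc'⟩ := hIH (by
        intro hXN
        apply hX
        apply XX.up ha hb
        obtain ⟨i, i', j, j', hi, hi', hj, hj', g1, g2, g3, g4, g5, g6, g7⟩ := hXN
        have hash : ∀ i, i < N → ash w' i = ash lam i := fun i hi => by
          simp only [ash, hwl i hi]
        rw [hash i hi] at g1 g4
        rw [hash i' hi'] at g2 g3 g5
        exact ⟨i, i', j, j', hi, hi', hj, hj', g1, g2, g3, g4, g5,
          fun k hk => hash k hk ▸ g6 k hk, fun k hk => hash k hk ▸ g7 k hk⟩)
      exact ⟨c' * c, by rw [hc', hc, smul_smul]⟩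
    · exfalso
      have hwr : ∀ i, i < N → w' i = lam i - (if i = r then (d:ℤ) else 0) := by
        intro i hi
        have := hr2 i hi
        rwa [Function.update_of_ne (by omega)] at this
      have hbound := hK.bound hgl hbd hx hx0 hxs hxw' hr hr2
      have e1 : ash lam (r+1) < ash mu N := by simp only [ash]; push_cast; omega
      have e2 : ash mu N < ash lam r := by simp only [ash]; omega
      obtain ⟨c, hc⟩ := hIH (by
        intro hXN
        apply hX
        refine XX.up2 ha hb hr e1 e2 ?_ hXN
        intro i hi
        simp only [ash, hwr i hi]
        split_ifs with h
        · subst h; omega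
        · omega)
      have hc0 : c ≠ 0 := by rintro rfl; simp at hc; exact hv0 hc
      obtain ⟨M, rfl⟩ : ∃ M, N = M + 1 := ⟨N-1, by omega⟩
      have hmuM := hmu M (M+1) (by omega) (by omega)
      have h2 := hst2 M (by omega) (mu M - mu (M+1) + 1).toNat (by omega)
      rw [hc, map_smul] at h2
      have h3 := (smul_eq_zero.1 h2).resolve_left hc0
      have h4 := rpow_kill hgl hxs hr h3
      have hdlt : d < (mu M - mu (M+1) + 1).toNat := by
        by_contra hcon
        exact hr4 (pow_zero_of_le h4 (by omega))
      apply hX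
      exact XX.of_gap ha hb hr e1 e2 (by simp only [ash]; push_cast at hr1 ⊢; omega)

end C5

section C2
variable {V : Type} [AddCommGroup V] [Module ℂ V] {n : ℕ} {E : ℕ → ℕ → V →ₗ[ℂ] V}

/-- transposed dual action -/
def dE (E : ℕ → ℕ → V →ₗ[ℂ] V) (i j : ℕ) : Module.Dual ℂ V →ₗ[ℂ] Module.Dual ℂ V :=
  (E j i).dualMap

lemma dE_apply (i j : ℕ) (φ : Module.Dual ℂ V) (x : V) : dE E i j φ x = φ (E j i x) := rfl

lemma dE_pow (i j k : ℕ) (φ : Module.Dual ℂ V) (x : V) :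
    (dE E i j ^ k) φ x = φ ((E j i ^ k) x) := by
  induction k generalizing φ x with
  | zero => rfl
  | succ k ih =>
    rw [pow_succ', Module.End.mul_apply, dE_apply, ih, ← Module.End.mul_apply, ← pow_succ]

lemma IsGL.dual (hgl : IsGL n E) : IsGL n (dE E) := by
  intro i j k l hi hj hk hl φ
  ext x
  have := hgl l k j i hl hk hj hi x
  rw [dE_apply, dE_apply, this]
  simp only [LinearMap.add_apply, LinearMap.sub_apply, dE_apply, map_add, map_sub]
  congr 1
  · congr 1
    by_cases h : j = k
    · subst h; simp [dE_apply]
    · simp [h, Ne.symm h]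
  · by_cases h : l = i
    · subst h; simp [dE_apply]
    · simp [h, Ne.symm h]

lemma IRep.dual [FiniteDimensional ℂ V] {ξ : V} {lam : ℕ → ℤ} (h : IRep n E ξ lam) :
    ∃ ξ' : Module.Dual ℂ V, IRep n (dE E) ξ' lam ∧ ξ' ξ = 1 := by
  have hnot : ξ ∉ WB n E (Dms n lam) := fun hc => h.ne (WB.Dms_wt h.wt hc)
  obtain ⟨f, hf, hfk⟩ := Submodule.exists_le_ker_of_notMem hnot
  have hf0 : ∀ y ∈ WB n E (Dms n lam), f y = 0 := fun y hy => hfk hy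
  refine ⟨(f ξ)⁻¹ • f, ⟨h.gl.dual, ?_, ?_, ?_, ?_⟩, by simp [hf]⟩
  · intro hc
    have : ((f ξ)⁻¹ • f) ξ = 0 := by rw [hc]; rfl
    simp [hf] at this
  · intro i j hij hj
    ext x
    rw [dE_apply, LinearMap.smul_apply, hf0 _ (WB.lower h.gl (h.mem_WB x) hij hj)]; simp
  · intro i hi
    ext x
    rw [dE_apply]
    have hx : x ∈ Submodule.span ℂ {ξ} ⊔ WB n E (Dms n lam) :=
      Low.le_top h.gl h.wt (by rw [h.low]; trivial)
    obtain ⟨a, ha, b, hb, rfl⟩ := Submodule.mem_sup.1 hx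
    obtain ⟨c, rfl⟩ := Submodule.mem_span_singleton.1 ha
    have hb' : E i i b ∈ WB n E (Dms n lam) :=
      WB.map (E i i) (fun w x hw hx => by
        rw [hx i hi]; exact WB.mem hw (hx.smul _)) hb
    simp only [map_add, LinearMap.smul_apply, map_smul, h.wt i hi, hf0 _ hb, hf0 _ hb']
    simp only [smul_eq_mul, mul_zero, add_zero]
  · intro U hU
    have hS : Stb n E U.dualCoannihilator := by
      intro i j hi hj y hy
      rw [Submodule.mem_dualCoannihilator] at hy ⊢
      intro φ hφ
      exact hy _ (hU j i hj hi φ hφ)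
    have e := Subspace.dualCoannihilator_dualAnnihilator_eq (W := U)
    rcases h.irr _ hS with h1 | h1
    · right; rw [← e, h1]; simp
    · left; rw [← e, h1]; simp

end C2

open scoped TensorProduct

section C3
variable {V W : Type} [AddCommGroup V] [Module ℂ V] [AddCommGroup W] [Module ℂ W]
  {n : ℕ} {E : ℕ → ℕ → V →ₗ[ℂ] V} {F : ℕ → ℕ → W →ₗ[ℂ] W}

noncomputable def T1 (E : ℕ → ℕ → V →ₗ[ℂ] V) (F : ℕ → ℕ → W →ₗ[ℂ] W) (i j : ℕ) :
    V ⊗[ℂ] W →ₗ[ℂ] V ⊗[ℂ] W :=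
  TensorProduct.map (E i j) LinearMap.id + TensorProduct.map LinearMap.id (F i j)

noncomputable def T2 (n : ℕ) (E : ℕ → ℕ → V →ₗ[ℂ] V) (F : ℕ → ℕ → W →ₗ[ℂ] W) (i j : ℕ) :
    V ⊗[ℂ] W →ₗ[ℂ] V ⊗[ℂ] W :=
  ∑ a ∈ Finset.range n, TensorProduct.map (E i a) (F a j)

def YI (n : ℕ) (E : ℕ → ℕ → V →ₗ[ℂ] V) (F : ℕ → ℕ → W →ₗ[ℂ] W) : Prop :=
  ∀ U : Submodule ℂ (V ⊗[ℂ] W), Stb n (T1 E F) U → Stb n (T2 n E F) U → U = ⊥ ∨ U = ⊤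

lemma T1_tmul (i j : ℕ) (x : V) (y : W) : T1 E F i j (x ⊗ₜ y) = E i j x ⊗ₜ y + x ⊗ₜ F i j y := by
  simp [T1]

lemma T2_tmul (i j : ℕ) (x : V) (y : W) :
    T2 n E F i j (x ⊗ₜ y) = ∑ a ∈ Finset.range n, E i a x ⊗ₜ F a j y := by
  simp [T2, LinearMap.sum_apply]

lemma T1_gl (hE : IsGL n E) (hF : IsGL n F) : IsGL n (T1 E F) := by
  intro i j k l hi hj hk hl z
  induction z using TensorProduct.induction_on with
  | zero => simp
  | add x y hx hy =>
    simp only [map_add, hx, hy]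
    split_ifs <;> abel
  | tmul x y =>
    simp only [T1_tmul, map_add]
    rw [hE i j k l hi hj hk hl x, hF i j k l hi hj hk hl y]
    simp only [TensorProduct.add_tmul, TensorProduct.sub_tmul, TensorProduct.tmul_add,
      TensorProduct.tmul_sub]
    split_ifs <;> (try simp only [TensorProduct.zero_tmul, TensorProduct.tmul_zero]) <;> abel

/-- commutation of `t1` with `t2` -/
lemma T12_comm (hE : IsGL n E) (hF : IsGL n F) {i j k l : ℕ} (hi : i < n) (hj : j < n) (hk : k < n)
    (hl : l < n) (z : V ⊗[ℂ] W) : T1 E F i j (T2 n E F k l z) = T2 n E F k l (T1 E F i j z) +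
      (if j = k then T2 n E F i l z else 0) - (if l = i then T2 n E F k j z else 0) := by
  induction z using TensorProduct.induction_on with
  | zero => simp
  | add x y hx hy =>
    simp only [map_add, hx, hy]
    split_ifs <;> abel
  | tmul x y =>
    simp only [T1_tmul, T2_tmul, map_add, map_sum]
    have h1 : ∀ a ∈ Finset.range n, E i j (E k a x) ⊗ₜ[ℂ] F a l y + E k a x ⊗ₜ[ℂ] F i j (F a l y) =
        (E k a (E i j x) ⊗ₜ[ℂ] F a l y + E k a x ⊗ₜ[ℂ] F a l (F i j y)) +
        (if j = k then E i a x ⊗ₜ[ℂ] F a l y else 0) - (if a = i then E k j x ⊗ₜ[ℂ] F i l y else 0)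
        + (if a = j then E k j x ⊗ₜ[ℂ] F i l y else 0)
        - (if l = i then E k a x ⊗ₜ[ℂ] F a j y else 0) := by
      intro a ha
      have ha := Finset.mem_range.1 ha
      rw [hE i j k a hi hj hk ha x, hF i j a l hi hj ha hl y]
      simp only [TensorProduct.add_tmul, TensorProduct.sub_tmul, TensorProduct.tmul_add,
        TensorProduct.tmul_sub]
      have e1 : (if j = k then E i a x else 0) ⊗ₜ[ℂ] F a l y =
        if j = k then E i a x ⊗ₜ[ℂ] F a l y else 0 := by split_ifs <;> simp
      have e2 : (if a = i then E k j x else 0) ⊗ₜ[ℂ] F a l y =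
        if a = i then E k j x ⊗ₜ[ℂ] F i l y else 0 := by
          split_ifs with h
          · rw [h]
          · simp
      have e3 : E k a x ⊗ₜ[ℂ] (if j = a then F i l y else 0) =
        if a = j then E k j x ⊗ₜ[ℂ] F i l y else 0 := by
          by_cases h : a = j
          · simp [h]
          · simp [h, Ne.symm h]
      have e4 : E k a x ⊗ₜ[ℂ] (if l = i then F a j y else 0) =
        if l = i then E k a x ⊗ₜ[ℂ] F a j y else 0 := by split_ifs <;> simp
      rw [e1, e2, e3, e4]; abel
    rw [← Finset.sum_add_distrib, Finset.sum_congr rfl h1]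
    simp only [Finset.sum_sub_distrib, Finset.sum_add_distrib, Finset.sum_ite_eq',
      Finset.mem_range, hi, hj, if_true]
    have e5 : ∀ (p : Prop) [Decidable p] (f : ℕ → V ⊗[ℂ] W),
      (∑ a ∈ Finset.range n, if p then f a else 0) = if p then ∑ a ∈ Finset.range n, f a else 0 := by
        intro p _ f; split_ifs <;> simp
    rw [e5, e5]; abel

lemma Wt.tmul {w w' : ℕ → ℤ} {x : V} {y : W} (hx : Wt n E w x) (hy : Wt n F w' y) :
    Wt n (T1 E F) (fun i => w i + w' i) (x ⊗ₜ y) := by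
  intro i hi
  rw [T1_tmul, hx i hi, hy i hi, TensorProduct.tmul_smul, ← TensorProduct.smul_tmul', ← add_smul]
  push_cast; rfl

lemma psum_add (w w' : ℕ → ℤ) (m : ℕ) : psum (fun i => w i + w' i) m = psum w m + psum w' m :=
  Finset.sum_add_distrib

lemma T1_bd {lam mu : ℕ → ℤ} {ξ : V} {η : W} (hE : IRep n E ξ lam) (hF : IRep n F η mu)
    (z : V ⊗[ℂ] W) : z ∈ WB n (T1 E F) (Bdd n (fun i => lam i + mu i)) := by
  induction z using TensorProduct.induction_on with
  | zero => exact zero_mem _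
  | add x y hx hy => exact add_mem hx hy
  | tmul x y =>
    have hx := hE.mem_WB x
    have hy := hF.mem_WB y
    refine WB.map (n := n) (E := E) (P := Dm n lam)
      ((TensorProduct.mk ℂ V W).flip y) ?_ hx
    intro w x hw hx
    refine WB.map (n := n) (E := F) (P := Dm n mu) (TensorProduct.mk ℂ V W x) ?_ hy
    intro w' y hw' hy
    refine WB.mem ?_ (hx.tmul hy)
    intro j hj
    rw [psum_add, psum_add]
    exact add_le_add (hw.1 j hj) (hw'.1 j hj)

/-- extremal weight vectors -/
lemma exists_max {K : Submodule ℂ V} {lam : ℕ → ℤ}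
    (hB : ∀ x ∈ K, x ∈ WB n E (Bdd n lam))
    (hK : ∀ i, i < n → ∀ y ∈ K, E i i y ∈ K) {x : V} (hx : x ∈ K) (hx0 : x ≠ 0) :
    ∃ y ∈ K, ∃ w, y ≠ 0 ∧ Wt n E w y ∧
      ∀ i j, i < j → j < n → ∀ z ∈ K, Wt n E (sh w i j) z → z = 0 := by
  classical
  let Q : ℕ → Prop := fun k => ∃ y ∈ K, ∃ w, y ≠ 0 ∧ Wt n E w y ∧
    ∑ j ∈ Finset.range (n+1), (psum lam j - psum w j) = k
  have hex : ∃ k, Q k := by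
    obtain ⟨w, y, hy, hP, hy0, hyw⟩ := WB.exists hK hx hx0 (hB x hx)
    have : 0 ≤ ∑ j ∈ Finset.range (n+1), (psum lam j - psum w j) := by
      apply Finset.sum_nonneg
      intro j hj
      have := hP j (by have := Finset.mem_range.1 hj; omega)
      omega
    obtain ⟨k, hk⟩ := Int.eq_ofNat_of_zero_le this
    exact ⟨k, y, hy, w, hy0, hyw, hk⟩
  obtain ⟨y, hy, w, hy0, hyw, hsum⟩ := Nat.find_spec hex
  refine ⟨y, hy, w, hy0, hyw, ?_⟩
  intro i j hij hj z h2 h1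
  by_contra hne
  obtain ⟨w', hP, hw'⟩ := WB.wt hne h1 (hB _ h2)
  have hps : ∀ m, m ≤ n → psum (sh w i j) m ≤ psum lam m := by
    intro m hm
    rw [psum_congr (m := m) fun a ha => hw' a (by omega)]
    exact hP m hm
  have hnn : 0 ≤ ∑ m ∈ Finset.range (n+1), (psum lam m - psum (sh w i j) m) := by
    apply Finset.sum_nonneg
    intro m hm
    have := hps m (by have := Finset.mem_range.1 hm; omega)
    omega
  obtain ⟨k, hk⟩ := Int.eq_ofNat_of_zero_le hnn
  have hlt : ∑ m ∈ Finset.range (n+1), (psum lam m - psum (sh w i j) m) <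
      ∑ m ∈ Finset.range (n+1), (psum lam m - psum w m) := by
    apply Finset.sum_lt_sum
    · intro m _; rw [psum_sh]; split_ifs <;> omega
    · refine ⟨i+1, Finset.mem_range.2 (by omega), ?_⟩
      rw [psum_sh]; split_ifs <;> omega
  have := Nat.find_min' hex ⟨z, h2, sh w i j, hne, h1, hk⟩
  omega

/-- contraction with a functional on the second factor -/
noncomputable def ctr (φ : Module.Dual ℂ W) : V ⊗[ℂ] W →ₗ[ℂ] V :=
  (TensorProduct.rid ℂ V).toLinearMap ∘ₗ LinearMap.lTensor V φ

lemma ctr_tmul (φ : Module.Dual ℂ W) (x : V) (y : W) : ctr φ (x ⊗ₜ[ℂ] y) = φ y • x := by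
  simp [ctr]

lemma ctr_add (φ ψ : Module.Dual ℂ W) (z : V ⊗[ℂ] W) : ctr (φ + ψ) z = ctr φ z + ctr ψ z := by
  induction z using TensorProduct.induction_on with
  | zero => simp
  | add x y hx hy => simp only [map_add, hx, hy]; abel
  | tmul x y => simp [ctr_tmul, add_smul]

lemma ctr_smul (c : ℂ) (φ : Module.Dual ℂ W) (z : V ⊗[ℂ] W) : ctr (c • φ) z = c • ctr φ z := by
  induction z using TensorProduct.induction_on with
  | zero => simp
  | add x y hx hy => simp only [map_add, hx, hy, smul_add]
  | tmul x y => simp [ctr_tmul, mul_smul]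

lemma ctr_T1 (φ : Module.Dual ℂ W) (i j : ℕ) (z : V ⊗[ℂ] W) :
    ctr φ (T1 E F i j z) = E i j (ctr φ z) + ctr (dE F j i φ) z := by
  induction z using TensorProduct.induction_on with
  | zero => simp
  | add x y hx hy => simp only [map_add, hx, hy]; abel
  | tmul x y => simp [ctr_tmul, T1_tmul, dE_apply]

lemma ctr_T2 (φ : Module.Dual ℂ W) (i j : ℕ) (z : V ⊗[ℂ] W) :
    ctr φ (T2 n E F i j z) = ∑ a ∈ Finset.range n, E i a (ctr (dE F j a φ) z) := by
  induction z using TensorProduct.induction_on with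
  | zero => simp
  | add x y hx hy => simp only [map_add, hx, hy, Finset.sum_add_distrib]
  | tmul x y => simp [ctr_tmul, T2_tmul, dE_apply]

lemma ctr_eq_zero [FiniteDimensional ℂ W] (z : V ⊗[ℂ] W)
    (h : ∀ φ : Module.Dual ℂ W, ctr φ z = 0) : z = 0 := by
  let b := Module.finBasis ℂ W
  have : ∀ z : V ⊗[ℂ] W, z = ∑ i, ctr (b.coord i) z ⊗ₜ[ℂ] b i := by
    intro z
    induction z using TensorProduct.induction_on with
    | zero => simp
    | add x y hx hy =>
      nth_rewrite 1 [hx, hy]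
      simp [TensorProduct.add_tmul, Finset.sum_add_distrib]
    | tmul x y =>
      simp only [ctr_tmul, TensorProduct.smul_tmul, ← TensorProduct.tmul_sum]
      congr 1
      exact (b.sum_repr y).symm
  rw [this z]
  simp [h]

end C3

open scoped TensorProduct

section C4
variable {V W : Type} [AddCommGroup V] [Module ℂ V] [AddCommGroup W] [Module ℂ W]
  {n : ℕ} {E : ℕ → ℕ → V →ₗ[ℂ] V} {F : ℕ → ℕ → W →ₗ[ℂ] W}

lemma ctr_upper {ζ : V ⊗[ℂ] W} (hz : ∀ i j, i < j → j < n → T1 E F i j ζ = 0)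
    (φ : Module.Dual ℂ W) {i j : ℕ} (hij : i < j) (hj : j < n) :
    ctr (dE F j i φ) ζ = - E i j (ctr φ ζ) := by
  have := ctr_T1 (E := E) (F := F) φ i j ζ
  rw [hz i j hij hj, map_zero] at this
  exact (neg_eq_of_add_eq_zero_right this.symm).symm

lemma eq_zero_of_ctr [FiniteDimensional ℂ W] {η' : Module.Dual ℂ W} {mu : ℕ → ℤ}
    (hd : IRep n (dE F) η' mu) {ζ : V ⊗[ℂ] W}
    (hz : ∀ i j, i < j → j < n → T1 E F i j ζ = 0) (h0 : ctr η' ζ = 0) : ζ = 0 := by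
  apply ctr_eq_zero
  let Z : Submodule ℂ (Module.Dual ℂ W) :=
    { carrier := {φ | ctr φ ζ = 0}
      add_mem' := fun {a b} ha hb => by
        change ctr (a + b) ζ = 0
        rw [ctr_add, ha, hb, add_zero]
      zero_mem' := by
        change ctr 0 ζ = 0
        have := ctr_smul 0 η' ζ
        rwa [zero_smul, zero_smul] at this
      smul_mem' := fun c a ha => by
        change ctr (c • a) ζ = 0
        rw [ctr_smul, ha, smul_zero] }
  have : Low n (dE F) η' ≤ Z := by
    apply Low.le h0
    intro i j hji hi y _ hy
    change ctr (dE F i j y) ζ = 0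
    rw [ctr_upper hz y hji hi, hy, map_zero, neg_zero]
  intro φ
  rw [hd.low] at this
  exact this (x := φ) trivial

theorem thmV [FiniteDimensional ℂ V] [FiniteDimensional ℂ W] {ξ : V} {η : W} {lam mu : ℕ → ℤ}
    (hE : IRep n E ξ lam) (hF : IRep n F η mu) (hX : ¬ XX n (ash lam) (ash mu))
    (U : Submodule ℂ (V ⊗[ℂ] W)) (h1 : Stb n (T1 E F) U) (h2 : Stb n (T2 n E F) U) (hU : U ≠ ⊥) :
    ξ ⊗ₜ[ℂ] η ∈ U := by
  obtain ⟨x, hx, hx0⟩ := Submodule.exists_mem_ne_zero_of_ne_bot hU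
  obtain ⟨ζ, hζ, w, hζ0, hw, hmax⟩ := exists_max (n := n) (E := T1 E F) (K := U)
    (fun x _ => T1_bd hE hF x) (fun i hi y hy => h1 i i hi hi y hy) hx hx0
  have u1 : ∀ i j, i < j → j < n → T1 E F i j ζ = 0 := fun i j hij hj =>
    hmax i j hij hj _ (h1 i j (by omega) hj ζ hζ)
      (hw.sh (T1_gl hE.gl hF.gl) (by omega) hj)
  have u2 : ∀ i j, i < j → j < n → T2 n E F i j ζ = 0 := fun i j hij hj =>
    hmax i j hij hj _ (h2 i j (by omega) hj ζ hζ) (by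
      intro k hk
      rw [T12_comm hE.gl hF.gl hk hk (by omega) hj, hw k hk, map_smul]
      unfold sh
      by_cases h1 : k = i <;> by_cases h2 : k = j
      · omega
      · subst h1; simp [h2, Ne.symm h2]; module
      · subst h2; simp [h1]; module
      · simp [h1, h2, Ne.symm h2])
  obtain ⟨η', hd, hη⟩ := hF.dual
  have hv0 : ctr η' ζ ≠ 0 := fun h => hζ0 (eq_zero_of_ctr hd u1 h)
  obtain ⟨c, hc⟩ := thmI n ⊤ ξ lam mu hE.gl hE.bd hE.cls (ctr η' ζ) trivial hv0
    ⟨fun i => w i - mu i, by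
      intro i hi
      have := ctr_T1 (E := E) (F := F) η' i i ζ
      rw [hw i hi, hd.wt i hi, ctr_smul, map_smul] at this
      push_cast
      rw [sub_smul, this]; abel⟩
    (by
      intro i j hij hj
      have := ctr_T2 (n := n) (E := E) (F := F) η' i j ζ
      rw [u2 i j hij hj, map_zero] at this
      have hs : ∀ a ∈ Finset.range n, a ∉ Finset.range (j+1) →
          E i a (ctr (dE F j a η') ζ) = 0 := by
        intro a ha ha'
        simp only [Finset.mem_range] at ha ha'
        rw [hd.sing j a (by omega) ha]
        have := ctr_smul 0 η' ζ
        rw [zero_smul, zero_smul] at this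
        rw [this, map_zero]
      rw [← Finset.sum_subset (Finset.range_mono (by omega : j + 1 ≤ n)) hs,
        Finset.sum_range_succ, hd.wt j hj, ctr_smul, map_smul] at this
      have h3 : ∑ a ∈ Finset.range j, E i a (ctr (dE F j a η') ζ) = - Sg j E i (ctr η' ζ) := by
        unfold Sg
        rw [← Finset.sum_neg_distrib]
        apply Finset.sum_congr rfl
        intro a ha
        have ha := Finset.mem_range.1 ha
        rw [ctr_upper u1 η' ha hj, map_neg]
      rw [h3] at this
      have h4 := neg_add_eq_zero.1 this.symm
      exact h4)
    (by
      intro p hp k hk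
      obtain ⟨m, hm, hm0⟩ := hd.pow_zero hp
      have hkm : k = m + 1 := by omega
      have key : ∀ (k : ℕ), ctr ((dE F (p+1) p ^ k) η') ζ =
          (-1:ℂ)^k • (E p (p+1) ^ k) (ctr η' ζ) := by
        intro k
        induction k with
        | zero => simp
        | succ k ih =>
          rw [pow_succ', Module.End.mul_apply, ctr_upper u1 _ (by omega) hp, ih, map_smul,
            pow_succ' (E p (p+1)), Module.End.mul_apply, pow_succ]
          module
      have h5 := key k
      rw [hkm, hm0] at h5
      have := ctr_smul 0 η' ζ
      rw [zero_smul, zero_smul] at this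
      rw [this] at h5
      rw [hkm]
      exact (smul_eq_zero.1 h5.symm).resolve_left (by simp))
    (fun i j hij hj => hF.dom hij hj) hX
  have hc0 : c ≠ 0 := by rintro rfl; simp at hc; exact hv0 hc
  have : ζ - c • (ξ ⊗ₜ[ℂ] η) = 0 := by
    refine eq_zero_of_ctr (E := E) hd ?_ ?_
    · intro i j hij hj
      rw [map_sub, map_smul, u1 i j hij hj, T1_tmul, hE.sing i j hij hj, hF.sing i j hij hj]
      simp
    · rw [map_sub, map_smul, ctr_tmul, hη, hc]; simp
  have h6 : ξ ⊗ₜ[ℂ] η = c⁻¹ • ζ := by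
    rw [sub_eq_zero.1 this, smul_smul, inv_mul_cancel₀ hc0, one_smul]
  rw [h6]
  exact U.smul_mem _ hζ

/-- pairing -/
noncomputable def Dl [FiniteDimensional ℂ V] [FiniteDimensional ℂ W] :
    (Module.Dual ℂ W ⊗[ℂ] Module.Dual ℂ V) ≃ₗ[ℂ] Module.Dual ℂ (V ⊗[ℂ] W) :=
  (TensorProduct.comm ℂ _ _) ≪≫ₗ TensorProduct.dualDistribEquiv ℂ V W

lemma Dl_tmul [FiniteDimensional ℂ V] [FiniteDimensional ℂ W] (φ : Module.Dual ℂ W)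
    (ψ : Module.Dual ℂ V) (x : V) (y : W) : Dl (φ ⊗ₜ[ℂ] ψ) (x ⊗ₜ[ℂ] y) = ψ x * φ y := by
  simp only [Dl, LinearEquiv.trans_apply, TensorProduct.comm_tmul]
  exact TensorProduct.dualDistrib_apply _ _ _ _

lemma Dl_T1 [FiniteDimensional ℂ V] [FiniteDimensional ℂ W] (i j : ℕ)
    (z : Module.Dual ℂ W ⊗[ℂ] Module.Dual ℂ V) (u : V ⊗[ℂ] W) :
    Dl (T1 (dE F) (dE E) i j z) u = Dl z (T1 E F j i u) := by
  induction u using TensorProduct.induction_on with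
  | zero => simp
  | add x y hx hy => simp only [map_add, hx, hy]
  | tmul x y =>
    induction z using TensorProduct.induction_on with
    | zero => simp
    | add x y hx hy => simp only [map_add, LinearMap.add_apply, hx, hy]
    | tmul φ ψ =>
      simp only [T1_tmul, map_add, LinearMap.add_apply, Dl_tmul, dE_apply]; ring

lemma Dl_T2 [FiniteDimensional ℂ V] [FiniteDimensional ℂ W] (i j : ℕ)
    (z : Module.Dual ℂ W ⊗[ℂ] Module.Dual ℂ V) (u : V ⊗[ℂ] W) :
    Dl (T2 n (dE F) (dE E) i j z) u = Dl z (T2 n E F j i u) := by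
  induction u using TensorProduct.induction_on with
  | zero => simp
  | add x y hx hy => simp only [map_add, hx, hy]
  | tmul x y =>
    induction z using TensorProduct.induction_on with
    | zero => simp
    | add x y hx hy => simp only [map_add, LinearMap.add_apply, hx, hy]
    | tmul φ ψ =>
      simp only [T2_tmul, map_sum, LinearMap.sum_apply, Dl_tmul, dE_apply]

/-- the perpendicular subspace -/
noncomputable def perp [FiniteDimensional ℂ V] [FiniteDimensional ℂ W]
    (U : Submodule ℂ (V ⊗[ℂ] W)) : Submodule ℂ (Module.Dual ℂ W ⊗[ℂ] Module.Dual ℂ V) :=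
  U.dualAnnihilator.comap Dl.toLinearMap

lemma mem_perp [FiniteDimensional ℂ V] [FiniteDimensional ℂ W] {U : Submodule ℂ (V ⊗[ℂ] W)}
    {z : Module.Dual ℂ W ⊗[ℂ] Module.Dual ℂ V} : z ∈ perp U ↔ ∀ u ∈ U, Dl z u = 0 := by
  simp [perp, Submodule.mem_dualAnnihilator]

lemma perp_bot [FiniteDimensional ℂ V] [FiniteDimensional ℂ W] {U : Submodule ℂ (V ⊗[ℂ] W)}
    (h : perp U = ⊥) : U = ⊤ := by
  have : U.dualAnnihilator = ⊥ := by
    rw [eq_bot_iff]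
    intro φ hφ
    have : Dl.symm φ ∈ perp U := by simpa [perp] using hφ
    rw [h] at this
    have := (Submodule.mem_bot ℂ).1 this
    simpa using this
  exact Subspace.dualAnnihilator_inj.1 (by rw [this]; simp)

lemma perp_top [FiniteDimensional ℂ V] [FiniteDimensional ℂ W] {U : Submodule ℂ (V ⊗[ℂ] W)}
    (h : perp U = ⊤) : U = ⊥ := by
  have : U.dualAnnihilator = ⊤ := by
    rw [eq_top_iff]
    intro φ _
    have : Dl.symm φ ∈ perp U := by rw [h]; trivial
    simpa [perp] using this
  exact Subspace.dualAnnihilator_inj.1 (by rw [this]; simp)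

lemma perp_stb1 [FiniteDimensional ℂ V] [FiniteDimensional ℂ W] {U : Submodule ℂ (V ⊗[ℂ] W)}
    (h : Stb n (T1 E F) U) : Stb n (T1 (dE F) (dE E)) (perp U) := by
  intro i j hi hj z hz
  rw [mem_perp] at hz ⊢
  intro u hu
  rw [Dl_T1]
  exact hz _ (h j i hj hi u hu)

lemma perp_stb2 [FiniteDimensional ℂ V] [FiniteDimensional ℂ W] {U : Submodule ℂ (V ⊗[ℂ] W)}
    (h : Stb n (T2 n E F) U) : Stb n (T2 n (dE F) (dE E)) (perp U) := by
  intro i j hi hj z hz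
  rw [mem_perp] at hz ⊢
  intro u hu
  rw [Dl_T2]
  exact hz _ (h j i hj hi u hu)

theorem irred_of_not_XX [FiniteDimensional ℂ V] [FiniteDimensional ℂ W] {ξ : V} {η : W}
    {lam mu : ℕ → ℤ} (hE : IRep n E ξ lam) (hF : IRep n F η mu)
    (hX : ¬ XX n (ash lam) (ash mu)) (hX' : ¬ XX n (ash mu) (ash lam)) : YI n E F := by
  intro U h1 h2
  by_cases hU : U = ⊥
  · exact Or.inl hU
  right
  by_contra hT
  have a1 := thmV hE hF hX U h1 h2 hU
  obtain ⟨ξ', hd, hξ⟩ := hE.dual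
  obtain ⟨η', hd', hη⟩ := hF.dual
  have a2 := thmV hd' hd hX' (perp U) (perp_stb1 h1) (perp_stb2 h2) (fun h => hT (perp_bot h))
  have := mem_perp.1 a2 _ a1
  rw [Dl_tmul, hξ, hη] at this
  simp at this

lemma YI.dual [FiniteDimensional ℂ V] [FiniteDimensional ℂ W] (hdd : YI n (dE F) (dE E)) :
    YI n E F := by
  intro U h1 h2
  rcases hdd (perp U) (perp_stb1 h1) (perp_stb2 h2) with h | h
  · exact Or.inr (perp_bot h)
  · exact Or.inl (perp_top h)

lemma YI.dual' [FiniteDimensional ℂ V] [FiniteDimensional ℂ W] (h : YI n E F) :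
    YI n (dE F) (dE E) := by
  intro U h1 h2
  let Up : Submodule ℂ (V ⊗[ℂ] W) := (U.map Dl.toLinearMap).dualCoannihilator
  have hm : ∀ u, u ∈ Up ↔ ∀ z ∈ U, Dl z u = 0 := by
    intro u
    simp only [Up, Submodule.mem_dualCoannihilator]
    constructor
    · intro hh z hz; exact hh _ (Submodule.mem_map_of_mem hz)
    · rintro hh φ hφ
      obtain ⟨z, hz, rfl⟩ := Submodule.mem_map.1 hφ
      exact hh z hz
  have s1 : Stb n (T1 E F) Up := by
    intro i j hi hj u hu
    rw [hm] at hu ⊢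
    intro z hz
    rw [← Dl_T1]
    exact hu _ (h1 j i hj hi z hz)
  have s2 : Stb n (T2 n E F) Up := by
    intro i j hi hj u hu
    rw [hm] at hu ⊢
    intro z hz
    rw [← Dl_T2]
    exact hu _ (h2 j i hj hi z hz)
  have e := Subspace.dualCoannihilator_dualAnnihilator_eq (W := U.map Dl.toLinearMap)
  have hperp : perp Up = U := by
    unfold perp
    change Submodule.comap _ (Submodule.dualAnnihilator (Submodule.dualCoannihilator _)) = U
    rw [e]
    exact Submodule.comap_map_eq_of_injective Dl.injective U
  rcases h Up s1 s2 with h3 | h3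
  · right; rw [← hperp, h3]; simp [perp]
  · left; rw [← hperp, h3]; simp [perp]

end C4

section C5
variable {V : Type} [AddCommGroup V] [Module ℂ V] {n : ℕ} {E : ℕ → ℕ → V →ₗ[ℂ] V}

/-- Casimir operator -/
def Cas (n : ℕ) (E : ℕ → ℕ → V →ₗ[ℂ] V) : V →ₗ[ℂ] V :=
  ∑ i ∈ Finset.range n, ∑ j ∈ Finset.range n, (E i j) ∘ₗ (E j i)

lemma Cas_apply (x : V) : Cas n E x =
    ∑ i ∈ Finset.range n, ∑ j ∈ Finset.range n, E i j (E j i x) := by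
  simp [Cas, LinearMap.sum_apply]

lemma Cas_comm (hgl : IsGL n E) {k l : ℕ} (hk : k < n) (hl : l < n) (x : V) :
    E k l (Cas n E x) = Cas n E (E k l x) := by
  rw [Cas_apply, Cas_apply, map_sum]
  have h1 : ∀ i ∈ Finset.range n, E k l (∑ j ∈ Finset.range n, E i j (E j i x)) =
      (∑ j ∈ Finset.range n, E i j (E j i (E k l x)))
      + (if l = i then ∑ j ∈ Finset.range n, E k j (E j l x) else 0)
      - E i l (E k i x) + E i l (E k i x)
      - (if k = i then ∑ j ∈ Finset.range n, E k j (E j l x) else 0) := by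
    intro i hi
    have hi := Finset.mem_range.1 hi
    rw [map_sum]
    have h2 : ∀ j ∈ Finset.range n, E k l (E i j (E j i x)) =
        E i j (E j i (E k l x)) + (if l = i then E k j (E j l x) else 0)
        - (if k = j then E i l (E k i x) else 0) + (if l = j then E i l (E k i x) else 0)
        - (if k = i then E k j (E j l x) else 0) := by
      intro j hj
      have hj := Finset.mem_range.1 hj
      rw [hgl k l i j hk hl hi hj, hgl k l j i hk hl hj hi, map_sub, map_add]
      have e1 : (if l = i then E k j (E j i x) else 0) = if l = i then E k j (E j l x) else 0 := by
        split_ifs with h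
        · rw [h]
        · rfl
      have e2 : (if j = k then E i l (E j i x) else 0) = if k = j then E i l (E k i x) else 0 := by
        by_cases h : k = j
        · simp [h]
        · simp [h, Ne.symm h]
      have e3 : E i j (if l = j then E k i x else 0) = if l = j then E i l (E k i x) else 0 := by
        split_ifs with h
        · rw [h]
        · simp
      have e4 : E i j (if i = k then E j l x else 0) = if k = i then E k j (E j l x) else 0 := by
        by_cases h : k = i
        · simp [h]
        · simp [h, Ne.symm h]
      rw [e1, e2, e3, e4]; abel
    rw [Finset.sum_congr rfl h2]
    simp only [Finset.sum_sub_distrib, Finset.sum_add_distrib, Finset.sum_ite_eq,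
      Finset.mem_range, hk, hl, if_true]
    have e5 : ∀ (p : Prop) [Decidable p] (f : ℕ → V),
      (∑ a ∈ Finset.range n, if p then f a else 0) = if p then ∑ a ∈ Finset.range n, f a else 0 := by
        intro p _ f; split_ifs <;> simp
    rw [e5, e5]
  rw [Finset.sum_congr rfl h1]
  simp only [Finset.sum_sub_distrib, Finset.sum_add_distrib, Finset.sum_ite_eq,
      Finset.mem_range, hk, hl, if_true]
  abel

/-- Casimir eigenvalue -/
def cas (n : ℕ) (w : ℕ → ℤ) : ℤ := ∑ i ∈ Finset.range n, w i * (w i + n - 1 - 2 * i)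

lemma sum_lt_ind {n i : ℕ} (hi : i < n) (c : ℤ) :
    (∑ j ∈ Finset.range n, if i < j then c else 0) = c * ((n:ℤ) - 1 - i) := by
  induction n with
  | zero => omega
  | succ n ih =>
    rw [Finset.sum_range_succ]
    rcases Nat.lt_succ_iff_lt_or_eq.1 hi with h | h
    · rw [ih h, if_pos h]; push_cast; ring
    · subst h
      rw [Finset.sum_eq_zero]
      · simp
      · intro j hj
        have := Finset.mem_range.1 hj
        rw [if_neg (by omega)]

lemma sum_gt_ind {n j : ℕ} (hj : j ≤ n) (c : ℤ) :
    (∑ i ∈ Finset.range n, if i < j then c else 0) = c * (j:ℤ) := by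
  induction n with
  | zero => have : j = 0 := by omega
            subst this; simp
  | succ n ih =>
    rw [Finset.sum_range_succ]
    rcases Nat.lt_succ_iff_lt_or_eq.1 (Nat.lt_succ_of_le hj) with h | h
    · rw [ih (by omega), if_neg (by omega)]; ring
    · subst h
      rw [if_pos (by omega), Finset.sum_congr rfl (g := fun _ => c)]
      · simp; ring
      · intro j hj
        have := Finset.mem_range.1 hj
        rw [if_pos (by omega)]

lemma Cas_sing (hgl : IsGL n E) {x : V} {w : ℕ → ℤ} (hs : Sing n E x) (hw : Wt n E w x) :
    Cas n E x = (cas n w : ℂ) • x := by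
  rw [Cas_apply]
  have h1 : ∀ i ∈ Finset.range n, ∀ j ∈ Finset.range n, E i j (E j i x) =
      (((if i = j then w i * w i else 0) + (if i < j then w i else 0) - (if i < j then w j else 0)
        : ℤ) : ℂ) • x := by
    intro i hi j hj
    have hi := Finset.mem_range.1 hi
    have hj := Finset.mem_range.1 hj
    rcases lt_trichotomy i j with h | h | h
    · rw [hgl i j j i hi hj hj hi, hs i j h hj, hw i hi, hw j hj, if_pos rfl, if_pos rfl,
        if_neg (by omega), if_pos h, if_pos h, map_zero]
      push_cast; module
    · subst h
      rw [hw i hi, map_smul, hw i hi, if_pos rfl]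
      simp only [lt_irrefl, if_false]
      push_cast; module
    · rw [hs j i h hi, map_zero, if_neg (by omega), if_neg (by omega), if_neg (by omega)]; simp
  rw [Finset.sum_congr rfl fun i hi => Finset.sum_congr rfl (h1 i hi)]
  simp only [← Finset.sum_smul, ← Int.cast_sum]
  congr 2
  have h2 : ∑ i ∈ Finset.range n, ∑ j ∈ Finset.range n,
      ((if i = j then w i * w i else 0) + (if i < j then w i else 0) - (if i < j then w j else 0))
      = (∑ i ∈ Finset.range n, (w i * w i + w i * ((n:ℤ) - 1 - i))) -
        ∑ j ∈ Finset.range n, w j * (j:ℤ) := by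
    simp only [Finset.sum_sub_distrib]
    congr 1
    · apply Finset.sum_congr rfl
      intro i hi
      have hi' := Finset.mem_range.1 hi
      rw [Finset.sum_add_distrib, sum_lt_ind hi']
      simp [hi']
    · rw [Finset.sum_comm]
      apply Finset.sum_congr rfl
      intro j hj
      have hj' := Finset.mem_range.1 hj
      rw [sum_gt_ind hj'.le]
  rw [h2, cas, ← Finset.sum_sub_distrib]
  apply Finset.sum_congr rfl
  intro i _
  ring

lemma cas_abel (n : ℕ) (mu w : ℕ → ℤ) : cas (n+1) mu - cas (n+1) w =
    (psum mu (n+1) - psum w (n+1)) * (mu n + w n - n) +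
    ∑ j ∈ Finset.range n, (psum mu (j+1) - psum w (j+1)) *
      ((mu j - mu (j+1)) + (w j - w (j+1)) + 2) := by
  have key : ∀ (N : ℤ) (m : ℕ), (∑ i ∈ Finset.range (m+1), mu i * (mu i + N - 1 - 2 * i)) -
      (∑ i ∈ Finset.range (m+1), w i * (w i + N - 1 - 2 * i)) =
    (psum mu (m+1) - psum w (m+1)) * (mu m + w m + N - 1 - 2 * m) +
    ∑ j ∈ Finset.range m, (psum mu (j+1) - psum w (j+1)) *
      ((mu j - mu (j+1)) + (w j - w (j+1)) + 2) := by
    intro N m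
    induction m with
    | zero => simp [psum]; ring
    | succ m ih =>
      rw [Finset.sum_range_succ _ (m+1), Finset.sum_range_succ _ (m+1), add_sub_add_comm, ih,
        Finset.sum_range_succ _ m, psum_succ mu (m+1), psum_succ w (m+1)]
      push_cast; ring
  unfold cas
  rw [key]; push_cast; ring

lemma cas_eq {n : ℕ} {mu w : ℕ → ℤ} (hd : Dm n mu w) (hmu : ∀ p, p + 1 < n → mu (p+1) ≤ mu p)
    (hw : ∀ p, p + 1 < n → w (p+1) ≤ w p) (h : cas n mu = cas n w) :
    ∀ i, i < n → w i = mu i := by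
  cases n with
  | zero => intro i hi; omega
  | succ n =>
    have h1 := cas_abel n mu w
    rw [h, sub_self, hd.2, sub_self, zero_mul, zero_add] at h1
    have h2 := (Finset.sum_eq_zero_iff_of_nonneg (by
      intro j hj
      have hj := Finset.mem_range.1 hj
      have a1 := hd.1 (j+1) (by omega)
      have a2 := hmu j (by omega)
      have a3 := hw j (by omega)
      exact mul_nonneg (by omega) (by omega))).1 h1.symm
    apply eq_of_psum
    intro j hj
    rcases Nat.lt_or_ge j (n+1) with h3 | h3
    · cases j with
      | zero => simp [psum_zero]
      | succ j =>
        have h4 := h2 j (Finset.mem_range.2 (by omega))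
        have a2 := hmu j (by omega)
        have a3 := hw j (by omega)
        rcases mul_eq_zero.1 h4 with h5 | h5
        · omega
        · omega
    · have : j = n+1 := by omega
      subst this; exact hd.2

lemma nil_step {f g h : Module.End ℂ V} (hfg : ∀ x, f (g x) = g (f x) + h x)
    (hfh : ∀ x, f (h x) = h (f x)) (k : ℕ) : ∀ y, (f ^ k) y = 0 → (f ^ (k+1)) (g y) = 0 := by
  have hh : ∀ k y, (f^k) (h y) = h ((f^k) y) := by
    intro k
    induction k with
    | zero => simp
    | succ k ih => intro y; rw [pow_succ, Module.End.mul_apply, Module.End.mul_apply, hfh, ih]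
  induction k with
  | zero =>
    intro y hy
    simp at hy
    simp [hy]
  | succ k ih =>
    intro y hy
    rw [pow_succ, Module.End.mul_apply, hfg, map_add, hh, hy, ih]
    · simp
    · rw [← Module.End.mul_apply, ← pow_succ, hy]

lemma low_nil (hgl : IsGL n E) {x : V} {p : ℕ} (hp : p + 1 < n)
    (hx : ∃ k, (E (p+1) p ^ k) x = 0) : ∀ y ∈ Low n E x, ∃ k, (E (p+1) p ^ k) y = 0 := by
  let S : Submodule ℂ V :=
    { carrier := {y | ∃ k, (E (p+1) p ^ k) y = 0}
      add_mem' := by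
        rintro a b ⟨k, hk⟩ ⟨l, hl⟩
        refine ⟨k + l, ?_⟩
        rw [map_add, pow_zero_of_le hk (by omega), pow_zero_of_le hl (by omega), add_zero]
      zero_mem' := ⟨0, by simp⟩
      smul_mem' := by
        rintro c a ⟨k, hk⟩
        exact ⟨k, by rw [map_smul, hk, smul_zero]⟩ }
  have : Low n E x ≤ S := by
    apply Low.le hx
    rintro i j hji hi y - ⟨k, hk⟩
    refine ⟨k+1, ?_⟩
    by_cases h1 : p = i
    · subst h1
      refine nil_step (f := E (p+1) p) (g := E p j) (h := E (p+1) j) ?_ ?_ k y hk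
      · intro x
        rw [hgl (p+1) p p j (by omega) (by omega) (by omega) (by omega), if_pos rfl,
          if_neg (by omega), sub_zero]
      · intro x
        rw [hgl (p+1) p (p+1) j (by omega) (by omega) (by omega) (by omega), if_neg (by omega),
          if_neg (by omega)]; simp
    · by_cases h2 : j = p + 1
      · subst h2
        refine nil_step (f := E (p+1) p) (g := E i (p+1)) (h := - E i p) ?_ ?_ k y hk
        · intro x
          rw [hgl (p+1) p i (p+1) (by omega) (by omega) (by omega) (by omega), if_neg h1,
            if_pos rfl, LinearMap.neg_apply]; abel
        · intro x
          rw [LinearMap.neg_apply, map_neg,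
            hgl (p+1) p i p (by omega) (by omega) (by omega) (by omega), if_neg h1,
            if_neg (by omega)]; simp
      · refine nil_step (f := E (p+1) p) (g := E i j) (h := 0) ?_ ?_ k y hk
        · intro x
          rw [hgl (p+1) p i j (by omega) (by omega) (by omega) (by omega), if_neg h1,
            if_neg h2]; simp
        · intro x; simp
  exact fun y hy => this hy

/-- Lemma Q: uniqueness of singular vectors in an integrable highest weight module -/
lemma lemQ (hgl : IsGL n E) {x : V} {mu : ℕ → ℤ} (hs : Sing n E x) (hw : Wt n E mu x)
    (hf : ∀ p, p + 1 < n → ∃ m : ℕ, mu p - mu (p+1) = m ∧ (E (p+1) p ^ (m+1)) x = 0)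
    {y : V} {w : ℕ → ℤ} (hy : y ∈ Low n E x) (hy0 : y ≠ 0) (hys : Sing n E y)
    (hyw : Wt n E w y) : ∃ c : ℂ, y = c • x := by
  obtain ⟨w', h1, h2⟩ := WB.wt hy0 hyw (Low.le_WB hgl hw hy)
  have hd : Dm n mu w := h1.congr fun i hi => (h2 i hi).symm
  have hcas : Low n E x ≤ LinearMap.ker (Cas n E - (cas n mu : ℂ) • LinearMap.id) := by
    apply Low.le
    · simp [Cas_sing hgl hs hw]
    · intro i j hji hi z _ hz
      simp only [LinearMap.mem_ker, LinearMap.sub_apply, LinearMap.smul_apply,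
        LinearMap.id_apply, sub_eq_zero] at hz ⊢
      rw [← Cas_comm hgl hi (by omega), hz, map_smul]
  have h3 := hcas hy
  simp only [LinearMap.mem_ker, LinearMap.sub_apply, LinearMap.smul_apply,
        LinearMap.id_apply, sub_eq_zero] at h3
  rw [Cas_sing hgl hys hyw] at h3
  have h4 : cas n w = cas n mu := by exact_mod_cast smul_left_injective ℂ hy0 h3
  have h5 := cas_eq hd (fun p hp => by
    obtain ⟨m, hm, -⟩ := hf p hp
    omega) (fun p hp => by
    obtain ⟨m, hm, hm0⟩ := hf p hp
    obtain ⟨k, hk, -⟩ := sl2 hgl hyw hy0 (i := p) (j := p+1) (by omega) hp (by omega)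
      (hys p (p+1) (by omega) hp) (low_nil hgl hp ⟨_, hm0⟩ y hy)
    omega) h4.symm
  exact Low.top_wt hgl hw hy (hyw.congr h5)

lemma lemQ' (hgl : IsGL n E) {x : V} {mu : ℕ → ℤ} (hs : Sing n E x) (hw : Wt n E mu x)
    (hf : ∀ p, p + 1 < n → ∃ m : ℕ, mu p - mu (p+1) = m ∧ (E (p+1) p ^ (m+1)) x = 0)
    {K : Submodule ℂ V} (hK : K ≤ Low n E x)
    (hKs : ∀ i j, i ≤ j → j < n → ∀ y ∈ K, E i j y ∈ K) (hK0 : K ≠ ⊥) : x ∈ K := by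
  obtain ⟨y, hy, hy0⟩ := Submodule.exists_mem_ne_zero_of_ne_bot hK0
  obtain ⟨z, hz, w, hz0, hzs, hzw⟩ := exists_sing hgl (lam := mu) (K := K)
    (fun x hx => WB.mono (fun _ h => h.1) le_rfl (Low.le_WB hgl hw (hK hx))) hKs hy hy0
  obtain ⟨c, rfl⟩ := lemQ hgl hs hw hf (hK hz) hz0 hzs hzw
  have hc : c ≠ 0 := by rintro rfl; simp at hz0
  have := K.smul_mem c⁻¹ hz
  rwa [smul_smul, inv_mul_cancel₀ hc, one_smul] at this

lemma Sing.of_simple (hgl : IsGL n E) {x : V} (h : ∀ p, p + 1 < n → E p (p+1) x = 0) :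
    Sing n E x := by
  intro i j hij hj
  obtain ⟨d, rfl⟩ := Nat.exists_eq_add_of_lt hij
  clear hij
  induction d with
  | zero => exact h i hj
  | succ d ih =>
    have h1 := ih (by omega)
    have h2 := h (i+d+1) (by omega)
    have h3 := hgl i (i+d+1) (i+d+1) (i+d+2) (by omega) (by omega) (by omega) (by omega) x
    rw [h1, h2, if_pos rfl, if_neg (by omega)] at h3
    rw [show i + (d+1) + 1 = i+d+2 by omega]
    simpa using h3.symm

end C5

open scoped TensorProduct

section C6
variable {M : Type} [AddCommGroup M] [Module ℂ M]

/-- Abstract parabolic construction: operators `X`, `D`, `G`. -/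
structure XDG (N : ℕ) (X D : ℕ → M →ₗ[ℂ] M) (G : ℕ → ℕ → M →ₗ[ℂ] M) : Prop where
  xx : ∀ i j x, X i (X j x) = X j (X i x)
  dd : ∀ i j x, D i (D j x) = D j (D i x)
  dx : ∀ i j x, D i (X j x) = X j (D i x) + if i = j then x else 0
  gx : ∀ i j k, i < N → j < N → ∀ x, G i j (X k x) = X k (G i j x)
  gd : ∀ i j k, i < N → j < N → ∀ x, G i j (D k x) = D k (G i j x)
  gg : IsGL N G

variable {N : ℕ} {X D : ℕ → M →ₗ[ℂ] M} {G : ℕ → ℕ → M →ₗ[ℂ] M} (c : ℂ)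

def opA (X D : ℕ → M →ₗ[ℂ] M) (G : ℕ → ℕ → M →ₗ[ℂ] M) (i j : ℕ) : M →ₗ[ℂ] M :=
  G i j - X j ∘ₗ D i

def opZ (N : ℕ) (c : ℂ) (X D : ℕ → M →ₗ[ℂ] M) : M →ₗ[ℂ] M :=
  c • LinearMap.id + ∑ k ∈ Finset.range N, X k ∘ₗ D k

def opY (N : ℕ) (c : ℂ) (X D : ℕ → M →ₗ[ℂ] M) (G : ℕ → ℕ → M →ₗ[ℂ] M) (i : ℕ) : M →ₗ[ℂ] M :=
  (∑ k ∈ Finset.range N, opA X D G i k ∘ₗ D k) - c • D i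

def opE (N : ℕ) (c : ℂ) (X D : ℕ → M →ₗ[ℂ] M) (G : ℕ → ℕ → M →ₗ[ℂ] M) (i j : ℕ) : M →ₗ[ℂ] M :=
  if i = N then (if j = N then opZ N c X D else X j)
  else (if j = N then opY N c X D G i else opA X D G i j)

lemma opA_apply (i j : ℕ) (x : M) : opA X D G i j x = G i j x - X j (D i x) := rfl

lemma opZ_apply (x : M) : opZ N c X D x = c • x + ∑ k ∈ Finset.range N, X k (D k x) := by
  simp [opZ, LinearMap.sum_apply]

lemma opY_apply (i : ℕ) (x : M) :
    opY N c X D G i x = (∑ k ∈ Finset.range N, opA X D G i k (D k x)) - c • D i x := by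
  simp [opY, LinearMap.sum_apply]

lemma XDG.ax (h : XDG N X D G) {i j k : ℕ} (hi : i < N) (hj : j < N) (x : M) :
    opA X D G i j (X k x) = X k (opA X D G i j x) - if i = k then X j x else 0 := by
  simp only [opA_apply, h.gx i j k hi hj, h.dx, map_sub, map_add, h.xx j k]
  split_ifs <;> (try simp only [map_zero]) <;> abel

lemma XDG.ad (h : XDG N X D G) {i j k : ℕ} (hi : i < N) (hj : j < N) (x : M) :
    opA X D G i j (D k x) = D k (opA X D G i j x) + if j = k then D i x else 0 := by
  simp only [opA_apply, h.gd i j k hi hj, h.dx, map_sub, h.dd i k]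
  by_cases hjk : j = k
  · simp [hjk]; abel
  · simp [hjk, Ne.symm hjk]

lemma XDG.aa (h : XDG N X D G) {i j k l : ℕ} (hi : i < N) (hj : j < N) (hk : k < N) (hl : l < N) (x : M) :
    opA X D G i j (opA X D G k l x) = opA X D G k l (opA X D G i j x) +
      (if j = k then opA X D G i l x else 0) - (if l = i then opA X D G k j x else 0) := by
  have h1 : opA X D G i j (opA X D G k l x) = opA X D G i j (G k l x) -
      opA X D G i j (X l (D k x)) := by rw [opA_apply k l, map_sub]
  rw [h1, h.ax hi hj, h.ad hi hj, map_add]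
  have h2 : opA X D G i j (G k l x) = G k l (opA X D G i j x) +
      (if j = k then G i l x else 0) - (if l = i then G k j x else 0) := by
    rw [opA_apply, opA_apply, h.gg i j k l hi hj hk hl, map_sub, h.gx k l _ hk hl,
      h.gd k l _ hk hl]
    abel
  rw [h2, opA_apply k l (opA X D G i j x)]
  by_cases hjk : j = k
  · subst hjk
    by_cases hli : l = i
    · subst hli; simp [opA_apply]; abel
    · simp [hli, Ne.symm hli, opA_apply]; abel
  · by_cases hli : l = i
    · subst hli; simp [hjk, opA_apply]; abel
    · simp [hjk, hli, Ne.symm hli]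

lemma XDG.az (h : XDG N X D G) {i j : ℕ} (hi : i < N) (hj : j < N) (x : M) :
    opA X D G i j (opZ N c X D x) = opZ N c X D (opA X D G i j x) := by
  rw [opZ_apply, opZ_apply, map_add, map_smul, map_sum]
  congr 1
  have h1 : ∀ k ∈ Finset.range N, opA X D G i j (X k (D k x)) =
      X k (D k (opA X D G i j x)) + (if j = k then X j (D i x) else 0) -
        (if i = k then X j (D i x) else 0) := by
    intro k hk
    rw [h.ax hi hj, h.ad hi hj, map_add]
    congr 1
    · congr 1
      split_ifs with e
      · rw [e]
      · simp
    · split_ifs with e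
      · rw [e]
      · rfl
  rw [Finset.sum_congr rfl h1]
  simp [Finset.sum_sub_distrib, Finset.sum_add_distrib, hi, hj]

lemma XDG.ay (h : XDG N X D G) {i j k : ℕ} (hi : i < N) (hj : j < N) (hk : k < N) (x : M) :
    opA X D G i j (opY N c X D G k x) = opY N c X D G k (opA X D G i j x) +
      if j = k then opY N c X D G i x else 0 := by
  simp only [opY_apply]
  rw [map_sub, map_smul, map_sum, h.ad hi hj]
  have h1 : ∀ l ∈ Finset.range N, opA X D G i j (opA X D G k l (D l x)) =
      opA X D G k l (D l (opA X D G i j x)) + (if j = l then opA X D G k j (D i x) else 0)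
      + (if j = k then opA X D G i l (D l x) else 0) -
        (if i = l then opA X D G k j (D i x) else 0) := by
    intro l hl
    have hl := Finset.mem_range.1 hl
    rw [h.aa hi hj hk hl, h.ad hi hj, map_add]
    congr 1
    · congr 1
      congr 1
      split_ifs with e
      · rw [e]
      · simp
    · by_cases e : i = l
      · simp [e]
      · simp [e, Ne.symm e]
  rw [Finset.sum_congr rfl h1]
  simp only [Finset.sum_sub_distrib, Finset.sum_add_distrib, Finset.sum_ite_eq, Finset.mem_range,
    hi, hj, if_true]
  split_ifs <;> simp [smul_add] <;> abel

lemma XDG.yx (h : XDG N X D G) {i j : ℕ} (hi : i < N) (hj : j < N) (x : M) :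
    opY N c X D G i (X j x) = X j (opY N c X D G i x) + opA X D G i j x
      - if i = j then opZ N c X D x else 0 := by
  simp only [opY_apply]
  rw [h.dx, map_sub, map_smul, map_sum]
  have h1 : ∀ k ∈ Finset.range N, opA X D G i k (D k (X j x)) =
      X j (opA X D G i k (D k x)) + (if k = j then opA X D G i j x else 0) -
        (if i = j then X k (D k x) else 0) := by
    intro k hk
    have hk := Finset.mem_range.1 hk
    rw [h.dx, map_add, h.ax hi hk]
    have e : opA X D G i k (if k = j then x else 0) = if k = j then opA X D G i j x else 0 := by
      split_ifs with e
      · rw [e]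
      · simp
    rw [e]; abel
  rw [Finset.sum_congr rfl h1, opZ_apply]
  have e5 : ∀ (p : Prop) [Decidable p] (f : ℕ → M),
      (∑ a ∈ Finset.range N, if p then f a else 0) = if p then ∑ a ∈ Finset.range N, f a else 0 := by
        intro p _ f; split_ifs <;> simp
  simp only [Finset.sum_sub_distrib, Finset.sum_add_distrib, Finset.sum_ite_eq', Finset.mem_range,
    hj, if_true]
  rw [e5]
  split_ifs <;> simp only [smul_add, smul_zero] <;> abel

lemma XDG.zx (h : XDG N X D G) {j : ℕ} (hj : j < N) (x : M) :
    opZ N c X D (X j x) = X j (opZ N c X D x) + X j x := by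
  simp only [opZ_apply]
  rw [map_add, map_smul, map_sum]
  have h1 : ∀ k ∈ Finset.range N, X k (D k (X j x)) =
      X j (X k (D k x)) + (if k = j then X j x else 0) := by
    intro k _
    rw [h.dx, map_add, h.xx k j]
    split_ifs with e
    · rw [e]
    · simp
  rw [Finset.sum_congr rfl h1]
  simp [Finset.sum_add_distrib, hj]; abel

lemma XDG.zd (h : XDG N X D G) {j : ℕ} (hj : j < N) (x : M) :
    opZ N c X D (D j x) = D j (opZ N c X D x) - D j x := by
  simp only [opZ_apply]
  rw [map_add, map_smul, map_sum]
  have h1 : ∀ k ∈ Finset.range N, X k (D k (D j x)) =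
      D j (X k (D k x)) - (if k = j then D j x else 0) := by
    intro k _
    rw [h.dx, h.dd k j]
    by_cases e : j = k
    · simp [e]
    · simp [e, Ne.symm e]
  rw [Finset.sum_congr rfl h1]
  simp [Finset.sum_sub_distrib, hj]; abel

lemma XDG.zy (h : XDG N X D G) {i : ℕ} (hi : i < N) (x : M) :
    opZ N c X D (opY N c X D G i x) = opY N c X D G i (opZ N c X D x) - opY N c X D G i x := by
  simp only [opY_apply (c := c) i]
  rw [map_sub, map_smul, map_sum, h.zd c hi]
  have h1 : ∀ k ∈ Finset.range N, opZ N c X D (opA X D G i k (D k x)) =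
      opA X D G i k (D k (opZ N c X D x)) - opA X D G i k (D k x) := by
    intro k hk
    have hk := Finset.mem_range.1 hk
    rw [← h.az c hi hk, h.zd c hk, map_sub]
  rw [Finset.sum_congr rfl h1, Finset.sum_sub_distrib, smul_sub]
  abel

lemma XDG.yd (h : XDG N X D G) {i k : ℕ} (hi : i < N) (hk : k < N) (x : M) :
    opY N c X D G i (D k x) = D k (opY N c X D G i x) + D i (D k x) := by
  simp only [opY_apply (c := c) i]
  rw [map_sub, map_smul, map_sum]
  have h1 : ∀ l ∈ Finset.range N, opA X D G i l (D l (D k x)) =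
      D k (opA X D G i l (D l x)) + (if l = k then D i (D k x) else 0) := by
    intro l hl
    have hl := Finset.mem_range.1 hl
    rw [h.dd l k, h.ad hi hl]
    split_ifs with e
    · rw [e]
    · rfl
  rw [Finset.sum_congr rfl h1, Finset.sum_add_distrib, h.dd i k]
  simp [hk]; abel

lemma XDG.yy (h : XDG N X D G) {i j : ℕ} (hi : i < N) (hj : j < N) (x : M) :
    opY N c X D G i (opY N c X D G j x) = opY N c X D G j (opY N c X D G i x) := by
  rw [opY_apply (c := c) j x, map_sub, map_smul, map_sum, h.yd c hi hj]
  have h1 : ∀ k ∈ Finset.range N, opY N c X D G i (opA X D G j k (D k x)) =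
      opA X D G j k (D k (opY N c X D G i x)) + opA X D G j k (D k (D i x))
       - (if k = i then opY N c X D G j (D i x) else 0) := by
    intro k hk
    have hk := Finset.mem_range.1 hk
    have h2 := h.ay c hj hk hi (D k x)
    rw [h.yd c hi hk, map_add, h.dd i k] at h2
    rw [h2]
    split_ifs with e
    · rw [e]; abel
    · abel
  rw [Finset.sum_congr rfl h1]
  simp only [Finset.sum_sub_distrib, Finset.sum_add_distrib, Finset.sum_ite_eq', Finset.mem_range,
    hi, if_true]
  rw [opY_apply (c := c) j (D i x), opY_apply (c := c) j (opY N c X D G i x), smul_add, h.dd i j]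
  abel

lemma opE_a {i j : ℕ} (hi : i < N) (hj : j < N) : opE N c X D G i j = opA X D G i j := by
  simp [opE, hi.ne, hj.ne]

lemma opE_y {i : ℕ} (hi : i < N) : opE N c X D G i N = opY N c X D G i := by
  simp [opE, hi.ne]

lemma opE_x {j : ℕ} (hj : j < N) : opE N c X D G N j = X j := by
  simp [opE, hj.ne]

lemma opE_z : opE N c X D G N N = opZ N c X D := by
  simp [opE]

lemma XDG.gl (h : XDG N X D G) : IsGL (N+1) (opE N c X D G) := by
  intro i j k l hi hj hk hl x
  have key : ∀ k, k < N+1 → k < N ∨ k = N := fun k hk => by omega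
  rcases key i hi with hi | rfl <;> rcases key j hj with hj | hj <;> rcases key k hk with hk | hk <;>
    rcases key l hl with hl | hl
  · rw [opE_a c hi hj, opE_a c hk hl, opE_a c hi hl, opE_a c hk hj, h.aa hi hj hk hl]
  · subst hl
    rw [opE_a c hi hj, opE_y c hk, opE_y c hi, h.ay c hi hj hk, if_neg (by omega : ¬ l = i), sub_zero]
  · subst hk
    rw [opE_a c hi hj, opE_x c hl, opE_x c hj, h.ax hi hj, if_neg (by omega : ¬ j = k), add_zero]
    simp only [eq_comm (a := l)]
  · subst hk; subst hl
    rw [opE_a c hi hj, opE_z, h.az c hi hj, if_neg (by omega), if_neg (by omega)]; simp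
  · subst hj
    rw [opE_a c hk hl, opE_y c hi, opE_y c hk, if_neg (by omega : ¬ j = k), h.ay c hk hl hi]
    abel
  · subst hj; subst hl
    rw [opE_y c hi, opE_y c hk, h.yy c hi hk, if_neg (by omega), if_neg (by omega)]; simp
  · subst hj; subst hk
    rw [opE_y c hi, opE_x c hl, opE_a c hi hl, opE_z, h.yx c hi hl, if_pos rfl]
    simp only [eq_comm (a := l)]
  · subst hj; subst hk; subst hl
    rw [opE_y c hi, opE_z, h.zy c hi, if_pos rfl, if_neg (by omega)]; abel
  · rw [opE_x c hj, opE_a c hk hl, opE_x c hl, if_neg (by omega : ¬ l = i), sub_zero, h.ax hk hl]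
    simp only [eq_comm (a := j)]
    abel
  · subst hl
    rw [opE_x c hj, opE_y c hk, opE_z, opE_a c hk hj, h.yx c hk hj, if_pos rfl]
    simp only [eq_comm (a := j)]
    abel
  · subst hk
    rw [opE_x c hj, opE_x c hl, h.xx, if_neg (by omega), if_neg (by omega)]; simp
  · subst hk; subst hl
    rw [opE_x c hj, opE_z, h.zx c hj, if_pos rfl, if_neg (by omega)]; abel
  · subst hj
    rw [opE_z, opE_a c hk hl, h.az c hk hl, if_neg (by omega), if_neg (by omega)]; simp
  · subst hj; subst hl
    rw [opE_z, opE_y c hk, h.zy c hk, if_pos rfl, if_neg (by omega)]; abel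
  · subst hj; subst hk
    rw [opE_z, opE_x c hl, h.zx c hl, if_pos rfl, if_neg (by omega)]; abel
  · subst hj; subst hk; subst hl
    simp

end C6

open scoped TensorProduct

section C7
variable {V W : Type} [AddCommGroup V] [Module ℂ V] [AddCommGroup W] [Module ℂ W]

/-- relations of the strictly lower triangular matrices -/
def NM (n : ℕ) (L : ℕ → ℕ → V →ₗ[ℂ] V) : Prop :=
  ∀ i j k l, j < i → i < n → l < k → k < n → ∀ x, L i j (L k l x) =
    L k l (L i j x) + (if j = k then L i l x else 0) - (if l = i then L k j x else 0)

lemma IsGL.nm {n : ℕ} {L : ℕ → ℕ → V →ₗ[ℂ] V} (h : IsGL n L) : NM n L :=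
  fun i j k l hji hi hlk hk x => h i j k l hi (by omega) hk (by omega) x

lemma NM.mono {n m : ℕ} {L : ℕ → ℕ → V →ₗ[ℂ] V} (h : NM n L) (hm : m ≤ n) : NM m L :=
  fun i j k l hji hi hlk hk x => h i j k l hji (by omega) hlk (by omega) x

lemma exists_rho (N : ℕ) (L : ℕ → Module.End ℂ V)
    (hL : ∀ i j, i < N → j < N → L i * L j = L j * L i) :
    ∃ ρ : MvPolynomial ℕ ℂ →ₐ[ℂ] Module.End ℂ V,
      (∀ j, j < N → ρ (MvPolynomial.X j) = L j) ∧ ∀ j, ¬ j < N → ρ (MvPolynomial.X j) = 0 := by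
  let L' : ℕ → Module.End ℂ V := fun j => if j < N then L j else 0
  have hc : ∀ a ∈ Set.range L', ∀ b ∈ Set.range L', a * b = b * a := by
    rintro _ ⟨i, rfl⟩ _ ⟨j, rfl⟩
    simp only [L']
    by_cases h1 : i < N <;> by_cases h2 : j < N
    · simpa [h1, h2] using hL i j h1 h2
    all_goals simp [h1, h2]
  letI : CommRing (Algebra.adjoin ℂ (Set.range L')) := Algebra.adjoinCommRingOfComm ℂ hc
  let f : MvPolynomial ℕ ℂ →ₐ[ℂ] Algebra.adjoin ℂ (Set.range L') :=
    MvPolynomial.aeval fun j => ⟨L' j, Algebra.subset_adjoin ⟨j, rfl⟩⟩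
  refine ⟨(Algebra.adjoin ℂ (Set.range L')).val.comp f, ?_, ?_⟩
  · intro j hj
    simp [f, L', hj]
  · intro j hj
    simp [f, L', hj]

noncomputable def pX (W : Type) [AddCommGroup W] [Module ℂ W] (j : ℕ) :
    (MvPolynomial ℕ ℂ ⊗[ℂ] W) →ₗ[ℂ] (MvPolynomial ℕ ℂ ⊗[ℂ] W) :=
  TensorProduct.map (LinearMap.mulLeft ℂ (MvPolynomial.X j)) LinearMap.id

noncomputable def pD (W : Type) [AddCommGroup W] [Module ℂ W] (j : ℕ) :
    (MvPolynomial ℕ ℂ ⊗[ℂ] W) →ₗ[ℂ] (MvPolynomial ℕ ℂ ⊗[ℂ] W) :=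
  TensorProduct.map (MvPolynomial.pderiv (R := ℂ) j).toLinearMap LinearMap.id

noncomputable def pG (F : ℕ → ℕ → W →ₗ[ℂ] W) (i j : ℕ) :
    (MvPolynomial ℕ ℂ ⊗[ℂ] W) →ₗ[ℂ] (MvPolynomial ℕ ℂ ⊗[ℂ] W) :=
  TensorProduct.map LinearMap.id (F i j)

lemma pX_tmul (j : ℕ) (p : MvPolynomial ℕ ℂ) (w : W) :
    pX W j (p ⊗ₜ w) = (MvPolynomial.X j * p) ⊗ₜ w := by simp [pX]

lemma pD_tmul (j : ℕ) (p : MvPolynomial ℕ ℂ) (w : W) :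
    pD W j (p ⊗ₜ w) = (MvPolynomial.pderiv j p) ⊗ₜ w := by simp [pD]

lemma pG_tmul (F : ℕ → ℕ → W →ₗ[ℂ] W) (i j : ℕ) (p : MvPolynomial ℕ ℂ) (w : W) :
    pG F i j (p ⊗ₜ w) = p ⊗ₜ F i j w := by simp [pG]

lemma pderiv_X_mul (i j : ℕ) (p : MvPolynomial ℕ ℂ) :
    MvPolynomial.pderiv i (MvPolynomial.X j * p) = MvPolynomial.X j * MvPolynomial.pderiv i p +
      if i = j then p else 0 := by
  rw [Derivation.leibniz]
  by_cases h : i = j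
  · subst h; simp
  · simp [h, MvPolynomial.pderiv_X_of_ne (Ne.symm h)]

lemma pderiv_comm (i j : ℕ) (p : MvPolynomial ℕ ℂ) :
    MvPolynomial.pderiv i (MvPolynomial.pderiv j p) =
    MvPolynomial.pderiv j (MvPolynomial.pderiv i p) := by
  induction p using MvPolynomial.induction_on with
  | C a => simp
  | add p q hp hq => simp [hp, hq]
  | mul_X p k hp =>
    rw [mul_comm p, pderiv_X_mul, pderiv_X_mul, map_add, map_add, pderiv_X_mul, pderiv_X_mul, hp]
    by_cases h1 : i = k <;> by_cases h2 : j = k <;> simp [h1, h2]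

lemma p_XDG {N : ℕ} {F : ℕ → ℕ → W →ₗ[ℂ] W} (hF : IsGL N F) : XDG N (pX W) (pD W) (pG F) where
  xx i j z := by
    induction z using TensorProduct.induction_on with
    | zero => simp
    | add x y hx hy => simp only [map_add, hx, hy]
    | tmul p w => simp only [pX_tmul]; congr 1; ring
  dd i j z := by
    induction z using TensorProduct.induction_on with
    | zero => simp
    | add x y hx hy => simp only [map_add, hx, hy]
    | tmul p w => simp only [pD_tmul, pderiv_comm]
  dx i j z := by
    induction z using TensorProduct.induction_on with
    | zero => simp
    | add x y hx hy => simp only [map_add, hx, hy]; split_ifs <;> abel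
    | tmul p w =>
      simp only [pD_tmul, pX_tmul, pderiv_X_mul, TensorProduct.add_tmul]
      split_ifs <;> simp
  gx i j k _ _ z := by
    induction z using TensorProduct.induction_on with
    | zero => simp
    | add x y hx hy => simp only [map_add, hx, hy]
    | tmul p w => simp only [pX_tmul, pG_tmul]
  gd i j k _ _ z := by
    induction z using TensorProduct.induction_on with
    | zero => simp
    | add x y hx hy => simp only [map_add, hx, hy]
    | tmul p w => simp only [pD_tmul, pG_tmul]
  gg i j k l hi hj hk hl z := by
    induction z using TensorProduct.induction_on with
    | zero => simp
    | add x y hx hy => simp only [map_add, hx, hy]; split_ifs <;> abel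
    | tmul p w =>
      simp only [pG_tmul, hF i j k l hi hj hk hl w, TensorProduct.tmul_add, TensorProduct.tmul_sub]
      split_ifs <;> simp

/-- commutator of `L i j` with `ρ p` -/
lemma rho_comm {N : ℕ} {L : ℕ → ℕ → V →ₗ[ℂ] V} (hL : NM (N+1) L)
    {ρ : MvPolynomial ℕ ℂ →ₐ[ℂ] Module.End ℂ V}
    (h1 : ∀ j, j < N → ρ (MvPolynomial.X j) = L N j) (h2 : ∀ j, ¬ j < N → ρ (MvPolynomial.X j) = 0)
    {i j : ℕ} (hji : j < i) (hi : i < N) (p : MvPolynomial ℕ ℂ) : ∀ x : V,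
    L i j (ρ p x) = ρ p (L i j x) - ρ (MvPolynomial.X j * MvPolynomial.pderiv i p) x := by
  induction p using MvPolynomial.induction_on with
  | C a =>
    intro x
    rw [← MvPolynomial.algebraMap_eq, AlgHom.commutes]
    simp [Module.algebraMap_end_apply, MvPolynomial.algebraMap_eq]
  | add p q hp hq =>
    intro x
    simp only [map_add, LinearMap.add_apply, hp, hq, mul_add]; abel
  | mul_X p k hp =>
    intro x
    rw [mul_comm p, pderiv_X_mul, mul_add, map_mul, map_add, Module.End.mul_apply,
      Module.End.mul_apply, LinearMap.add_apply, mul_left_comm (MvPolynomial.X j),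
      map_mul ρ (MvPolynomial.X k), Module.End.mul_apply]
    by_cases hk : k < N
    · rw [h1 k hk, hL i j N k hji (by omega) hk (by omega), hp, map_sub, if_neg (by omega)]
      by_cases hki : i = k
      · subst hki
        rw [if_pos rfl, if_pos rfl, map_mul ρ (MvPolynomial.X j) p, Module.End.mul_apply,
          h1 j (by omega)]; abel
      · rw [if_neg hki, if_neg (Ne.symm hki)]; simp
    · rw [h2 k hk, if_neg (by omega)]; simp

noncomputable def mkPsi (ρ : MvPolynomial ℕ ℂ →ₐ[ℂ] Module.End ℂ V) (Φ : W →ₗ[ℂ] V) :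
    (MvPolynomial ℕ ℂ ⊗[ℂ] W) →ₗ[ℂ] V :=
  TensorProduct.lift ((LinearMap.lcomp ℂ V Φ) ∘ₗ ρ.toLinearMap)

lemma mkPsi_tmul (ρ : MvPolynomial ℕ ℂ →ₐ[ℂ] Module.End ℂ V) (Φ : W →ₗ[ℂ] V)
    (p : MvPolynomial ℕ ℂ) (w : W) : mkPsi ρ Φ (p ⊗ₜ w) = ρ p (Φ w) := by
  simp [mkPsi]

/-- equivariant extension of `Φ` -/
lemma exists_Psi {N : ℕ} {F : ℕ → ℕ → W →ₗ[ℂ] W} {L : ℕ → ℕ → V →ₗ[ℂ] V} (hL : NM (N+1) L)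
    (c : ℂ) {ξ : W} (Φ : W →ₗ[ℂ] V)
    (hΦ : ∀ i j, j < i → i < N → ∀ w ∈ Low N F ξ, Φ (F i j w) = L i j (Φ w)) :
    ∃ Ψ : (MvPolynomial ℕ ℂ ⊗[ℂ] W) →ₗ[ℂ] V, Ψ (1 ⊗ₜ ξ) = Φ ξ ∧
      ∀ i j, j < i → i < N+1 → ∀ z ∈ Low (N+1) (opE N c (pX W) (pD W) (pG F)) (1 ⊗ₜ ξ),
        Ψ (opE N c (pX W) (pD W) (pG F) i j z) = L i j (Ψ z) := by
  obtain ⟨ρ, h1, h2⟩ := exists_rho N (fun j => L N j) (by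
    intro i j hi hj
    ext x
    simp only [Module.End.mul_apply]
    rw [hL N i N j hi (by omega) hj (by omega), if_neg (by omega), if_neg (by omega)]; simp)
  let M0 : Submodule ℂ (MvPolynomial ℕ ℂ ⊗[ℂ] W) :=
    Submodule.span ℂ {z | ∃ p, ∃ w ∈ Low N F ξ, z = p ⊗ₜ w}
  have hX : ∀ j, j < N → ∀ z, mkPsi ρ Φ (pX W j z) = L N j (mkPsi ρ Φ z) := by
    intro j hj z
    induction z using TensorProduct.induction_on with
    | zero => simp
    | add x y hx hy => simp only [map_add, hx, hy]
    | tmul p w => rw [pX_tmul, mkPsi_tmul, mkPsi_tmul, map_mul, Module.End.mul_apply, h1 j hj]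
  have hA : ∀ i j, j < i → i < N → ∀ z ∈ M0, mkPsi ρ Φ (opA (pX W) (pD W) (pG F) i j z) =
      L i j (mkPsi ρ Φ z) := by
    intro i j hji hi z hz
    induction hz using Submodule.span_induction with
    | zero => simp
    | add x y _ _ hx hy => simp only [map_add, hx, hy]
    | smul a x _ hx => simp only [map_smul, hx]
    | mem x hx =>
      obtain ⟨p, w, hw, rfl⟩ := hx
      rw [opA_apply, pG_tmul, pD_tmul, pX_tmul, map_sub, mkPsi_tmul, mkPsi_tmul, mkPsi_tmul,
        hΦ i j hji hi w hw, rho_comm hL h1 h2 hji hi]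
  have hXm : ∀ j, ∀ z ∈ M0, pX W j z ∈ M0 := by
    intro j z hz
    induction hz using Submodule.span_induction with
    | zero => simp
    | add x y _ _ hx hy => rw [map_add]; exact add_mem hx hy
    | smul a x _ hx => rw [map_smul]; exact Submodule.smul_mem _ _ hx
    | mem x hx =>
      obtain ⟨p, w, hw, rfl⟩ := hx
      rw [pX_tmul]
      exact Submodule.subset_span ⟨_, w, hw, rfl⟩
  have hAm : ∀ i j, j < i → i < N → ∀ z ∈ M0, opA (pX W) (pD W) (pG F) i j z ∈ M0 := by
    intro i j hji hi z hz
    induction hz using Submodule.span_induction with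
    | zero => simp
    | add x y _ _ hx hy => rw [map_add]; exact add_mem hx hy
    | smul a x _ hx => rw [map_smul]; exact Submodule.smul_mem _ _ hx
    | mem x hx =>
      obtain ⟨p, w, hw, rfl⟩ := hx
      rw [opA_apply, pG_tmul, pD_tmul, pX_tmul]
      exact sub_mem (Submodule.subset_span ⟨_, _, Low.step hji hi hw, rfl⟩)
        (Submodule.subset_span ⟨_, w, hw, rfl⟩)
  have hM : Low (N+1) (opE N c (pX W) (pD W) (pG F)) (1 ⊗ₜ ξ) ≤ M0 := by
    refine Low.le (U := M0) ?_ ?_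
    · exact Submodule.subset_span ⟨1, ξ, Low.self, rfl⟩
    intro i j hji hi z _ hz
    by_cases h : i = N
    · subst h; rw [opE_x c hji]; exact hXm j z hz
    · rw [opE_a c (by omega) (by omega)]; exact hAm i j hji (by omega) z hz
  refine ⟨mkPsi ρ Φ, by simp [mkPsi_tmul], ?_⟩
  intro i j hji hi z hz
  by_cases h : i = N
  · subst h; rw [opE_x c hji]; exact hX j hji z
  · rw [opE_a c (by omega) (by omega)]; exact hA i j hji (by omega) z (hM hz)

/-- lower equivariance implies full equivariance -/
lemma equiv_all {M : Type} [AddCommGroup M] [Module ℂ M] {n : ℕ} {E : ℕ → ℕ → M →ₗ[ℂ] M}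
    {F : ℕ → ℕ → W →ₗ[ℂ] W} (hE : IsGL n E) (hF : IsGL n F) {x : M} {mu : ℕ → ℤ}
    (hs : Sing n E x) (hw : Wt n E mu x) (f : M →ₗ[ℂ] W) (hs' : Sing n F (f x))
    (hw' : Wt n F mu (f x))
    (hl : ∀ i j, j < i → i < n → ∀ z ∈ Low n E x, f (E i j z) = F i j (f z)) :
    ∀ i j, i < n → j < n → ∀ z ∈ Low n E x, f (E i j z) = F i j (f z) := by
  have key : Low n E x ≤
      ({ carrier := {y | ∀ i j, i ≤ j → j < n → f (E i j y) = F i j (f y)}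
         add_mem' := fun {a b} ha hb i j h1 h2 => by
          simp only [map_add, ha i j h1 h2, hb i j h1 h2]
         zero_mem' := fun i j h1 h2 => by simp
         smul_mem' := fun c a ha i j h1 h2 => by
          simp only [map_smul, ha i j h1 h2] } : Submodule ℂ M) := by
    apply Low.le
    · intro i j hij hj
      rcases hij.lt_or_eq with h | h
      · rw [hs i j h hj, hs' i j h hj, map_zero]
      · subst h; rw [hw i hj, hw' i hj, map_smul]
    · intro k l hlk hk y hy hy' i j hij hj
      have hyy : ∀ a b, a < n → b < n → f (E a b y) = F a b (f y) := by
        intro a b ha hb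
        rcases le_or_gt a b with h | h
        · exact hy' a b h hb
        · exact hl a b h ha y hy
      rw [hE i j k l (by omega) hj hk (by omega), hl k l hlk hk y hy,
        hF i j k l (by omega) hj hk (by omega), map_sub, map_add,
        hl k l hlk hk _ (Low.stb hE hs hw i j (by omega) hj y hy), hy' i j hij hj]
      congr 1
      · congr 1
        split_ifs
        · exact hyy _ _ (by omega) (by omega)
        · simp
      · split_ifs
        · exact hyy _ _ (by omega) (by omega)
        · simp
  intro i j hi hj z hz
  rcases le_or_gt i j with h | h
  · exact key hz i j h hj
  · exact hl i j h hi z hz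

lemma exists_factor {A B C : Type} [AddCommGroup A] [Module ℂ A] [AddCommGroup B] [Module ℂ B]
    [AddCommGroup C] [Module ℂ C] (f : A →ₗ[ℂ] B) (g : A →ₗ[ℂ] C) (S : Submodule ℂ A)
    (h : ∀ x ∈ S, f x = 0 → g x = 0) : ∃ Φ : B →ₗ[ℂ] C, ∀ x ∈ S, Φ (f x) = g x := by
  let f' := f ∘ₗ S.subtype
  let g' := g ∘ₗ S.subtype
  have hk : LinearMap.ker f' ≤ LinearMap.ker g' := by
    intro x hx
    exact h x x.2 hx
  let φ : LinearMap.range f' →ₗ[ℂ] C :=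
    ((LinearMap.ker f').liftQ g' hk) ∘ₗ f'.quotKerEquivRange.symm.toLinearMap
  obtain ⟨Φ, hΦ⟩ := φ.exists_extend
  refine ⟨Φ, fun x hx => ?_⟩
  have h1 : Φ (f x) = φ ⟨f' ⟨x, hx⟩, LinearMap.mem_range_self _ _⟩ := by
    rw [← hΦ]; rfl
  rw [h1]
  simp only [φ, LinearMap.comp_apply, LinearEquiv.coe_coe]
  have h2 : f'.quotKerEquivRange.symm ⟨f' ⟨x, hx⟩, LinearMap.mem_range_self _ _⟩ =
      Submodule.Quotient.mk ⟨x, hx⟩ := by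
    rw [LinearEquiv.symm_apply_eq]; rfl
  rw [h2]
  rfl

end C7

open scoped TensorProduct

section C7b
variable {V W M : Type} [AddCommGroup V] [Module ℂ V] [AddCommGroup W] [Module ℂ W]
  [AddCommGroup M] [Module ℂ M]

lemma quot_ker {n : ℕ} {E : ℕ → ℕ → M →ₗ[ℂ] M} {F : ℕ → ℕ → W →ₗ[ℂ] W} (hE : IsGL n E) {x : M}
    {mu : ℕ → ℤ} (hs : Sing n E x) (hw : Wt n E mu x) {Θ : Submodule ℂ M} (hΘ : Stb n E Θ)
    (hf : ∀ p, p + 1 < n → ∃ m : ℕ, mu p - mu (p+1) = m ∧ (E (p+1) p ^ (m+1)) x ∈ Θ)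
    (π : M →ₗ[ℂ] W) (hπ : ∀ i j, i < n → j < n → ∀ z ∈ Low n E x, π (E i j z) = F i j (π z))
    (hπΘ : ∀ z ∈ Θ, π z = 0) (hx : π x ≠ 0) {z : M} (hz : z ∈ Low n E x) (hz0 : π z = 0) :
    z ∈ Θ := by
  classical
  let Eb : ℕ → ℕ → (M ⧸ Θ) →ₗ[ℂ] (M ⧸ Θ) := fun i j =>
    if h : Θ ≤ Θ.comap (E i j) then Θ.mapQ Θ (E i j) h else 0
  have hEb : ∀ i j, i < n → j < n → ∀ y, Eb i j (Θ.mkQ y) = Θ.mkQ (E i j y) := by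
    intro i j hi hj y
    have h : Θ ≤ Θ.comap (E i j) := fun y hy => hΘ i j hi hj y hy
    simp only [Eb, dif_pos h]
    rfl
  have hpow : ∀ i j, i < n → j < n → ∀ k y, (Eb i j ^ k) (Θ.mkQ y) = Θ.mkQ ((E i j ^ k) y) := by
    intro i j hi hj k y
    induction k with
    | zero => rfl
    | succ k ih => rw [pow_succ', pow_succ', Module.End.mul_apply, Module.End.mul_apply, ih,
        hEb i j hi hj]
  have hgl : IsGL n Eb := by
    intro i j k l hi hj hk hl y
    obtain ⟨y, rfl⟩ := Θ.mkQ_surjective y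
    rw [hEb k l hk hl, hEb i j hi hj, hEb i j hi hj, hEb k l hk hl, hEb i l hi hl, hEb k j hk hj,
      hE i j k l hi hj hk hl]
    split_ifs <;> simp
  have hLow : Low n E x ≤ (Low n Eb (Θ.mkQ x)).comap Θ.mkQ := by
    apply Low.le
    · exact Low.self
    · intro i j hji hi y _ hy
      rw [Submodule.mem_comap, ← hEb i j hi (by omega)]
      exact Low.step hji hi hy
  by_contra hcon
  have hst := Low.stb hE hs hw
  have key := lemQ' hgl (x := Θ.mkQ x) (mu := mu)
    (fun i j hij hj => by rw [hEb i j (by omega) hj, hs i j hij hj, map_zero])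
    (fun i hi => by rw [hEb i i hi hi, hw i hi, map_smul])
    (fun p hp => by
      obtain ⟨m, h1, h2⟩ := hf p hp
      refine ⟨m, h1, ?_⟩
      rw [hpow _ _ hp (by omega)]
      simpa using h2)
    (K := (LinearMap.ker π ⊓ Low n E x).map Θ.mkQ)
    (by
      rw [Submodule.map_le_iff_le_comap]
      exact inf_le_right.trans hLow)
    (by
      rintro i j hij hj _ ⟨y, ⟨hy1, hy2⟩, rfl⟩
      rw [hEb i j (by omega) hj]
      refine ⟨_, ⟨?_, hst i j (by omega) hj y hy2⟩, rfl⟩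
      rw [SetLike.mem_coe, LinearMap.mem_ker] at *
      rw [hπ i j (by omega) hj y hy2, hy1, map_zero])
    (by
      rw [Submodule.ne_bot_iff]
      refine ⟨Θ.mkQ z, ⟨z, ⟨hz0, hz⟩, rfl⟩, ?_⟩
      simpa using hcon)
  obtain ⟨y, ⟨hy1, hy2⟩, hy3⟩ := key
  have h1 : y - x ∈ Θ := by
    rw [← Submodule.Quotient.eq]; exact hy3
  have h2 := hπΘ _ h1
  rw [map_sub, LinearMap.mem_ker.1 hy1, zero_sub, neg_eq_zero] at h2
  exact hx h2

/-- powers through an equivariant map. -/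
lemma equiv_pow {n : ℕ} {E : ℕ → ℕ → M →ₗ[ℂ] M} {L : ℕ → ℕ → V →ₗ[ℂ] V} {x : M}
    {Ψ : M →ₗ[ℂ] V}
    (h : ∀ i j, j < i → i < n → ∀ z ∈ Low n E x, Ψ (E i j z) = L i j (Ψ z)) {i j : ℕ}
    (hji : j < i) (hi : i < n) (k : ℕ) {z : M} (hz : z ∈ Low n E x) :
    (E i j ^ k) z ∈ Low n E x ∧ Ψ ((E i j ^ k) z) = (L i j ^ k) (Ψ z) := by
  induction k with
  | zero => exact ⟨hz, rfl⟩
  | succ k ih =>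
    rw [pow_succ', pow_succ', Module.End.mul_apply, Module.End.mul_apply, h i j hji hi _ ih.1, ih.2]
    exact ⟨Low.step hji hi ih.1, rfl⟩

lemma low_ker {n : ℕ} {E : ℕ → ℕ → M →ₗ[ℂ] M} {L : ℕ → ℕ → V →ₗ[ℂ] V} {x θ : M}
    {Ψ : M →ₗ[ℂ] V}
    (h : ∀ i j, j < i → i < n → ∀ z ∈ Low n E x, Ψ (E i j z) = L i j (Ψ z))
    (hθ : θ ∈ Low n E x) (h0 : Ψ θ = 0) : Low n E θ ≤ Low n E x ⊓ LinearMap.ker Ψ := by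
  apply Low.le
  · exact ⟨hθ, h0⟩
  · rintro i j hji hi y _ ⟨h1, h2⟩
    refine ⟨Low.step hji hi h1, ?_⟩
    rw [SetLike.mem_coe, LinearMap.mem_ker] at *
    rw [h i j hji hi y h1, h2, map_zero]

theorem lemA {F : ℕ → ℕ → W →ₗ[ℂ] W} {L : ℕ → ℕ → V →ₗ[ℂ] V} {ξ : W} {mu : ℕ → ℤ} {v : V}
    (hξ : ξ ≠ 0) : ∀ n : ℕ, IsGL n F → Sing n F ξ → Wt n F mu ξ →
    (∀ p, p + 1 < n → ∃ m : ℕ, mu p - mu (p+1) = m ∧ (F (p+1) p ^ (m+1)) ξ = 0) → NM n L →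
    (∀ (p m : ℕ), p + 1 < n → mu p - mu (p+1) = m → (L (p+1) p ^ (m+1)) v = 0) →
    ∃ Φ : W →ₗ[ℂ] V, Φ ξ = v ∧
      ∀ i j, j < i → i < n → ∀ w ∈ Low n F ξ, Φ (F i j w) = L i j (Φ w) := by
  have base : ∃ Φ : W →ₗ[ℂ] V, Φ ξ = v := by
    obtain ⟨f, hf⟩ := Module.Projective.exists_dual_ne_zero ℂ hξ
    exact ⟨(f ξ)⁻¹ • f.smulRight v, by simp [smul_smul, hf]⟩
  intro n
  induction n with
  | zero => 
    intros
    obtain ⟨Φ, h⟩ := base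
    exact ⟨Φ, h, fun i j _ hi => by omega⟩
  | succ N ih =>
    intro hF hs hw hf hL hv
    rcases Nat.eq_zero_or_pos N with h0 | hN
    · subst h0
      obtain ⟨Φ, h⟩ := base
      exact ⟨Φ, h, fun i j _ hi => by omega⟩
    obtain ⟨Φ0, hΦ0, hΦ0'⟩ := ih (hF.mono (by omega)) (hs.mono (by omega)) (hw.mono (by omega))
      (fun p hp => hf p (by omega)) (hL.mono (by omega)) (fun p m hp => hv p m (by omega))
    set Eh := opE N (mu N : ℂ) (pX W) (pD W) (pG F) with hEh
    have hgl : IsGL (N+1) Eh := (p_XDG (hF.mono (by omega))).gl _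
    set x : MvPolynomial ℕ ℂ ⊗[ℂ] W := 1 ⊗ₜ ξ with hx
    have hD : ∀ (i : ℕ) (w : W), pD W i (1 ⊗ₜ w) = 0 := by
      intro i w; rw [pD_tmul]; simp
    have hA : ∀ i j, i < N → j < N → ∀ w, Eh i j (1 ⊗ₜ w) = 1 ⊗ₜ F i j w := by
      intro i j hi hj w
      rw [hEh, opE_a _ hi hj, opA_apply, hD, map_zero, sub_zero, pG_tmul]
    have hxs : Sing (N+1) Eh x := by
      intro i j hij hj
      by_cases h : j = N
      · subst h
        rw [hEh, opE_y _ hij, opY_apply]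
        simp [hx, hD]
      · rw [hx, hA i j (by omega) (by omega), hs i j hij hj, TensorProduct.tmul_zero]
    have hxw : Wt (N+1) Eh mu x := by
      intro i hi
      by_cases h : i = N
      · subst h
        rw [hEh, opE_z, opZ_apply]
        simp [hx, hD]
      · rw [hx, hA i i (by omega) (by omega), hw i hi, TensorProduct.tmul_smul]
    obtain ⟨Ψ, hΨ, hΨ'⟩ := exists_Psi hL (mu N : ℂ) Φ0 hΦ0'
    obtain ⟨π, hπ, hπ'⟩ := exists_Psi (hF.nm) (mu N : ℂ) (ξ := ξ) (F := F) LinearMap.id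
      (fun i j _ _ w _ => rfl)
    rw [LinearMap.id_apply] at hπ
    rw [hΦ0] at hΨ
    have hπa := equiv_all hgl hF hxs hxw π (by rw [hπ]; exact hs) (by rw [hπ]; exact hw) hπ'
    obtain ⟨M, rfl⟩ : ∃ M, N = M + 1 := ⟨N - 1, by omega⟩
    obtain ⟨m, hm, hm0⟩ := hf M (by omega)
    set θ := (Eh (M+1) M ^ (m+1)) x with hθ
    have hθs : Sing (M+1+1) Eh θ := by
      apply Sing.of_simple hgl
      intro p hp
      by_cases h : p = M
      · subst h
        rw [hθ, ef_pow hgl hxw (by omega) (by omega) (by omega) (hxs _ _ (by omega) (by omega))]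
        have : (mu p : ℂ) - mu (p+1) = m := by exact_mod_cast hm
        rw [this]; simp
      · rw [hθ]
        generalize m+1 = k
        induction k with
        | zero => exact hxs _ _ (by omega) (by omega)
        | succ k ih =>
          rw [pow_succ', Module.End.mul_apply, hgl _ _ _ _ (by omega) hp (by omega) (by omega), ih,
            if_neg (by omega), if_neg (by omega)]
          simp
    have hθw := hxw.pow hgl (i := M+1) (j := M) (by omega) (by omega) (m+1)
    have hθst := Low.stb hgl hθs hθw
    have hθΨ := equiv_pow hΨ' (i := M+1) (j := M) (by omega) (by omega) (m+1) Low.self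
    have hθπ := equiv_pow hπ' (i := M+1) (j := M) (by omega) (by omega) (m+1) Low.self
    rw [← hEh, ← hx] at hθΨ hθπ
    have kΨ := low_ker hΨ' hθΨ.1 (by rw [hθΨ.2, hΨ]; exact hv M m (by omega) hm)
    have kπ := low_ker hπ' hθπ.1 (by rw [hθπ.2, hπ]; exact hm0)
    have key : ∀ z ∈ Low (M+1+1) Eh x, π z = 0 → Ψ z = 0 := by
      intro z hz hz0
      have := quot_ker hgl hxs hxw hθst (π := π) (F := F) (fun p hp => by
        by_cases h : p = M
        · subst h
          exact ⟨m, hm, Low.self⟩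
        · obtain ⟨k, h1, h2⟩ := hf p hp
          refine ⟨k, h1, ?_⟩
          have : ∀ k, (Eh (p+1) p ^ k) x = 1 ⊗ₜ ((F (p+1) p ^ k) ξ) := by
            intro k
            induction k with
            | zero => rfl
            | succ k ih =>
              rw [pow_succ', pow_succ', Module.End.mul_apply, Module.End.mul_apply, ih,
                hA _ _ (by omega) (by omega)]
          rw [this, h2, TensorProduct.tmul_zero]
          exact zero_mem _) hπa (fun z hz => (kπ hz).2) (by rw [hπ]; exact hξ) hz hz0
      exact (kΨ this).2
    obtain ⟨Φ, hΦ⟩ := exists_factor π Ψ _ key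
    refine ⟨Φ, ?_, ?_⟩
    · rw [← hπ, hΦ _ Low.self, hΨ]
    · have hLow : Low (M+1+1) F ξ ≤ (Low (M+1+1) Eh x).map π := by
        apply Low.le
        · exact ⟨x, Low.self, hπ⟩
        · rintro i j hji hi _ _ ⟨z, hz, rfl⟩
          exact ⟨_, Low.step hji hi hz, hπ' i j hji hi z hz⟩
      intro i j hji hi w hw
      obtain ⟨z, hz, rfl⟩ := hLow hw
      rw [← hπ' i j hji hi z hz, hΦ _ (Low.step hji hi hz), hΦ z hz, hΨ' i j hji hi z hz]

end C7b

open scoped TensorProduct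

section C8
open MvPolynomial in
/-- the polynomial representation -/
noncomputable def pL (i j : ℕ) : MvPolynomial ℕ ℂ →ₗ[ℂ] MvPolynomial ℕ ℂ :=
  LinearMap.mulLeft ℂ (X i) ∘ₗ (pderiv (R := ℂ) j).toLinearMap

lemma pL_apply (i j : ℕ) (q : MvPolynomial ℕ ℂ) :
    pL i j q = MvPolynomial.X i * MvPolynomial.pderiv j q := rfl

lemma pL_gl (n : ℕ) : IsGL n pL := by
  intro i j k l _ _ _ _ q
  simp only [pL_apply, pderiv_X_mul, pderiv_comm l j]
  have h : (if l = i then MvPolynomial.X k * MvPolynomial.pderiv j q else 0) =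
    MvPolynomial.X k * (if l = i then MvPolynomial.pderiv j q else 0) := by split_ifs <;> simp
  have h' : (if j = k then MvPolynomial.X i * MvPolynomial.pderiv l q else 0) =
    MvPolynomial.X i * (if j = k then MvPolynomial.pderiv l q else 0) := by split_ifs <;> simp
  rw [h, h']; ring

lemma pL_pow {s r : ℕ} (hsr : s ≠ r) (p k : ℕ) :
    (pL s r ^ k) (MvPolynomial.X r ^ p) = ((p.descFactorial k : ℕ) : ℂ) •
      (MvPolynomial.X s ^ k * MvPolynomial.X r ^ (p - k)) := by
  induction k with
  | zero => simp
  | succ k ih =>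
    rw [pow_succ', Module.End.mul_apply, ih, map_smul, pL_apply, Derivation.leibniz,
      Derivation.leibniz_pow, Derivation.leibniz_pow, MvPolynomial.pderiv_X_self,
      MvPolynomial.pderiv_X_of_ne hsr, Nat.descFactorial_succ]
    simp only [smul_zero, add_zero, smul_eq_mul, mul_one, nsmul_eq_mul]
    rw [show p - (k+1) = p - k - 1 by omega, Nat.cast_mul, mul_comm ((p-k : ℕ) : ℂ), mul_smul]
    congr 1
    rw [MvPolynomial.smul_eq_C_mul, MvPolynomial.C_eq_coe_nat]
    ring

lemma coeff_pL_zero {i j N p : ℕ} (hi : i ≠ N) (q : MvPolynomial ℕ ℂ) :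
    MvPolynomial.coeff (Finsupp.single N p) (pL i j q) = 0 := by
  rw [pL_apply, MvPolynomial.coeff_X_mul', if_neg]
  simp [Finsupp.single_apply, Ne.symm hi]

lemma coeff_pL_diag (N p : ℕ) (q : MvPolynomial ℕ ℂ) :
    MvPolynomial.coeff (Finsupp.single N p) (pL N N q) =
      p * MvPolynomial.coeff (Finsupp.single N p) q := by
  induction q using MvPolynomial.induction_on' with
  | add a b ha hb => rw [map_add, MvPolynomial.coeff_add, ha, hb, MvPolynomial.coeff_add, mul_add]
  | monomial m c =>
    rw [pL_apply, MvPolynomial.X_mul_pderiv_monomial, MvPolynomial.coeff_smul,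
      MvPolynomial.coeff_monomial]
    split_ifs with h
    · subst h; simp
    · simp

variable {V : Type} [AddCommGroup V] [Module ℂ V] {N : ℕ} {E : ℕ → ℕ → V →ₗ[ℂ] V}

lemma exists_dual_vec [FiniteDimensional ℂ V] {ξ : V} {lam : ℕ → ℤ} (h : IRep (N+1) E ξ lam)
    {r p : ℕ} (hr : r < N) (hp : (p:ℤ) ≤ lam r - lam (r+1)) :
    ∃ x, x ≠ 0 ∧ Sing N E x ∧ Wt (N+1) E (shk lam N r p) x := by
  obtain ⟨ξ', h', -⟩ := h.dual
  obtain ⟨Φ, hΦ, hΦ'⟩ := lemA (F := dE E) (L := pL) (ξ := ξ') (mu := lam)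
    (v := MvPolynomial.X r ^ p) h'.ne (N+1) h'.gl h'.sing h'.wt (fun q hq => h'.pow_zero hq)
    (pL_gl _).nm (by
      intro q m hq hm
      by_cases hqr : q = r
      · subst hqr
        rw [pL_pow (by omega), Nat.descFactorial_eq_zero_iff_lt.2 (by omega)]
        simp
      · rw [pow_succ, Module.End.mul_apply, pL_apply, Derivation.leibniz_pow,
          MvPolynomial.pderiv_X_of_ne (Ne.symm hqr)]
        simp)
  rw [h'.low] at hΦ'
  have hl : ∀ i j, j < i → i < N+1 → ∀ w, Φ (dE E i j w) = pL i j (Φ w) :=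
    fun i j hji hi w => hΦ' i j hji hi w trivial
  let c : ℕ → ℂ := fun i => lam i - (if i = r then (p:ℂ) else 0)
  have hd : ∀ w, ∀ i, i < N+1 → Φ (dE E i i w) = c i • Φ w + pL i i (Φ w) := by
    have key : Low (N+1) (dE E) ξ' ≤
      ({ carrier := {w | ∀ i, i < N+1 → Φ (dE E i i w) = c i • Φ w + pL i i (Φ w)}
         add_mem' := fun {a b} ha hb i hi => by
          simp only [map_add, ha i hi, hb i hi]; module
         zero_mem' := fun i hi => by simp
         smul_mem' := fun t a ha i hi => by
          simp only [map_smul, ha i hi]; module } : Submodule ℂ (Module.Dual ℂ V)) := by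
      apply Low.le
      · intro i hi
        rw [h'.wt i hi, map_smul, hΦ, pL_apply, Derivation.leibniz_pow]
        by_cases hir : i = r
        · subst hir
          rw [MvPolynomial.pderiv_X_self]
          simp only [c, if_true, smul_eq_mul, mul_one, nsmul_eq_mul]
          rcases Nat.eq_zero_or_pos p with h0 | h0
          · subst h0; simp
          · have : MvPolynomial.X (R := ℂ) i * ((p : MvPolynomial ℕ ℂ) * MvPolynomial.X i ^ (p-1)) =
              (p:ℂ) • MvPolynomial.X i ^ p := by
              rw [MvPolynomial.smul_eq_C_mul, MvPolynomial.C_eq_coe_nat]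
              obtain ⟨t, rfl⟩ : ∃ t, p = t + 1 := ⟨p - 1, by omega⟩
              simp only [Nat.add_sub_cancel]
              ring
            rw [this]; module
        · rw [MvPolynomial.pderiv_X_of_ne (Ne.symm hir)]
          simp [c, hir]
      · intro k l hlk hk w _ hw i hi
        have hw := hw i hi
        rw [h'.gl i i k l hi hi hk (by omega), map_sub, map_add, hl k l hlk hk, hw, hl k l hlk hk,
          pL_gl (N+1) i i k l hi hi hk (by omega), map_add, map_smul, add_sub_assoc, add_sub_assoc,
          add_assoc]
        congr 3
        · split_ifs with h1
          · subst h1; exact hl i l hlk hi w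
          · simp
        · split_ifs with h1
          · subst h1; exact hl k l hlk hk w
          · simp
    intro w i hi
    exact key (h'.low ▸ trivial : w ∈ Low (N+1) (dE E) ξ') i hi
  let f : Module.Dual ℂ (Module.Dual ℂ V) :=
    (MvPolynomial.lcoeff ℂ (Finsupp.single N p)) ∘ₗ Φ
  have hf : ∀ φ, f φ = MvPolynomial.coeff (Finsupp.single N p) (Φ φ) := fun φ => rfl
  let x := (Module.evalEquiv ℂ V).symm f
  have hx : ∀ φ : Module.Dual ℂ V, φ x = f φ := fun φ => Module.apply_evalEquiv_symm_apply _ _ φ f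
  have hext : ∀ y z : V, (∀ φ : Module.Dual ℂ V, φ y = φ z) → y = z := by
    intro y z h
    exact (Module.forall_dual_apply_eq_zero_iff ℂ (y - z)).1 (fun φ => by rw [map_sub, h, sub_self])
      |> sub_eq_zero.1
  refine ⟨x, ?_, ?_, ?_⟩
  · intro hx0
    have h1 := hx ((dE E N r ^ p) ξ')
    have h2 := (equiv_pow (Ψ := Φ) (L := pL) (E := dE E) (x := ξ') (n := N+1)
      (fun i j a b z _ => hl i j a b z) hr (by omega) p Low.self).2
    rw [hx0, map_zero, hf, h2, hΦ, pL_pow (by omega), MvPolynomial.coeff_smul] at h1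
    simp [MvPolynomial.coeff_X_pow, Nat.descFactorial_self] at h1
    exact Nat.factorial_ne_zero p (by exact_mod_cast h1.symm)
  · intro i j hij hj
    apply hext
    intro φ
    rw [map_zero, ← dE_apply (E := E) j i φ x, hx, hf, hl j i hij (by omega), coeff_pL_zero (by omega)]
  · intro i hi
    apply hext
    intro φ
    rw [← dE_apply (E := E) i i φ x, hx, hf, hd φ i hi, MvPolynomial.coeff_add,
      MvPolynomial.coeff_smul, map_smul, hx, hf]
    by_cases hiN : i = N
    · subst hiN
      rw [coeff_pL_diag]
      simp [shk, c, hr.ne']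
      ring
    · rw [coeff_pL_zero hiN]
      simp only [shk, c, hiN, if_false, smul_eq_mul]
      push_cast
      split_ifs <;> simp

end C8

open scoped TensorProduct

section C8b
variable {V : Type} [AddCommGroup V] [Module ℂ V] {N : ℕ} {E : ℕ → ℕ → V →ₗ[ℂ] V}

lemma first_ne {P : ℕ → Prop} {N : ℕ} (h : ¬ ∀ i, i < N → P i) :
    ∃ s, s < N ∧ ¬ P s ∧ ∀ i, i < s → P i := by
  classical
  push Not at h
  have h1 := Nat.find_spec h
  refine ⟨Nat.find h, h1.1, h1.2, fun i hi => ?_⟩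
  have h2 := Nat.find_min h hi
  push Not at h2
  exact h2 (by omega)

lemma c8 [FiniteDimensional ℂ V] {ξ : V} {lam : ℕ → ℤ} (h : IRep (N+1) E ξ lam)
    {r p : ℕ} (hr : r < N) (hp1 : 1 ≤ p) (hp : (p:ℤ) ≤ lam r - lam (r+1)) :
    ∃ x, x ≠ 0 ∧ Sing N E x ∧ Wt (N+1) E (shk lam N r p) x ∧
      x ∈ Kt N E ⊤ (lam N + p) (lam r - p + N - r) := by
  obtain ⟨x, hx0, hs, hw⟩ := exists_dual_vec h hr hp
  refine ⟨x, hx0, hs, hw, trivial, ?_, ?_⟩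
  · rw [hw N (by omega)]
    simp [shk, hr.ne']
  have hgl := h.gl
  obtain ⟨d, rfl⟩ : ∃ d, p = d + 1 := ⟨p - 1, by omega⟩
  have htl : ∀ s, s < N → ∀ y, y ≠ 0 → Sing N E y →
      Wt (N+1) E (sh (shk lam N r (d+1)) s N) y → s = r := by
    intro s hsN y hy0 hys hyw
    have := h.cls.tl hgl h.bd d y _ trivial hy0 hys hyw (by
      simp [sh, shk, hsN.ne', hr.ne']; ring) s hsN
    by_contra hsr
    simp [sh, shk, hsN.ne, hsr] at this
  have hE0 : ∀ i, i < r → E i N x = 0 := by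
    by_contra hcon
    obtain ⟨s, h1, h2, h3⟩ := first_ne hcon
    have := htl s (by omega) _ h2 (Sing.step hgl hs (by omega) h3)
      (hw.sh hgl (by omega) (by omega))
    omega
  by_contra hcon
  obtain ⟨s, h1, h2, h3⟩ := first_ne hcon
  have hwS : Wt (N+1) E (sh (shk lam N r (d+1)) s N) (Sg N E s x) := by
    unfold Sg
    intro i hi
    rw [map_sum, Finset.smul_sum]
    apply Finset.sum_congr rfl
    intro a ha
    have ha := Finset.mem_range.1 ha
    have hh := ((hw.sh hgl (i := a) (j := N) (by omega) (by omega)).sh hgl (i := s) (j := a)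
      (by omega) (by omega)) i hi
    rw [hh]
    congr 2
    simp only [sh]
    ring
  have hsr := htl s h1 (Sg N E s x - ((lam r - (d+1:ℕ) + N - r : ℤ) : ℂ) • E s N x)
    (fun hz => h2 (sub_eq_zero.1 hz)) (by
      intro j k hjk hk
      have e1 := Sg_comm1 hgl (i := s) (j := j) (k := k) h1 (by omega) hk x
      rw [hs j k hjk hk, Sg_zero] at e1
      have e2 := hgl j k s N (by omega) (by omega) (by omega) (by omega) x
      rw [hs j k hjk hk, map_zero, if_neg (by omega : ¬ N = j)] at e2
      rw [map_sub, map_smul, e2, sub_eq_zero.1 e1.symm]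
      by_cases hks : k = s
      · subst hks
        simp [h3 j hjk]
      · simp [hks])
    (hwS.sub ((hw.sh hgl (by omega) (by omega)).smul _))
  subst hsr
  apply h2
  rw [Sg_first hgl hs hw h1 hE0]
  congr 2
  simp [shk, h1.ne]

/-- restriction to the submodule generated by a vector -/
noncomputable def rE (E : ℕ → ℕ → V →ₗ[ℂ] V) (U : Submodule ℂ V) (i j : ℕ) : U →ₗ[ℂ] U :=
  open Classical in if h : ∀ y ∈ U, E i j y ∈ U then (E i j).restrict h else 0

variable {n : ℕ}

lemma rE_coe {U : Submodule ℂ V} (hU : Stb n E U) {i j : ℕ} (hi : i < n) (hj : j < n) (y : U) :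
    (rE E U i j y : V) = E i j y := by
  have h : ∀ y ∈ U, E i j y ∈ U := fun y hy => hU i j hi hj y hy
  simp only [rE, dif_pos h]
  rfl

lemma rE_pow {U : Submodule ℂ V} (hU : Stb n E U) {i j : ℕ} (hi : i < n) (hj : j < n) (k : ℕ)
    (y : U) : (((rE E U i j ^ k) y : U) : V) = (E i j ^ k) y := by
  induction k with
  | zero => rfl
  | succ k ih => rw [pow_succ', pow_succ', Module.End.mul_apply, Module.End.mul_apply,
      rE_coe hU hi hj, ih]

lemma Cls.irep (hgl : IsGL n E) (hbd : Bd n E) {K : Submodule ℂ V} {x : V} {lam : ℕ → ℤ}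
    (h : Cls n E K x lam) :
    IRep n (rE E (Low n E x)) ⟨x, Low.self⟩ lam := by
  have hst := Low.stb hgl h.sing h.wt
  refine ⟨?_, ?_, ?_, ?_, ?_⟩
  · intro i j k l hi hj hk hl y
    apply Subtype.ext
    rw [Submodule.coe_sub, Submodule.coe_add]
    simp only [apply_ite (Subtype.val), Submodule.coe_zero, rE_coe hst hi hj, rE_coe hst hk hl,
      rE_coe hst hi hl, rE_coe hst hk hj]
    exact hgl i j k l hi hj hk hl y
  · intro h0; exact h.ne (congrArg Subtype.val h0)
  · intro i j hij hj
    apply Subtype.ext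
    rw [rE_coe hst (by omega) hj]; exact h.sing i j hij hj
  · intro i hi
    apply Subtype.ext
    rw [rE_coe hst hi hi]; exact h.wt i hi
  · intro U hU
    by_cases hU0 : U = ⊥
    · exact Or.inl hU0
    right
    obtain ⟨y, hy, hy0⟩ := Submodule.exists_mem_ne_zero_of_ne_bot hU0
    have hlk : Low n E x ≤ K := Low.le_stb h.mem h.stb
    have hUst : Stb n E (U.map (Low n E x).subtype) := by
      rintro i j hi hj _ ⟨y, hy, rfl⟩
      exact ⟨_, hU i j hi hj y hy, rE_coe hst hi hj y⟩
    obtain ⟨z, hz, w, hz0, hzs, hzw⟩ := exists_sing hgl (lam := lam)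
      (K := U.map (Low n E x).subtype)
      (by
        rintro _ ⟨y, hy, rfl⟩
        exact WB.mono (fun _ h => h.1) le_rfl (Low.le_WB hgl h.wt y.2))
      (fun i j hij hj y hy => hUst i j (by omega) hj y hy) ⟨y, hy, rfl⟩
      (fun h0 => hy0 (Subtype.ext h0))
    obtain ⟨u, hu, rfl⟩ := hz
    obtain ⟨c, hc⟩ := h.uniq _ (hlk u.2) w hzs hzw
    have hc0 : c ≠ 0 := by
      rintro rfl
      rw [zero_smul] at hc; exact hz0 hc
    have hxU : x ∈ U.map (Low n E x).subtype := by
      have : c⁻¹ • (Low n E x).subtype u = x := by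
        rw [Submodule.subtype_apply, hc, smul_smul, inv_mul_cancel₀ hc0, one_smul]
      exact ⟨c⁻¹ • u, Submodule.smul_mem _ _ hu, this⟩
    rw [eq_top_iff]
    rintro ⟨y, hy⟩ -
    obtain ⟨y', hy', he⟩ := Low.le_stb hxU hUst hy
    have : y' = ⟨y, hy⟩ := Subtype.ext he
    rwa [← this]

end C8b

open scoped TensorProduct

section C9
variable {V : Type} [AddCommGroup V] [Module ℂ V] {N : ℕ} {E : ℕ → ℕ → V →ₗ[ℂ] V}

lemma Kt.pow (hgl : IsGL (N+1) E) {K : Submodule ℂ V} (hK : Stb (N+1) E K) {e τ : ℤ} {j : ℕ}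
    (hj : j < N) (k : ℕ) {x : V} (hx : x ∈ Kt N E K e τ) :
    (E j N ^ k) x ∈ Kt N E K (e-k) (τ+k) := by
  induction k with
  | zero => simpa using hx
  | succ k ih =>
    rw [pow_succ', Module.End.mul_apply]
    have := Kt.step hgl hK hj ih
    rw [show e - (k+1:ℕ) = e - k - 1 by push_cast; ring,
      show τ + (k+1:ℕ) = τ + k + 1 by push_cast; ring]
    exact this

lemma Sg_rec {M : ℕ} (hgl : IsGL (M+2) E) {i : ℕ} (hi : i < M) (y : V) :
    Sg M E i (E M (M+1) y) = E M (M+1) (Sg M E i y) + Sg (M+1) E i y - E i M (E M (M+1) y) := by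
  have h1 : ∀ a ∈ Finset.range M, E i a (E a M (E M (M+1) y)) =
      E M (M+1) (E i a (E a M y)) + E i a (E a (M+1) y) := by
    intro a ha
    have ha := Finset.mem_range.1 ha
    rw [hgl a M M (M+1) (by omega) (by omega) (by omega) (by omega), if_pos rfl,
      if_neg (by omega), sub_zero, map_add,
      hgl i a M (M+1) (by omega) (by omega) (by omega) (by omega), if_neg (by omega),
      if_neg (by omega), add_zero, sub_zero]
  unfold Sg
  rw [Finset.sum_congr rfl h1, Finset.sum_add_distrib, Finset.sum_range_succ, map_sum]
  abel

lemma star_id {M : ℕ} (hgl : IsGL (M+2) E) {K : Submodule ℂ V} (hK : Stb (M+2) E K) {e : ℤ}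
    {mu : ℕ → ℤ} {v : V} (hv : v ∈ Kt (M+1) E K e (mu (M+1))) {i : ℕ} (hi : i < M)
    (hA : Sg M E i v = (mu M : ℂ) • E i M v) (j : ℕ) :
    Sg M E i ((E M (M+1) ^ (j+1)) v) = ((mu M : ℂ) - j - 1) • E i M ((E M (M+1) ^ (j+1)) v) -
      (((j:ℂ)+1) * ((mu M : ℂ) - mu (M+1) - j)) • E i (M+1) ((E M (M+1) ^ j) v) := by
  have hc : ∀ y, E M (M+1) (E i M y) = E i M (E M (M+1) y) - E i (M+1) y := by
    intro y
    rw [hgl i M M (M+1) (by omega) (by omega) (by omega) (by omega), if_pos rfl,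
      if_neg (by omega)]
    abel
  have hc2 : ∀ y, E M (M+1) (E i (M+1) y) = E i (M+1) (E M (M+1) y) := by
    intro y
    rw [hgl i (M+1) M (M+1) (by omega) (by omega) (by omega) (by omega), if_neg (by omega),
      if_neg (by omega)]
    abel
  have hS : ∀ k : ℕ, Sg (M+1) E i ((E M (M+1) ^ k) v) =
      ((mu (M+1) : ℂ) + k) • E i (M+1) ((E M (M+1) ^ k) v) := by
    intro k
    have := (Kt.pow hgl hK (j := M) (by omega) k hv).2.2 i (by omega)
    rw [this]; push_cast; rfl
  induction j with
  | zero =>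
    have := hS 0
    simp only [pow_zero, Module.End.one_apply] at this
    simp only [zero_add, pow_one, pow_zero, Module.End.one_apply]
    rw [Sg_rec hgl hi, hA, map_smul, hc, this]
    push_cast; module
  | succ j ih =>
    rw [pow_succ' _ (j+1), Module.End.mul_apply, Sg_rec hgl hi, ih, map_sub, map_smul, map_smul,
      hc, hc2, hS]
    rw [← Module.End.mul_apply (E M (M+1)) (E M (M+1) ^ j), ← pow_succ']
    push_cast; module

lemma Cls.kfind [FiniteDimensional ℂ V] {K : Submodule ℂ V} {ξ : V} {lam : ℕ → ℤ}
    (hgl : IsGL (N+1) E) (hbd : Bd (N+1) E)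
    (hK : Cls (N+1) E K ξ lam) {e τ : ℤ} {u : V} (hu : u ∈ Kt N E K e τ) (hu0 : u ≠ 0)
    {w : ℕ → ℤ} (hw : Wt (N+1) E w u) :
    ∃ d : ℕ, e = lam N + d ∧ ∃ x w', Cls N E (Kt N E K e τ) x w' ∧
      ((d = 0 ∧ ∀ i, i < N → w' i = lam i) ∨
       (1 ≤ d ∧ ∃ r, r < N ∧ τ = lam r - d + N - r ∧
        (∀ i, i < N → w' i = lam i - (if i = r then (d:ℤ) else 0)) ∧ lam (r+1) ≤ lam r - d)) := by
  have hge := hK.last_ge hgl hbd hu.1 hu0 hw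
  have hwe := Kt.last_eq hu hu0 hw
  obtain ⟨d, hd⟩ : ∃ d : ℕ, e = lam N + d := ⟨(w N - lam N).toNat, by omega⟩
  refine ⟨d, hd, ?_⟩
  subst hd
  have hglN := hgl.mono (Nat.le_succ N)
  obtain ⟨lam0, hl0⟩ := hbd.mono (Nat.le_succ N)
  obtain ⟨x, hx, w', hx0, hxs, hxw⟩ := exists_sing hglN (K := Kt N E K (lam N + d) τ)
    (fun x _ => hl0 x) (fun i j hij hj y hy => Kt.stb hgl hK.stb i j (by omega) hj y hy) hu hu0
  have hxw' := Kt.wt_last hx hxw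
  refine ⟨x, w', hK.kt hgl hbd hx hx0 hxs hxw, ?_⟩
  rcases hK.k3 hgl hbd d τ x _ hx hx0 hxs hxw' with ⟨hd0, c, hc⟩ |
        ⟨hd1, r, hr, hr1, hr2, hr3, hr4, hr5⟩
  · exact Or.inl ⟨hd0, Wt.unique hx0 hxw (hc ▸ (hK.wt.mono (Nat.le_succ N)).smul c)⟩
  · right
    refine ⟨hd1, r, hr, hr1, ?_, hK.bound hgl hbd hx hx0 hxs hxw' hr hr2⟩
    intro i hi
    have := hr2 i hi
    rwa [Function.update_of_ne (by omega)] at this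

lemma lemS_kill [FiniteDimensional ℂ V] {M : ℕ} {ξ : V} {lam lam' mu : ℕ → ℤ}
    (h : IRep (M+2) E ξ lam) (hb : SD (M+2) (ash mu)) {r p : ℕ} (hr : r < M+1) (hr1 : 1 ≤ r)
    (hp : (p:ℤ) = ash lam r - ash mu (M+1))
    (h2 : ash mu M ≤ ash lam r)
    (hlam' : ∀ i, i < M+1 → lam' i = lam i - if i = r then (p:ℤ) else 0)
    {v : V} (hv : v ∈ Kt (M+1) E ⊤ (lam (M+1) + p) (mu (M+1)))
    {w : ℕ → ℤ} (hw : Wt (M+1) E w v) (hwM : w M = lam' M + (ash lam (r-1) - ash mu M))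
    (hA : StarA (M+1) E mu v) {k : ℕ} (hk : (k:ℤ) = mu M - mu (M+1) + 1) :
    (E M (M+1) ^ k) v = 0 := by
  by_contra hu0
  have hgl := h.gl
  have ha : SD (M+2) (ash lam) := SD.of_dom fun i j hij hj => h.dom hij hj
  have hbM := hb M (M+1) (by omega) (by omega)
  have hkb : (k:ℤ) = ash mu M - ash mu (M+1) := by simp only [ash]; push_cast; omega
  have hK := h.cls
  have hu := Kt.pow hgl hK.stb (j := M) (by omega) k hv
  have huw := (Kt.wt_last hv hw).pow hgl (i := M) (j := M+1) (by omega) (by omega) k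
  have hbd := h.bd
  obtain ⟨d, hd, x1, w1, hC, hw1⟩ := hK.kfind hgl hbd hu hu0 huw
  have hdd : (d:ℤ) = p - k := by omega
  -- identify w1
  have hw1' : ∀ i, i < M+1 → ash w1 i = if i = r then ash mu M else ash lam i := by
    rcases hw1 with ⟨h0, h1⟩ | ⟨h0, r1, hr1', hτ, h1, -⟩
    · intro i hi
      simp only [ash] at *
      rw [h1 i hi]
      split_ifs with hir
      · subst hir; omega
      · rfl
    · have : r1 = r := by
        have e1 : ash lam r1 = ash lam r := by
          simp only [ash] at *; push_cast at *; omega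
        rcases lt_trichotomy r1 r with hh | hh | hh
        · have := ha _ _ hh (by omega); omega
        · exact hh
        · have := ha _ _ hh (by omega); omega
      subst this
      intro i hi
      simp only [ash] at *
      rw [h1 i hi]
      split_ifs with hir
      · subst hir; omega
      · omega
  have hSg : ∀ i, i < M → Sg M E i ((E M (M+1) ^ k) v) =
      ((mu M - k : ℤ) : ℂ) • E i M ((E M (M+1) ^ k) v) := by
    intro i hi
    obtain ⟨j, rfl⟩ : ∃ j, k = j + 1 := ⟨k - 1, by omega⟩
    rw [star_id hgl hK.stb hv hi (hA i M hi (by omega)) j]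
    have : (mu M : ℂ) - mu (M+1) - j = 0 := by
      have : mu M - mu (M+1) - j = 0 := by push_cast at hk; omega
      exact_mod_cast this
    rw [this]
    push_cast; module
  have hu2 : (E M (M+1) ^ k) v ∈ Kt M E (Kt (M+1) E ⊤ (lam (M+1) + p - k) (mu (M+1) + k))
      (w M + k) (mu M - k) := by
    refine ⟨hu, ?_, hSg⟩
    rw [huw M (by omega)]
    simp [shk]
  have hglN := hgl.mono (Nat.le_succ (M+1))
  have hbdN := hbd.mono (Nat.le_succ (M+1))
  obtain ⟨d', hd', x2, w2, hC2, hw2⟩ := hC.kfind hglN hbdN hu2 hu0 (huw.mono (Nat.le_succ _))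
  have har := ha (r-1) r (by omega) (by omega)
  have hwM1 := hw1' M (by omega)
  have hlM := hlam' M (by omega)
  have hd'' : (d':ℤ) = if r = M then ash lam (r-1) - ash mu M else ash lam (r-1) - ash mu (M+1) := by
    by_cases hrM : r = M
    · subst hrM
      rw [if_pos rfl] at hwM1 hlM ⊢
      simp only [ash] at *; push_cast at *; omega
    · rw [if_neg (Ne.symm hrM)] at hwM1 hlM
      rw [if_neg hrM]
      simp only [ash] at *; push_cast at *; omega
  rcases hw2 with ⟨h0, -⟩ | ⟨h0, s, hs, hτ, -, hbnd⟩
  · split_ifs at hd'' <;> omega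
  · have e1 : ash w1 s = ash mu (M+1) + d' := by
      simp only [ash] at *; push_cast at *; omega
    have e2 : ash w1 (s+1) < ash mu (M+1) := by
      simp only [ash] at *; push_cast at *; omega
    rw [hw1' s (by omega)] at e1
    rw [hw1' (s+1) (by omega)] at e2
    by_cases hrM : r = M
    · subst hrM
      rw [if_pos rfl] at hd''
      rw [if_neg hs.ne] at e1
      have := ha.lt_of (i := r-1) (j := s) (by omega) (by omega)
      omega
    · rw [if_neg hrM] at hd''
      by_cases hsr : s = r
      · rw [if_pos hsr] at e1; omega
      · rw [if_neg hsr] at e1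
        have h1 := ha.le_of (i := r-1) (j := s) (by omega) (by omega)
        have h2 := ha.le_of (i := s) (j := r-1) (by omega) (by omega)
        rw [if_pos (by omega)] at e2
        omega

lemma StarA.succ {mu : ℕ → ℤ} {v : V} (h : StarA N E mu v)
    (h' : ∀ i, i < N → Sg N E i v = (mu N : ℂ) • E i N v) : StarA (N+1) E mu v := by
  intro i j hij hj
  by_cases h1 : j = N
  · subst h1; exact h' i hij
  · exact h i j hij (by omega)

lemma StarB.succ {M : ℕ} {mu : ℕ → ℤ} {v : V} (h : StarB (M+1) E mu v)
    (h' : ∀ k : ℕ, (k:ℤ) = mu M - mu (M+1) + 1 → (E M (M+1) ^ k) v = 0) :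
    StarB (M+2) E mu v := by
  intro p hp k hk
  by_cases h1 : p = M
  · subst h1; exact h' k hk
  · exact h p (by omega) k hk

lemma Sing.starA {mu : ℕ → ℤ} {v : V} (h : Sing N E v) : StarA N E mu v := by
  intro i j hij hj
  rw [h i j hij hj, smul_zero]
  unfold Sg
  apply Finset.sum_eq_zero
  intro a ha
  rw [h a j (Finset.mem_range.1 ha) hj, map_zero]

lemma Sing.starB {mu : ℕ → ℤ} (hmu : ∀ i j, i < j → j < N → mu j ≤ mu i) {v : V}
    (h : Sing N E v) : StarB N E mu v := by
  intro p hp k hk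
  have := hmu p (p+1) (by omega) hp
  obtain ⟨j, rfl⟩ : ∃ j, k = j + 1 := ⟨k - 1, by omega⟩
  rw [pow_succ, Module.End.mul_apply, h p (p+1) (by omega) hp, map_zero]

lemma rE_starA {U : Submodule ℂ V} (hU : Stb N E U) {mu : ℕ → ℤ} {v : U}
    (h : StarA N (rE E U) mu v) : StarA N E mu (v : V) := by
  intro i j hij hj
  have h1 := congrArg Subtype.val (h i j hij hj)
  rw [Submodule.coe_smul, rE_coe hU (by omega) hj] at h1
  rw [← h1]
  unfold Sg
  rw [Submodule.coe_sum]
  apply Finset.sum_congr rfl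
  intro a ha
  have ha := Finset.mem_range.1 ha
  rw [rE_coe hU (by omega) (by omega), rE_coe hU (by omega) (by omega)]

lemma rE_starB {U : Submodule ℂ V} (hU : Stb N E U) {mu : ℕ → ℤ} {v : U}
    (h : StarB N (rE E U) mu v) : StarB N E mu (v : V) := by
  intro p hp k hk
  rw [← rE_pow hU (by omega) hp, h p hp k hk]; rfl

lemma rE_wt {U : Submodule ℂ V} (hU : Stb N E U) {w : ℕ → ℤ} {v : U}
    (h : Wt N (rE E U) w v) : Wt N E w (v : V) := by
  intro i hi
  rw [← rE_coe hU hi hi, h i hi]; rfl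

end C9

theorem lemS (N : ℕ) : ∀ (V : Type) [AddCommGroup V] [Module ℂ V] [FiniteDimensional ℂ V]
    (E : ℕ → ℕ → V →ₗ[ℂ] V) (ξ : V) (lam mu : ℕ → ℤ) (r m : ℕ),
    (∀ i j, i < j → j < N+1 → mu j ≤ mu i) → IRep (N+1) E ξ lam → r < N → 1 ≤ m → m ≤ r+1 →
    ash lam (r+1) < ash mu N → ash mu N < ash lam r →
    (∀ j, 1 ≤ j → j < m → ash mu (N-j) ≤ ash lam (r+1-j)) → ash lam (r+1-m) < ash mu (N-m) →
    ∃ v w, v ≠ 0 ∧ Wt (N+1) E w v ∧ w N = lam N + (ash lam r - ash mu N) ∧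
      StarA (N+1) E mu v ∧ StarB (N+1) E mu v := by
  induction N with
  | zero => intros; omega
  | succ M ih =>
    intro V _ _ _ E ξ lam mu r m hmu h hr hm1 hm h1 h2 h3 h4
    obtain ⟨p, hp⟩ : ∃ p : ℕ, (p:ℤ) = ash lam r - ash mu (M+1) :=
      ⟨(ash lam r - ash mu (M+1)).toNat, by omega⟩
    have hgl := h.gl
    have hbd := h.bd
    obtain ⟨x, hx0, hxs, hxw, hxK⟩ := c8 h hr (p := p) (by omega) (by
      simp only [ash] at *; push_cast at *; omega)
    have hτ : lam r - p + (M+1:ℕ) - r = mu (M+1) := by simp only [ash] at *; push_cast at *; omega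
    rw [hτ] at hxK
    have hglN := hgl.mono (Nat.le_succ (M+1))
    have hmuN : ∀ i j, i < j → j < M+1 → mu j ≤ mu i := fun i j hij hj => hmu i j hij (by omega)
    have hwt : shk lam (M+1) r p (M+1) = lam (M+1) + p := by simp [shk, hr.ne']
    rcases hm1.eq_or_lt with hm1 | hm1
    · subst hm1
      refine ⟨x, _, hx0, hxw, by rw [hwt, hp], StarA.succ hxs.starA hxK.2.2,
        StarB.succ (hxs.starB hmuN) ?_⟩
      intro k hk
      by_contra hne
      have := h.cls.last_ge hgl hbd trivial hne
        (hxw.pow hgl (i := M) (j := M+1) (by omega) (by omega) k)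
      simp [shk, hr.ne'] at this
      simp only [ash, Nat.add_sub_cancel] at *; push_cast at *; omega
    · have hC := h.cls.kt hgl hbd hxK hx0 hxs (hxw.mono (Nat.le_succ _))
      have hst := Low.stb hglN hxs (hxw.mono (Nat.le_succ _))
      have hI := hC.irep hglN (hbd.mono (Nat.le_succ _))
      have hl' : ∀ i, i < M+1 → shk lam (M+1) r p i = lam i - if i = r then (p:ℤ) else 0 := by
        intro i hi
        simp [shk, hi.ne]
      have ha : SD (M+2) (ash lam) := SD.of_dom fun i j hij hj => h.dom hij hj
      have hb : SD (M+2) (ash mu) := SD.of_dom hmu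
      have ha' : ∀ i, i < M+1 → ash (shk lam (M+1) r p) i = if i = r then ash mu (M+1) else ash lam i := by
        intro i hi
        simp only [ash] at *
        rw [hl' i hi]
        split_ifs with hir
        · subst hir; omega
        · omega
      have h31 := h3 1 le_rfl hm1
      simp only [Nat.add_sub_cancel] at h31
      obtain ⟨v, w, hv0, hvw, hvM, hvA, hvB⟩ := ih (Low (M+1) E x) (rE E (Low (M+1) E x))
        ⟨x, Low.self⟩ (shk lam (M+1) r p) mu (r-1) (m-1) hmuN hI (by omega) (by omega) (by omega)
        (by
          rw [show r - 1 + 1 = r by omega, ha' r hr, if_pos rfl]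
          exact hb _ _ (by omega) (by omega))
        (by
          rw [ha' (r-1) (by omega), if_neg (by omega)]
          have := ha (r-1) r (by omega) (by omega)
          omega)
        (by
          intro j hj1 hj2
          rw [ha' _ (by omega), if_neg (by omega), show r - 1 + 1 - j = r + 1 - (j+1) by omega,
            show M - j = M + 1 - (j+1) by omega]
          exact h3 (j+1) (by omega) (by omega))
        (by
          rw [ha' _ (by omega), if_neg (by omega), show r - 1 + 1 - (m-1) = r + 1 - m by omega,
            show M - (m-1) = M + 1 - m by omega]
          exact h4)
      have hvK : (v:V) ∈ Kt (M+1) E ⊤ (lam (M+1) + p) (mu (M+1)) :=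
        Low.le_stb hxK (Kt.stb hgl h.cls.stb) v.2
      have hvw := rE_wt hst hvw
      have hvA := rE_starA hst hvA
      have hvB := rE_starB hst hvB
      refine ⟨v, _, fun h0 => hv0 (Subtype.ext h0), Kt.wt_last hvK hvw, by simp [hp],
        StarA.succ hvA hvK.2.2, StarB.succ hvB ?_⟩
      intro k hk
      refine lemS_kill h hb hr (by omega) hp h31 hl' hvK hvw ?_ hvA hk
      rw [hvM, ha' (r-1) (by omega), if_neg (by omega)]

open scoped TensorProduct

lemma XX.down {N : ℕ} {a b : ℕ → ℤ} {i i' j j' : ℕ} (hi : i < N) (hi' : i' < N) (hj : j < N)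
    (hj' : j' < N) (h1 : a i < b j) (h2 : b j < a i') (h3 : a i' < b j')
    (h4 : ∀ k, k < N → b k ≠ a i) (h5 : ∀ k, k < N → b k ≠ a i')
    (h6 : ∀ k, k < N → a k ≠ b j) (h7 : ∀ k, k < N → a k ≠ b j') : XX N a b :=
  ⟨i, i', j, j', hi, hi', hj, hj', h1, h2, h3, h4, h5, h6, h7⟩

lemma XX.down_eq {N : ℕ} {a b : ℕ → ℤ} (he : a N = b N) (h : XX (N+1) a b) : XX N a b := by
  obtain ⟨i, i', j, j', hi, hi', hj, hj', h1, h2, h3, h4, h5, h6, h7⟩ := h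
  have key : ∀ {c d : ℕ → ℤ} {i : ℕ}, c N = d N → i < N+1 → (∀ k, k < N+1 → d k ≠ c i) → i < N := by
    intro c d i he hi h
    rcases Nat.lt_succ_iff_lt_or_eq.1 hi with h' | h'
    · exact h'
    · subst h'; exact absurd he.symm (h i hi)
  exact XX.down (key he hi h4) (key he hi' h5) (key he.symm hj h6) (key he.symm hj' h7) h1 h2 h3
    (fun k hk => h4 k (by omega)) (fun k hk => h5 k (by omega)) (fun k hk => h6 k (by omega))
    (fun k hk => h7 k (by omega))

lemma cross_ab {N : ℕ} {a b : ℕ → ℤ} (ha : SD (N+1) a) (hb : SD (N+1) b)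
    (hX : XX (N+1) a b ∨ XX (N+1) b a) (h1 : ¬ XX N a b) (h2 : ¬ XX N b a) (hlt : a N < b N) :
    (∀ k, k < N+1 → a k ≠ b N) ∧ ∃ i' j', i' < N ∧ j' < N ∧ b N < a i' ∧ a i' < b j' ∧
      (∀ k, k < N+1 → b k ≠ a i') ∧ (∀ k, k < N+1 → a k ≠ b j') := by
  have cas : ∀ {i}, i < N+1 → i < N ∨ i = N := fun h => Nat.lt_succ_iff_lt_or_eq.1 h
  rcases hX with ⟨i, i', j, j', hi, hi', hj, hj', g1, g2, g3, g4, g5, g6, g7⟩ |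
    ⟨i, i', j, j', hi, hi', hj, hj', g1, g2, g3, g4, g5, g6, g7⟩
  · have hi'i := ha.lt_of (i := i') (j := i) hi' (by omega)
    have hj'j := hb.lt_of (i := j') (j := j) hj' (by omega)
    rcases cas hj with hjN | rfl
    · have hbj := hb j N hjN (by omega)
      refine ⟨?_, i', j', by omega, by omega, by omega, g3, g5, g7⟩
      intro k hk he
      rcases cas hi with hiN | rfl
      · exact h1 (XX.down hiN (by omega) hjN (by omega) g1 g2 g3
          (fun k hk => g4 k (by omega)) (fun k hk => g5 k (by omega))
          (fun k hk => g6 k (by omega)) (fun k hk => g7 k (by omega)))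
      · rcases cas hk with hkN | rfl
        · refine h1 (XX.down (i := k) hkN (by omega) hjN (by omega) (by omega) g2 g3
            (fun l hl => ?_) (fun k hk => g5 k (by omega))
            (fun k hk => g6 k (by omega)) (fun k hk => g7 k (by omega)))
          have := hb l i hl (by omega)
          omega
        · omega
    · exact ⟨g6, i', j', by omega, by omega, g2, g3, g5, g7⟩
  · have hi'i := hb.lt_of (i := i') (j := i) hi' (by omega)
    have hj'j := ha.lt_of (i := j') (j := j) hj' (by omega)
    have hbi := hb.le (i := i) (j := N) (by omega) (by omega)
    have hjN : j < N := by
      rcases cas hj with hh | rfl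
      · exact hh
      · omega
    rcases cas hi with hiN | rfl
    · exact absurd (XX.down hiN (by omega) hjN (by omega) g1 g2 g3
          (fun k hk => g4 k (by omega)) (fun k hk => g5 k (by omega))
          (fun k hk => g6 k (by omega)) (fun k hk => g7 k (by omega))) h2
    · exact ⟨g4, j, i', hjN, by omega, g1, g2, g6, g5⟩

lemma cross_data {N : ℕ} {a b : ℕ → ℤ} (ha : SD (N+1) a) (hb : SD (N+1) b)
    (hX : XX (N+1) a b ∨ XX (N+1) b a) (h1 : ¬ XX N a b) (h2 : ¬ XX N b a) (hlt : a N < b N) :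
    ∃ r m, r < N ∧ 1 ≤ m ∧ m ≤ r+1 ∧ a (r+1) < b N ∧ b N < a r ∧
      (∀ j, 1 ≤ j → j < m → b (N-j) ≤ a (r+1-j)) ∧ a (r+1-m) < b (N-m) := by
  classical
  obtain ⟨hbN, i', j', hi', hj', g1, g2, g3, g4⟩ := cross_ab ha hb hX h1 h2 hlt
  have hbj := hb j' N hj' (by omega)
  -- r
  obtain ⟨r, hrN, hr1, hr2⟩ : ∃ r, r < N ∧ a (r+1) < b N ∧ b N < a r := by
    by_contra hcon
    push Not at hcon
    have : ∀ k, i' + k ≤ N → b N < a (i' + k) := by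
      intro k
      induction k with
      | zero => intro _; simpa using g1
      | succ k ih =>
        intro hk
        have h3 := ih (by omega)
        by_contra h4
        have h5 := hbN (i' + (k+1)) (by omega)
        have := hcon (i' + k) (by omega) (by
          rw [add_assoc]; omega)
        omega
    have := this (N - i') (by omega)
    rw [show i' + (N - i') = N by omega] at this
    omega
  have hir : i' ≤ r := by
    have := ha.lt_of (i := i') (j := r+1) (by omega) (by omega)
    omega
  have hex : ∃ m, 1 ≤ m ∧ m ≤ r+1 ∧ a (r+1-m) < b (N-m) := by
    by_contra hcon
    push Not at hcon
    have hle : ∀ t, t ≤ r → b (N-1-t) ≤ a (r-t) := by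
      intro t ht
      have := hcon (t+1) (by omega) (by omega)
      rwa [show r+1-(t+1) = r-t by omega, show N-(t+1) = N-1-t by omega] at this
    by_cases hrN1 : r = N - 1
    · have hle' : ∀ i, i < N → b i ≤ a i := by
        intro i hi
        have := hle (r-i) (by omega)
        rwa [show N-1-(r-i) = i by omega, show r-(r-i) = i by omega] at this
      -- element of a above β
      obtain ⟨l, hl, hl2⟩ : ∃ l, l ≤ j' ∧ ∀ k, k < N → b k ≠ a l := by
        by_contra hc
        push Not at hc
        apply pigeon (s := j'+1) (t := j') (a := b) (b := a) (ha.mono (by omega)) (by omega)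
        intro l hl
        obtain ⟨k, hk, he⟩ := hc l (by omega)
        refine ⟨k, ?_, he⟩
        apply hb.lt_of (by omega)
        have h5 := hle' j' hj'
        have h6 := g4 j' (by omega)
        have h7 := ha.le (i := l) (j := j') (by omega) (by omega)
        omega
      obtain ⟨q, hq, hqN, hq2⟩ : ∃ q, i' ≤ q ∧ q < N ∧ ∀ k, k < N → a k ≠ b q := by
        by_contra hc
        push Not at hc
        apply pigeon (s := N-i') (t := N-1-i') (a := fun l => a (i'+1+l)) (b := fun l => b (i'+l))
          (fun x y hxy hy => hb _ _ (by omega) (by omega)) (by omega)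
        intro q hq
        obtain ⟨k, hk, he⟩ := hc (i'+q) (by omega) (by omega)
        have : i' < k := by
          apply ha.lt_of (by omega)
          have h5 := hle' i' hi'
          have h6 := g3 i' (by omega)
          have h7 := hb.le (i := i') (j := i'+q) (by omega) (by omega)
          omega
        refine ⟨k-i'-1, by omega, ?_⟩
        rw [show i'+1+(k-i'-1) = k by omega]
        exact he
      have e1 : b q < a i' := by
        have h5 := hle' i' hi'
        have h6 := g3 i' (by omega)
        have h7 := hb.le (i := i') (j := q) (by omega) (by omega)
        omega
      have e2 : b j' < a l := by
        have h5 := hle' j' hj'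
        have h6 := g4 j' (by omega)
        have h7 := ha.le (i := l) (j := j') (by omega) (by omega)
        omega
      exact h2 (XX.down hqN hj' hi' (by omega) e1 g2 e2 hq2 (fun k hk => g4 k (by omega))
        (fun k hk => g3 k (by omega)) hl2)
    · have haN := ha.le (i := r+1) (j := N-1) (by omega) (by omega)
      have heq : ∀ t, t ≤ r - i' → b (N-1-t) = a (r-t) := by
        intro t
        induction t with
        | zero =>
          intro _
          by_contra hne
          have h5 := hle 0 (by omega)
          simp only [Nat.sub_zero] at h5 hne
          have h6 := hb (N-1) N (by omega) (by omega)
          have h7 := ha.le (i := i') (j := r) (by omega) (by omega)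
          refine h1 (XX.down (i := N-1) (j := N-1) (by omega) hi' (by omega) hj' (by omega)
            (by omega) g2 (fun k hk => ?_) (fun k hk => g3 k (by omega)) (fun k hk => ?_)
            (fun k hk => g4 k (by omega)))
          · have := hb.le (i := k) (j := N) (by omega) (by omega)
            omega
          · intro he
            have h8 := ha.lt_of (i := r) (j := k) (by omega) (by omega)
            have h9 := ha.le (i := r+1) (j := k) (by omega) (by omega)
            omega
        | succ t ih =>
          intro ht
          have hih := ih (by omega)
          by_contra hne
          have h5 := hle (t+1) (by omega)
          have h6 := hb (N-1-(t+1)) (N-1-t) (by omega) (by omega)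
          have h7 := ha.le (i := i') (j := r-(t+1)) (by omega) (by omega)
          have h10 := hb.le (i := N-1-t) (j := N) (by omega) (by omega)
          refine h1 (XX.down (i := N-1) (j := N-1-(t+1)) (by omega) hi' (by omega) hj' (by omega)
            (by omega) g2 (fun k hk => ?_) (fun k hk => g3 k (by omega)) (fun k hk => ?_)
            (fun k hk => g4 k (by omega)))
          · have := hb.le (i := k) (j := N) (by omega) (by omega)
            omega
          · intro he
            have h8 := ha.lt_of (i := r-(t+1)) (j := k) (by omega) (by omega)
            have h9 := ha.le (i := r-t) (j := k) (by omega) (by omega)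
            omega
      have := heq (r-i') le_rfl
      rw [show r - (r-i') = i' by omega] at this
      exact g3 _ (by omega) this
  have hs := Nat.find_spec hex
  refine ⟨r, Nat.find hex, hrN, hs.1, hs.2.1, hr1, hr2, ?_, hs.2.2⟩
  intro j hj1 hj2
  have := Nat.find_min hex hj2
  push Not at this
  exact this hj1 (by omega)

/-- existence of the special vector -/
def HasV (n : ℕ) (lam mu : ℕ → ℤ) : Prop :=
  ∀ (V : Type) [AddCommGroup V] [Module ℂ V] [FiniteDimensional ℂ V]
    (E : ℕ → ℕ → V →ₗ[ℂ] V) (ξ : V), IRep n E ξ lam →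
    ∃ v w, v ≠ 0 ∧ Wt n E w v ∧ (∃ i, i < n ∧ w i ≠ lam i) ∧ StarA n E mu v ∧ StarB n E mu v

lemma HasV.succ {N : ℕ} {lam mu : ℕ → ℤ} (hmu : ∀ i j, i < j → j < N+1 → mu j ≤ mu i)
    (h : HasV N lam mu) : HasV (N+1) lam mu := by
  intro V _ _ _ E ξ hI
  have hgl := hI.gl
  have hbd := hI.bd
  have hglN := hgl.mono (Nat.le_succ N)
  have hξK : ξ ∈ Kt N E ⊤ (lam N + (0:ℕ)) (mu N) := by
    refine ⟨trivial, by rw [hI.wt N (by omega)]; simp, fun i hi => ?_⟩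
    rw [hI.sing i N hi (by omega), smul_zero]
    unfold Sg
    apply Finset.sum_eq_zero
    intro a ha
    rw [hI.sing a N (Finset.mem_range.1 ha) (by omega), map_zero]
  have hsN := hI.sing.mono (Nat.le_succ N)
  have hwN := hI.wt.mono (Nat.le_succ N)
  have hC := hI.cls.kt hgl hbd hξK hI.ne hsN hwN
  have hst := Low.stb hglN hsN hwN
  obtain ⟨v, w, hv0, hvw, ⟨i, hi, hne⟩, hvA, hvB⟩ :=
    h _ _ _ (hC.irep hglN (hbd.mono (Nat.le_succ _)))
  have hvK : (v:V) ∈ Kt N E ⊤ (lam N + (0:ℕ)) (mu N) :=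
    Low.le_stb hξK (Kt.stb hgl hI.cls.stb) v.2
  have hvw := rE_wt hst hvw
  have hvA := rE_starA hst hvA
  have hvB := rE_starB hst hvB
  have hvw' := Kt.wt_last hvK hvw
  refine ⟨v, _, fun h0 => hv0 (Subtype.ext h0), hvw', ⟨i, by omega, ?_⟩,
    StarA.succ hvA hvK.2.2, ?_⟩
  · rwa [Function.update_of_ne (by omega)]
  · rcases N with _ | M
    · omega
    · refine StarB.succ hvB ?_
      intro k hk
      by_contra hne
      have h1 := hI.cls.last_ge hgl hbd trivial hne
        (hvw'.pow hgl (i := M) (j := M+1) (by omega) (by omega) k)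
      simp [shk] at h1
      have := hmu M (M+1) (by omega) (by omega)
      omega

theorem exst (n : ℕ) : ∀ lam mu : ℕ → ℤ, (∀ i j, i < j → j < n → lam j ≤ lam i) →
    (∀ i j, i < j → j < n → mu j ≤ mu i) →
    (XX n (ash lam) (ash mu) ∨ XX n (ash mu) (ash lam)) → HasV n lam mu ∨ HasV n mu lam := by
  induction n with
  | zero =>
    intro lam mu _ _ h
    rcases h with ⟨i, i', j, j', hi, _⟩ | ⟨i, i', j, j', hi, _⟩ <;> omega
  | succ N ih =>
    intro lam mu hlam hmu hX
    by_cases hN : XX N (ash lam) (ash mu) ∨ XX N (ash mu) (ash lam)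
    · rcases ih lam mu (fun i j hij hj => hlam i j hij (by omega))
        (fun i j hij hj => hmu i j hij (by omega)) hN with h | h
      · exact Or.inl (h.succ hmu)
      · exact Or.inr (h.succ hlam)
    · push Not at hN
      have main : ∀ lam mu : ℕ → ℤ, (∀ i j, i < j → j < N+1 → lam j ≤ lam i) →
          (∀ i j, i < j → j < N+1 → mu j ≤ mu i) →
          (XX (N+1) (ash lam) (ash mu) ∨ XX (N+1) (ash mu) (ash lam)) →
          ¬ XX N (ash lam) (ash mu) → ¬ XX N (ash mu) (ash lam) → ash lam N < ash mu N →
          HasV (N+1) lam mu := by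
        intro lam mu hlam hmu hX h1 h2 hlt
        obtain ⟨r, m, c1, c2, c3, c4, c5, c6, c7⟩ :=
          cross_data (SD.of_dom hlam) (SD.of_dom hmu) hX h1 h2 hlt
        intro V _ _ _ E ξ hI
        obtain ⟨v, w, d1, d2, d3, d4, d5⟩ :=
          lemS N V E ξ lam mu r m hmu hI c1 c2 c3 c4 c5 c6 c7
        exact ⟨v, w, d1, d2, ⟨N, by omega, by omega⟩, d4, d5⟩
      rcases lt_trichotomy (ash lam N) (ash mu N) with h | h | h
      · exact Or.inl (main lam mu hlam hmu hX hN.1 hN.2 h)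
      · rcases hX with hX | hX
        · exact absurd (XX.down_eq h hX) hN.1
        · exact absurd (XX.down_eq h.symm hX) hN.2
      · exact Or.inr (main mu lam hmu hlam hX.symm hN.2 hN.1 h)

open scoped TensorProduct

section C10
variable {V W : Type} [AddCommGroup V] [Module ℂ V] [AddCommGroup W] [Module ℂ W]
  {n : ℕ} {E : ℕ → ℕ → V →ₗ[ℂ] V} {F : ℕ → ℕ → W →ₗ[ℂ] W}

lemma T22_comm (hE : IsGL n E) (hF : IsGL n F) {i j k l : ℕ} (hi : i < n) (hj : j < n)
    (hk : k < n) (hl : l < n) (z : V ⊗[ℂ] W) :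
    T2 n E F i j (T2 n E F k l z) = T2 n E F k l (T2 n E F i j z) +
      T1 E F k j (T2 n E F i l z) - T2 n E F k j (T1 E F i l z) := by
  induction z using TensorProduct.induction_on with
  | zero => simp
  | add x y hx hy => simp only [map_add, hx, hy]; abel
  | tmul x y =>
    simp only [T2_tmul, T1_tmul, map_add, map_sum]
    have h1 : ∑ b ∈ Finset.range n, ∑ a ∈ Finset.range n,
          E i a (E k b x) ⊗ₜ[ℂ] F a j (F b l y) =
        ∑ b ∈ Finset.range n, ∑ a ∈ Finset.range n,
          (E k b (E i a x) ⊗ₜ[ℂ] F b l (F a j y) + E k b (E i a x) ⊗ₜ[ℂ] (if j = b then F a l y else 0)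
            - E k b (E i a x) ⊗ₜ[ℂ] (if l = a then F b j y else 0)
            + (if a = k then E i b x else 0) ⊗ₜ[ℂ] F a j (F b l y)
            - (if b = i then E k a x else 0) ⊗ₜ[ℂ] F a j (F b l y)) := by
      refine Finset.sum_congr rfl fun b hb => Finset.sum_congr rfl fun a ha => ?_
      rw [Finset.mem_range] at ha hb
      rw [hE i a k b hi ha hk hb x, TensorProduct.sub_tmul, TensorProduct.add_tmul]
      nth_rewrite 1 [hF a j b l ha hj hb hl y]
      rw [TensorProduct.tmul_sub, TensorProduct.tmul_add]
    rw [h1]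
    simp only [Finset.sum_add_distrib, Finset.sum_sub_distrib]
    have e1 : ∑ b ∈ Finset.range n, ∑ a ∈ Finset.range n,
        E k b (E i a x) ⊗ₜ[ℂ] (if j = b then F a l y else 0)
        = ∑ a ∈ Finset.range n, E k j (E i a x) ⊗ₜ[ℂ] F a l y := by
      rw [Finset.sum_comm]
      refine Finset.sum_congr rfl fun a _ => ?_
      rw [Finset.sum_eq_single j]
      · simp
      · intro b _ hb; simp [Ne.symm hb]
      · intro h; exact absurd (Finset.mem_range.2 hj) h
    have e2 : ∑ b ∈ Finset.range n, ∑ a ∈ Finset.range n,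
        E k b (E i a x) ⊗ₜ[ℂ] (if l = a then F b j y else 0)
        = ∑ b ∈ Finset.range n, E k b (E i l x) ⊗ₜ[ℂ] F b j y := by
      refine Finset.sum_congr rfl fun a _ => ?_
      rw [Finset.sum_eq_single l]
      · simp
      · intro b _ hb; simp [Ne.symm hb]
      · intro h; exact absurd (Finset.mem_range.2 hl) h
    have e3 : ∑ b ∈ Finset.range n, ∑ a ∈ Finset.range n,
        (if a = k then E i b x else 0) ⊗ₜ[ℂ] F a j (F b l y)
        = ∑ b ∈ Finset.range n, E i b x ⊗ₜ[ℂ] F k j (F b l y) := by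
      refine Finset.sum_congr rfl fun a _ => ?_
      rw [Finset.sum_eq_single k]
      · simp
      · intro b _ hb; simp [hb]
      · intro h; exact absurd (Finset.mem_range.2 hk) h
    have e4 : ∑ b ∈ Finset.range n, ∑ a ∈ Finset.range n,
        (if b = i then E k a x else 0) ⊗ₜ[ℂ] F a j (F b l y)
        = ∑ a ∈ Finset.range n, E k a x ⊗ₜ[ℂ] F a j (F i l y) := by
      rw [Finset.sum_comm]
      refine Finset.sum_congr rfl fun a _ => ?_
      rw [Finset.sum_eq_single i]
      · simp
      · intro b _ hb; simp [hb]
      · intro h; exact absurd (Finset.mem_range.2 hi) h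
    rw [e1, e2, e3, e4]
    rw [Finset.sum_comm]
    abel

/-- Words in the Yangian generators applied to a vector, with their filtration degree. -/
inductive Wd (n : ℕ) (E : ℕ → ℕ → V →ₗ[ℂ] V) (F : ℕ → ℕ → W →ₗ[ℂ] W) (Ξ : V ⊗[ℂ] W) :
    ℕ → V ⊗[ℂ] W → Prop
  | base : Wd n E F Ξ 0 Ξ
  | t1 (m i j : ℕ) (y : V ⊗[ℂ] W) : i < n → j < n → Wd n E F Ξ m y →
      Wd n E F Ξ (m+1) (T1 E F i j y)
  | t2 (m i j : ℕ) (y : V ⊗[ℂ] W) : i < n → j < n → Wd n E F Ξ m y →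
      Wd n E F Ξ (m+2) (T2 n E F i j y)

def WS (n : ℕ) (E : ℕ → ℕ → V →ₗ[ℂ] V) (F : ℕ → ℕ → W →ₗ[ℂ] W) (Ξ : V ⊗[ℂ] W) (m : ℕ) :
    Submodule ℂ (V ⊗[ℂ] W) := Submodule.span ℂ {y | ∃ k, k ≤ m ∧ Wd n E F Ξ k y}

variable {Ξ : V ⊗[ℂ] W}

lemma WS.mem {m k : ℕ} {y : V ⊗[ℂ] W} (h : Wd n E F Ξ k y) (hk : k ≤ m) : y ∈ WS n E F Ξ m :=
  Submodule.subset_span ⟨k, hk, h⟩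

lemma WS.t1 {m i j : ℕ} (hi : i < n) (hj : j < n) {y : V ⊗[ℂ] W} (h : y ∈ WS n E F Ξ m) :
    T1 E F i j y ∈ WS n E F Ξ (m+1) := by
  have : WS n E F Ξ m ≤ (WS n E F Ξ (m+1)).comap (T1 E F i j) := by
    rw [WS, Submodule.span_le]
    rintro y ⟨k, hk, hy⟩
    exact WS.mem (hy.t1 _ _ _ _ hi hj) (by omega)
  exact this h

lemma WS.t2 {m i j : ℕ} (hi : i < n) (hj : j < n) {y : V ⊗[ℂ] W} (h : y ∈ WS n E F Ξ m) :
    T2 n E F i j y ∈ WS n E F Ξ (m+2) := by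
  have : WS n E F Ξ m ≤ (WS n E F Ξ (m+2)).comap (T2 n E F i j) := by
    rw [WS, Submodule.span_le]
    rintro y ⟨k, hk, hy⟩
    exact WS.mem (hy.t2 _ _ _ _ hi hj) (by omega)
  exact this h

lemma Wd.push (hE : IsGL n E) (hF : IsGL n F)
    (h1 : ∀ i j, i ≤ j → j < n → ∃ c : ℂ, T1 E F i j Ξ = c • Ξ)
    (h2 : ∀ i j, i ≤ j → j < n → ∃ c : ℂ, T2 n E F i j Ξ = c • Ξ) {m : ℕ} {y : V ⊗[ℂ] W}
    (h : Wd n E F Ξ m y) : ∀ i j, i ≤ j → j < n →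
      T1 E F i j y ∈ WS n E F Ξ m ∧ T2 n E F i j y ∈ WS n E F Ξ (m+1) := by
  induction h with
  | base =>
    intro i j hij hj
    obtain ⟨c, hc⟩ := h1 i j hij hj
    obtain ⟨d, hd⟩ := h2 i j hij hj
    rw [hc, hd]
    exact ⟨Submodule.smul_mem _ _ (WS.mem .base le_rfl),
      Submodule.smul_mem _ _ (WS.mem .base (by omega))⟩
  | t1 m k l y hk hl hy ih =>
    intro i j hij hj
    have hi : i < n := by omega
    obtain ⟨a1, a2⟩ := ih i j hij hj
    have hy' : y ∈ WS n E F Ξ m := WS.mem hy le_rfl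
    constructor
    · rw [T1_gl hE hF i j k l hi hj hk hl]
      refine Submodule.sub_mem _ (Submodule.add_mem _ (WS.t1 hk hl a1) ?_) ?_
      · split_ifs
        · exact WS.t1 hi hl hy'
        · exact Submodule.zero_mem _
      · split_ifs
        · exact WS.t1 hk hj hy'
        · exact Submodule.zero_mem _
    · have := T12_comm hE hF hk hl hi hj y
      rw [show T2 n E F i j (T1 E F k l y) = T1 E F k l (T2 n E F i j y)
        - (if l = i then T2 n E F k j y else 0) + (if j = k then T2 n E F i l y else 0) by
          rw [this]; abel]
      refine Submodule.add_mem _ (Submodule.sub_mem _ (WS.t1 hk hl a2) ?_) ?_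
      · split_ifs
        · exact WS.t2 hk hj hy'
        · exact Submodule.zero_mem _
      · split_ifs
        · exact WS.t2 hi hl hy'
        · exact Submodule.zero_mem _
  | t2 m k l y hk hl hy ih =>
    intro i j hij hj
    have hi : i < n := by omega
    obtain ⟨a1, a2⟩ := ih i j hij hj
    have hy' : y ∈ WS n E F Ξ m := WS.mem hy le_rfl
    constructor
    · rw [T12_comm hE hF hi hj hk hl]
      refine Submodule.sub_mem _ (Submodule.add_mem _ (WS.t2 hk hl a1) ?_) ?_
      · split_ifs
        · exact WS.t2 hi hl hy'
        · exact Submodule.zero_mem _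
      · split_ifs
        · exact WS.t2 hk hj hy'
        · exact Submodule.zero_mem _
    · rw [T22_comm hE hF hi hj hk hl]
      refine Submodule.sub_mem _ (Submodule.add_mem _ (WS.t2 hk hl a2) ?_) ?_
      · exact WS.t1 hk hj (WS.t2 hi hl hy')
      · exact WS.t2 hk hj (WS.t1 hi hl hy')

lemma WS.ker (hE : IsGL n E) (hF : IsGL n F)
    (h1 : ∀ i j, i ≤ j → j < n → ∃ c : ℂ, T1 E F i j Ξ = c • Ξ)
    (h2 : ∀ i j, i ≤ j → j < n → ∃ c : ℂ, T2 n E F i j Ξ = c • Ξ)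
    (ψ : V ⊗[ℂ] W →ₗ[ℂ] ℂ) (h0 : ψ Ξ = 0)
    (g1 : ∀ i j, j < i → i < n → ∀ z, ψ (T1 E F i j z) = 0)
    (g2 : ∀ i j, j < i → i < n → ∀ z, ψ (T2 n E F i j z) = 0) (m : ℕ) :
    WS n E F Ξ m ≤ LinearMap.ker ψ := by
  induction m using Nat.strong_induction_on with
  | _ m ih =>
    rw [WS, Submodule.span_le]
    rintro y ⟨k, hk, hy⟩
    cases hy with
    | base => exact h0
    | t1 m' i j y hi hj hy =>
      by_cases hij : i ≤ j
      · exact ih m' (by omega) (hy.push hE hF h1 h2 i j hij hj).1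
      · exact g1 i j (by omega) hi y
    | t2 m' i j y hi hj hy =>
      by_cases hij : i ≤ j
      · exact ih (m'+1) (by omega) (hy.push hE hF h1 h2 i j hij hj).2
      · exact g2 i j (by omega) hi y

lemma not_YI_of_ker (hE : IsGL n E) (hF : IsGL n F) (hΞ : Ξ ≠ 0)
    (h1 : ∀ i j, i ≤ j → j < n → ∃ c : ℂ, T1 E F i j Ξ = c • Ξ)
    (h2 : ∀ i j, i ≤ j → j < n → ∃ c : ℂ, T2 n E F i j Ξ = c • Ξ)
    (ψ : V ⊗[ℂ] W →ₗ[ℂ] ℂ) (h0 : ψ Ξ = 0) (hψ : ψ ≠ 0)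
    (g1 : ∀ i j, j < i → i < n → ∀ z, ψ (T1 E F i j z) = 0)
    (g2 : ∀ i j, j < i → i < n → ∀ z, ψ (T2 n E F i j z) = 0) : ¬ YI n E F := by
  intro hY
  let U : Submodule ℂ (V ⊗[ℂ] W) := Submodule.span ℂ {y | ∃ k, Wd n E F Ξ k y}
  have hU : U ≤ LinearMap.ker ψ := by
    rw [Submodule.span_le]
    rintro y ⟨k, hy⟩
    exact WS.ker hE hF h1 h2 ψ h0 g1 g2 k (WS.mem hy le_rfl)
  have s1 : Stb n (T1 E F) U := by
    intro i j hi hj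
    have : U ≤ U.comap (T1 E F i j) := by
      rw [Submodule.span_le]
      rintro y ⟨k, hy⟩
      exact Submodule.subset_span ⟨_, hy.t1 _ _ _ _ hi hj⟩
    exact fun y hy => this hy
  have s2 : Stb n (T2 n E F) U := by
    intro i j hi hj
    have : U ≤ U.comap (T2 n E F i j) := by
      rw [Submodule.span_le]
      rintro y ⟨k, hy⟩
      exact Submodule.subset_span ⟨_, hy.t2 _ _ _ _ hi hj⟩
    exact fun y hy => this hy
  have hm : Ξ ∈ U := Submodule.subset_span ⟨0, .base⟩
  rcases hY U s1 s2 with h | h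
  · rw [h] at hm
    exact hΞ ((Submodule.mem_bot ℂ).1 hm)
  · rw [h] at hU
    exact hψ (LinearMap.ker_eq_top.1 (top_le_iff.1 hU))

theorem thmR [FiniteDimensional ℂ V] [FiniteDimensional ℂ W] {ξ : V} {η : W} {lam mu w : ℕ → ℤ}
    (hE : IRep n E ξ lam) (hF : IRep n F η mu) {v : Module.Dual ℂ W} (hv : v ≠ 0)
    (hw : Wt n (dE F) w v) (hne : ∃ i, i < n ∧ w i ≠ mu i) (hA : StarA n (dE F) lam v)
    (hB : StarB n (dE F) lam v) : ¬ YI n E F := by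
  let L : ℕ → ℕ → Module.Dual ℂ W →ₗ[ℂ] Module.Dual ℂ W := fun i j => - dE F j i
  have hL : NM n L := by
    intro i j k l hji hi hlk hk x
    have := hF.gl.dual (n := n) j i l k (by omega) hi (by omega) hk x
    simp only [L, LinearMap.neg_apply, map_neg, neg_neg]
    rw [this]
    by_cases c1 : i = l <;> by_cases c2 : k = j
    · omega
    · simp [c1, c2, Ne.symm c2]
    · simp [c1, c2, Ne.symm c1, sub_eq_add_neg]
    · simp [c1, c2, Ne.symm c1, Ne.symm c2]
  obtain ⟨Φ, hΦ, hΦL⟩ := lemA (F := E) (L := L) (v := v) hE.ne n hE.gl hE.sing hE.wt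
    (fun p hp => hE.pow_zero hp) hL
    (by
      intro p m hp hm
      have : L (p+1) p = (-1 : ℂ) • dE F p (p+1) := by
        ext φ x
        show - (dE F p (p+1) φ x) = (-1:ℂ) * (dE F p (p+1) φ x)
        ring
      rw [this, smul_pow, LinearMap.smul_apply, hB p hp (m+1) (by push_cast; omega), smul_zero])
  have hΦL' : ∀ i j, j < i → i < n → ∀ x y, Φ (E i j x) y = - Φ x (F i j y) := by
    intro i j hji hi x y
    rw [hΦL i j hji hi x (by rw [hE.low]; trivial)]
    rfl
  let ψ : V ⊗[ℂ] W →ₗ[ℂ] ℂ := TensorProduct.lift Φ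
  have ψt : ∀ x y, ψ (x ⊗ₜ y) = Φ x y := fun x y => TensorProduct.lift.tmul x y
  have g1 : ∀ i j, j < i → i < n → ∀ z, ψ (T1 E F i j z) = 0 := by
    intro i j hji hi z
    induction z using TensorProduct.induction_on with
    | zero => simp
    | add x y hx hy => rw [map_add, map_add, hx, hy, add_zero]
    | tmul x y => rw [T1_tmul, map_add, ψt, ψt, hΦL' i j hji hi]; ring
  have g2a : ∀ x : V, ∀ i j, j < i → i < n → ∀ y, ψ (T2 n E F i j (x ⊗ₜ y)) = 0 := by
    let Q : Submodule ℂ V :=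
      { carrier := {x | ∀ i j, j < i → i < n → ∀ y, ψ (T2 n E F i j (x ⊗ₜ y)) = 0}
        zero_mem' := by intro i j _ _ y; simp
        add_mem' := by
          intro a b ha hb i j hji hi y
          rw [TensorProduct.add_tmul, map_add, map_add, ha i j hji hi, hb i j hji hi, add_zero]
        smul_mem' := by
          intro c a ha i j hji hi y
          rw [← TensorProduct.smul_tmul', map_smul, map_smul, ha i j hji hi, smul_zero] }
    have hQ : Low n E ξ ≤ Q := by
      apply Low.le
      · intro i j hji hi y
        rw [T2_tmul, map_sum]
        simp only [ψt]
        have hs := congrArg (fun φ : Module.Dual ℂ W => φ y) (hA j i hji hi)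
        simp only [Sg, LinearMap.sum_apply, dE_apply, LinearMap.smul_apply, smul_eq_mul] at hs
        rw [← Finset.sum_subset (Finset.range_subset_range.2 (Nat.succ_le_of_lt hi)),
          Finset.sum_range_succ]
        · rw [hE.wt i hi, map_smul, LinearMap.smul_apply, smul_eq_mul, hΦ, ← hs,
            ← Finset.sum_add_distrib]
          apply Finset.sum_eq_zero
          intro a ha
          rw [Finset.mem_range] at ha
          rw [hΦL' i a ha hi, hΦ]; ring
        · intro a ha ha'
          simp only [Finset.mem_range] at ha ha'
          rw [hE.sing i a (by omega) ha, map_zero, LinearMap.zero_apply]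
      · intro k l hlk hk x _ hx i j hji hi y
        have := T12_comm hE.gl hF.gl hk (by omega : l < n) hi (by omega : j < n) (x ⊗ₜ[ℂ] y)
        rw [T1_tmul, map_add] at this
        have e := congrArg ψ this
        rw [map_sub, map_add, map_add, g1 k l hlk hk, hx i j hji hi] at e
        have z1 : ψ (if l = i then T2 n E F k j (x ⊗ₜ[ℂ] y) else 0) = 0 := by
          split_ifs with c
          · exact hx k j (by omega) hk y
          · simp
        have z2 : ψ (if j = k then T2 n E F i l (x ⊗ₜ[ℂ] y) else 0) = 0 := by
          split_ifs with c
          · exact hx i l (by omega) hi y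
          · simp
        rw [z1, z2] at e
        simpa using e.symm
    intro x
    have : x ∈ Low n E ξ := by rw [hE.low]; trivial
    exact hQ this
  have g2 : ∀ i j, j < i → i < n → ∀ z, ψ (T2 n E F i j z) = 0 := by
    intro i j hji hi z
    induction z using TensorProduct.induction_on with
    | zero => simp
    | add x y hx hy => rw [map_add, map_add, hx, hy, add_zero]
    | tmul x y => exact g2a x i j hji hi y
  refine not_YI_of_ker (Ξ := ξ ⊗ₜ[ℂ] η) hE.gl hF.gl ?_ ?_ ?_ ψ ?_ ?_ g1 g2
  · intro h
    obtain ⟨f, hf⟩ := Module.Projective.exists_dual_ne_zero ℂ hF.ne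
    have e := congrArg (ctr f) h
    rw [ctr_tmul, map_zero, smul_eq_zero] at e
    exact e.elim hf hE.ne
  · intro i j hij hj
    rw [T1_tmul]
    rcases hij.lt_or_eq with h | rfl
    · exact ⟨0, by rw [hE.sing i j h hj, hF.sing i j h hj]; simp⟩
    · exact ⟨(lam i : ℂ) + mu i, by
        rw [hE.wt i hj, hF.wt i hj, TensorProduct.tmul_smul, ← TensorProduct.smul_tmul', add_smul]⟩
  · intro i j hij hj
    rw [T2_tmul]
    refine ⟨if i = j then (lam i : ℂ) * mu i else 0, ?_⟩
    rw [Finset.sum_eq_single i]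
    · rcases hij.lt_or_eq with h | rfl
      · rw [hF.sing i j h hj, if_neg (by omega)]; simp
      · rw [hE.wt i hj, hF.wt i hj, TensorProduct.tmul_smul, ← TensorProduct.smul_tmul', if_pos rfl,
          smul_smul, mul_comm]
    · intro a ha hai
      rw [Finset.mem_range] at ha
      rcases lt_or_gt_of_ne hai with h | h
      · rw [hF.sing a j (by omega) hj, TensorProduct.tmul_zero]
      · rw [hE.sing i a h ha, TensorProduct.zero_tmul]
    · intro h
      exact absurd (Finset.mem_range.2 (by omega)) h
  · rw [ψt, hΦ]
    obtain ⟨i, hi, hne⟩ := hne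
    have e := congrArg (fun φ : Module.Dual ℂ W => φ η) (hw i hi)
    simp only [dE_apply, LinearMap.smul_apply] at e
    rw [hF.wt i hi, map_smul, ← sub_eq_zero, ← sub_smul, smul_eq_zero] at e
    rcases e with e | e
    · exfalso
      apply hne
      have : (mu i : ℂ) = w i := sub_eq_zero.1 e
      exact_mod_cast this.symm
    · exact e
  · intro h
    apply hv
    ext y
    rw [← hΦ, ← ψt, h]; rfl

theorem red_of_XX [FiniteDimensional ℂ V] [FiniteDimensional ℂ W] {ξ : V} {η : W} {lam mu : ℕ → ℤ}
    (hE : IRep n E ξ lam) (hF : IRep n F η mu)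
    (hX : XX n (ash lam) (ash mu) ∨ XX n (ash mu) (ash lam)) : ¬ YI n E F := by
  obtain ⟨ξ1, hE1, -⟩ := hE.dual
  obtain ⟨η1, hF1, -⟩ := hF.dual
  obtain ⟨ξ2, hE2, -⟩ := hE1.dual
  rcases exst n lam mu (fun i j hij hj => hE.dom hij hj) (fun i j hij hj => hF.dom hij hj) hX
    with h | h
  · obtain ⟨v, w, hv, hw, hne, hA, hB⟩ := h _ _ _ hE2
    exact fun hY => thmR hF1 hE1 hv hw hne hA hB hY.dual'
  · obtain ⟨v, w, hv, hw, hne, hA, hB⟩ := h _ _ _ hF1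
    exact thmR hE hF hv hw hne hA hB
end C10

open scoped TensorProduct

section C13
variable {n : ℕ}

/-- extension by zero to natural number indices. -/
noncomputable def xE {V : Type} [AddCommGroup V] [Module ℂ V] (E : Fin n → Fin n → (V →ₗ[ℂ] V)) :
    ℕ → ℕ → V →ₗ[ℂ] V :=
  fun i j => if h : i < n ∧ j < n then E ⟨i, h.1⟩ ⟨j, h.2⟩ else 0

def xw (lam : Fin n → ℤ) : ℕ → ℤ := fun i => if h : i < n then lam ⟨i, h⟩ else 0

lemma xE_fin {V : Type} [AddCommGroup V] [Module ℂ V] (E : Fin n → Fin n → (V →ₗ[ℂ] V))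
    (i j : Fin n) : xE E i j = E i j := by simp [xE]

lemma xw_fin (lam : Fin n → ℤ) (i : Fin n) : xw lam i = lam i := by simp [xw]

lemma GLRep.irep {lam : Fin n → ℤ} (A : GLRep n (fun i => (lam i : ℂ))) :
    IRep n (xE A.E) A.hv (xw lam) where
  gl := by
    intro i j k l hi hj hk hl x
    have := congrArg (fun f : A.V →ₗ[ℂ] A.V => f x) (A.commRel ⟨i, hi⟩ ⟨j, hj⟩ ⟨k, hk⟩ ⟨l, hl⟩)
    simp only [LinearMap.sub_apply, LinearMap.comp_apply, Fin.mk.injEq] at this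
    simp only [xE, hi, hj, hk, hl, and_self, dif_pos]
    rw [sub_eq_iff_eq_add] at this
    rw [this]
    split_ifs <;> (try simp only [LinearMap.zero_apply]) <;> abel
  ne := A.hv_ne
  sing := by
    intro i j hij hj
    have hi : i < n := by omega
    simp only [xE, hi, hj, and_self, dif_pos]
    exact A.hv_upper _ _ hij
  wt := by
    intro i hi
    simp only [xE, xw, hi, and_self, dif_pos]
    exact A.hv_diag ⟨i, hi⟩
  irr := by
    intro U hU
    apply A.irreducible U
    intro i j v hv
    have := hU i j i.2 j.2 v hv
    rwa [xE_fin] at this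

lemma T1_fin {lam mu : Fin n → ℂ} (A : GLRep n lam) (B : GLRep n mu) (i j : Fin n) :
    T1 (xE A.E) (xE B.E) i j = t1 A B i j := by
  simp only [T1, t1, xE_fin]

lemma T2_fin {lam mu : Fin n → ℂ} (A : GLRep n lam) (B : GLRep n mu) (i j : Fin n) :
    T2 n (xE A.E) (xE B.E) i j = t2 A B i j := by
  rw [T2, t2, Finset.sum_range]
  simp only [xE_fin]

lemma yi_iff {lam mu : Fin n → ℂ} (A : GLRep n lam) (B : GLRep n mu) :
    YangianIrred2 A B ↔ YI n (xE A.E) (xE B.E) := by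
  constructor
  · intro h U h1 h2
    refine h U ?_ ?_
    · intro i j v hv
      rw [← T1_fin]; exact h1 i j i.2 j.2 v hv
    · intro i j v hv
      rw [← T2_fin]; exact h2 i j i.2 j.2 v hv
  · intro h U h1 h2
    refine h U ?_ ?_
    · intro i j hi hj v hv
      have := h1 ⟨i, hi⟩ ⟨j, hj⟩ v hv
      rwa [← T1_fin] at this
    · intro i j hi hj v hv
      have := h2 ⟨i, hi⟩ ⟨j, hj⟩ v hv
      rwa [← T2_fin] at this

lemma mem_Aset {lam : Fin n → ℤ} {a : ℤ} : a ∈ Aset n lam ↔ ∃ i, i < n ∧ ash (xw lam) i = a := by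
  simp only [Aset, Finset.mem_image, Finset.mem_univ, true_and]
  constructor
  · rintro ⟨i, rfl⟩
    exact ⟨i, i.2, by rw [ash, xw_fin]⟩
  · rintro ⟨i, hi, rfl⟩
    exact ⟨⟨i, hi⟩, by simp [ash, xw, hi]⟩

lemma mem_Adiff {lam mu : Fin n → ℤ} {a : ℤ} : a ∈ Aset n lam \ Aset n mu ↔
    ∃ i, i < n ∧ ash (xw lam) i = a ∧ ∀ k, k < n → ash (xw mu) k ≠ ash (xw lam) i := by
  rw [Finset.mem_sdiff, mem_Aset, mem_Aset]
  constructor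
  · rintro ⟨⟨i, hi, rfl⟩, h⟩
    exact ⟨i, hi, rfl, fun k hk e => h ⟨k, hk, e⟩⟩
  · rintro ⟨i, hi, rfl, h⟩
    exact ⟨⟨i, hi, rfl⟩, fun ⟨k, hk, e⟩ => h k hk e⟩

lemma crossing_iff (lam mu : Fin n → ℤ) :
    CrossingSets (Aset n lam \ Aset n mu) (Aset n mu \ Aset n lam) ↔
      (XX n (ash (xw lam)) (ash (xw mu)) ∨ XX n (ash (xw mu)) (ash (xw lam))) := by
  constructor
  · rintro (⟨a₁, h1, a₂, h2, b₁, h3, b₂, h4, l1, l2, l3⟩ | ⟨a₁, h1, a₂, h2, b₁, h3, b₂, h4, l1, l2, l3⟩)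
    · rw [mem_Adiff] at h1 h2 h3 h4
      obtain ⟨i, hi, rfl, ni⟩ := h1
      obtain ⟨i', hi', rfl, ni'⟩ := h2
      obtain ⟨j, hj, rfl, nj⟩ := h3
      obtain ⟨j', hj', rfl, nj'⟩ := h4
      exact Or.inl ⟨i, i', j, j', hi, hi', hj, hj', l1, l2, l3, ni, ni', nj, nj'⟩
    · rw [mem_Adiff] at h1 h2 h3 h4
      obtain ⟨i, hi, rfl, ni⟩ := h1
      obtain ⟨i', hi', rfl, ni'⟩ := h2
      obtain ⟨j, hj, rfl, nj⟩ := h3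
      obtain ⟨j', hj', rfl, nj'⟩ := h4
      exact Or.inr ⟨j, j', i, i', hj, hj', hi, hi', l1, l2, l3, nj, nj', ni, ni'⟩
  · rintro (⟨i, i', j, j', hi, hi', hj, hj', l1, l2, l3, ni, ni', nj, nj'⟩ |
      ⟨j, j', i, i', hj, hj', hi, hi', l1, l2, l3, nj, nj', ni, ni'⟩)
    · exact Or.inl ⟨_, mem_Adiff.2 ⟨i, hi, rfl, ni⟩, _, mem_Adiff.2 ⟨i', hi', rfl, ni'⟩,
        _, mem_Adiff.2 ⟨j, hj, rfl, nj⟩, _, mem_Adiff.2 ⟨j', hj', rfl, nj'⟩, l1, l2, l3⟩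
    · exact Or.inr ⟨_, mem_Adiff.2 ⟨i, hi, rfl, ni⟩, _, mem_Adiff.2 ⟨i', hi', rfl, ni'⟩,
        _, mem_Adiff.2 ⟨j, hj, rfl, nj⟩, _, mem_Adiff.2 ⟨j', hj', rfl, nj'⟩, l1, l2, l3⟩

end C13

/-- For `gl_n`-highest weights `λ`, `μ` with integer entries,
the `Y(gl_n)`-module `L(λ) ⊗ L(μ)` is irreducible if and only if the sets
`A_λ \ A_μ` and `A_μ \ A_λ` are non-crossing. -/
theorem tensorEval_irreducible_iff_nonCrossing
    (n : ℕ) (hn : 1 ≤ n) (lam mu : Fin n → ℤ)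
    (hlam : ∀ i : Fin n, ∀ h : (i : ℕ) + 1 < n, 0 ≤ lam i - lam ⟨(i : ℕ) + 1, h⟩)
    (hmu : ∀ i : Fin n, ∀ h : (i : ℕ) + 1 < n, 0 ≤ mu i - mu ⟨(i : ℕ) + 1, h⟩)
    (A : GLRep n (fun i => (lam i : ℂ))) (B : GLRep n (fun i => (mu i : ℂ))) :
    YangianIrred2 A B ↔
      ¬ CrossingSets (Aset n lam \ Aset n mu) (Aset n mu \ Aset n lam) := by
  rw [yi_iff, crossing_iff]
  constructor
  · intro hY hX
    exact red_of_XX A.irep B.irep hX hY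
  · intro hX
    exact irred_of_not_XX A.irep B.irep (fun h => hX (Or.inl h)) (fun h => hX (Or.inr h))
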